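/- Let n ≥ 1, let 0 < p < q < ∞ with α := n(1/p − 1/q) ≤ 1, and let g be a holomorphic function on B_n. Then J_g is bounded from H^p to H^q (i.e. there exists C > 0 with ‖J_g f‖_{H^q} ≤ C‖f‖_{H^p} for every f ∈ H^p) if and only if g ∈ Λ(α). Moreover, the least such constant C is comparable to ‖g‖_{Λ(α)} = sup_{z∈B_n} (1−|z|²)^{1−α}|Rg(z)|, with comparison constants depending only on n, p and q. -/

import Mathlib

open MeasureTheory Metric Set Filter
open scoped ENNReal NNReal Topology

noncomputable section

/-- ℂⁿ with its Euclidean (Hermitian) structure. -/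
abbrev En (n : ℕ) := EuclideanSpace ℂ (Fin n)

instance (n : ℕ) : MeasurableSpace (En n) := borel _
instance (n : ℕ) : BorelSpace (En n) := ⟨rfl⟩

/-- The open unit ball `B_n` of ℂⁿ. -/
def Bn (n : ℕ) : Set (En n) := Metric.ball 0 1

/-- The unit sphere `S_n = ∂B_n`. -/
def Sn (n : ℕ) : Set (En n) := Metric.sphere 0 1

/-- The Hermitian inner product `⟨z,w⟩ = ∑ z_k * conj (w_k)`. -/
def herm {n : ℕ} (z w : En n) : ℂ := ∑ k, z k * (starRingEnd ℂ) (w k)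

/-- The surface measure on the unit sphere, normalized so that `σ(S_n) = 1`
(the `(2n-1)`-dimensional Hausdorff measure restricted to the sphere, normalized). -/
def sigmaS (n : ℕ) : Measure (En n) :=
  ((μH[(2 * n - 1 : ℝ)] (Sn n))⁻¹) • (μH[(2 * n - 1 : ℝ)]).restrict (Sn n)

/-- Lebesgue measure on the unit ball, normalized so that `v(B_n) = 1`. -/
def volN (n : ℕ) : Measure (En n) :=
  ((volume (Bn n))⁻¹) • volume.restrict (Bn n)

/-- The radial derivative `Rg(z) = ∑ z_k ∂g/∂z_k (z) = (Dg)(z)[z]`. -/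
def radD {n : ℕ} (g : En n → ℂ) (z : En n) : ℂ := fderiv ℂ g z z

/-- The Volterra-type integration operator `J_g f(z) = ∫₀¹ f(tz) Rg(tz) dt/t`. -/
def J {n : ℕ} (g f : En n → ℂ) (z : En n) : ℂ :=
  ∫ t in Set.Ioo (0 : ℝ) 1, f (t • z) * radD g (t • z) / (t : ℂ)

/-- The Hardy space quasinorm `‖f‖_{H^p}`, with values in `ℝ≥0∞`:
`‖f‖_{H^p}^p = sup_{0<r<1} ∫_{S_n} |f(rζ)|^p dσ(ζ)`. -/
def hNorm (n : ℕ) (p : ℝ) (f : En n → ℂ) : ℝ≥0∞ :=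
  (⨆ r ∈ Set.Ioo (0 : ℝ) 1,
    ∫⁻ ζ, (‖f (r • ζ)‖₊ : ℝ≥0∞) ^ p ∂(sigmaS n)) ^ (1 / p)

/-- Membership in the Hardy space `H^p(B_n)`. -/
def MemHp (n : ℕ) (p : ℝ) (f : En n → ℂ) : Prop :=
  DifferentiableOn ℂ f (Bn n) ∧ hNorm n p f < ⊤

/-- The Carleson box `B_δ(ζ) = {z ∈ B_n : |1 - ⟨z,ζ⟩| < δ}`. -/
def cBox {n : ℕ} (ζ : En n) (δ : ℝ) : Set (En n) :=
  {z ∈ Bn n | ‖(1 : ℂ) - herm z ζ‖ < δ}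

/-- The measure `dμ_g(z) = |Rg(z)|²(1-|z|²) dv(z)`. -/
def muJ (n : ℕ) (g : En n → ℂ) : Measure (En n) :=
  (volN n).withDensity
    (fun z => (‖radD g z‖₊ : ℝ≥0∞) ^ 2 * ENNReal.ofReal (1 - ‖z‖ ^ 2))

/-- The admissible approach region `Γ_α(ζ) = {z ∈ B_n : |1-⟨z,ζ⟩| < (α/2)(1-|z|²)}`. -/
def Gam {n : ℕ} (α : ℝ) (ζ : En n) : Set (En n) :=
  {z ∈ Bn n | ‖(1 : ℂ) - herm z ζ‖ < α / 2 * (1 - ‖z‖ ^ 2)}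

open Classical in
/-- The involutive automorphism `φ_a` of the unit ball interchanging `0` and `a`:
`φ_a(z) = (a - P_a z - √(1-|a|²) (z - P_a z)) / (1 - ⟨z,a⟩)`, where `P_a` is the
orthogonal projection onto `ℂa`. -/
def mob {n : ℕ} (a z : En n) : En n :=
  if a = 0 then -z
  else ((1 : ℂ) - herm z a)⁻¹ •
    ((a - (herm z a / herm a a) • a) -
      ((Real.sqrt (1 - ‖a‖ ^ 2) : ℂ)) • (z - (herm z a / herm a a) • a))

/-- The norm of the invariant (real) gradient `∇̃f(z) = ∇(f ∘ φ_z)(0)`. -/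
def invGrad {n : ℕ} {F : Type*} [NormedAddCommGroup F] [NormedSpace ℝ F]
    (f : En n → F) (z : En n) : ℝ :=
  ‖fderiv ℝ (fun w => f (mob z w)) 0‖

/-- The invariant measure `dλ_n(z) = (1-|z|²)^{-(n+1)} dv(z)`. -/
def lamN (n : ℕ) : Measure (En n) :=
  (volN n).withDensity (fun z => ENNReal.ofReal ((1 - ‖z‖ ^ 2) ^ (-(n + 1 : ℝ))))

/-- The invariant Poisson integral `u_φ(z) = ∫_{S_n} φ(ζ) (1-|z|²)ⁿ/|1-⟨z,ζ⟩|^{2n} dσ(ζ)`. -/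
def poisson (n : ℕ) (φ : En n → ℝ) (z : En n) : ℝ :=
  ∫ ζ, φ ζ * ((1 - ‖z‖ ^ 2) ^ n / ‖(1 : ℂ) - herm z ζ‖ ^ (2 * n)) ∂(sigmaS n)

/-- The function `μ̃(ζ) = ∫_{Γ_α(ζ)} (1-|z|²)^{-n} dμ(z)`. -/
def tildeMu (n : ℕ) (α : ℝ) (μ : Measure (En n)) (ζ : En n) : ℝ≥0∞ :=
  ∫⁻ z in Gam α ζ, ENNReal.ofReal ((1 - ‖z‖ ^ 2) ^ (-(n : ℝ))) ∂μ

/-- The `L^{p/(p-s)}(S_n)`-norm of `μ̃`. -/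
def tildeMuNorm (n : ℕ) (α p s : ℝ) (μ : Measure (En n)) : ℝ≥0∞ :=
  (∫⁻ ζ, tildeMu n α μ ζ ^ (p / (p - s)) ∂(sigmaS n)) ^ ((p - s) / p)


/-- The Lipschitz-type norm `‖g‖_{Λ(α)} = sup_{z ∈ B_n} (1-|z|²)^{1-α} |Rg(z)|`. -/
def lipNorm (n : ℕ) (α : ℝ) (g : En n → ℂ) : ℝ≥0∞ :=
  ⨆ z ∈ Bn n, ENNReal.ofReal ((1 - ‖z‖ ^ 2) ^ (1 - α)) * (‖radD g z‖₊ : ℝ≥0∞)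

lemma exists_entire_re_im_eq_of_mem_span_fourier (f : C(AddCircle (1:ℝ), ℂ))
    (hf : f ∈ Submodule.span ℂ (Set.range (@fourier (1:ℝ)))) :
    ∃ Q P : ℂ → ℂ, Differentiable ℂ Q ∧ Differentiable ℂ P ∧
      ∀ x, (Q (AddCircle.toCircle x : ℂ)).re = (f x).re ∧
        (P (AddCircle.toCircle x : ℂ)).re = (f x).im := by
  induction hf using Submodule.span_induction with
  | zero => exact ⟨0, 0, differentiable_const 0, differentiable_const 0, fun x => by simp⟩
  | add f g _ _ hf hg =>
    obtain ⟨Q, P, hQ, hP, h⟩ := hf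
    obtain ⟨Q', P', hQ', hP', h'⟩ := hg
    exact ⟨Q + Q', P + P', hQ.add hQ', hP.add hP', fun x => by simp [h, h']⟩
  | mem f hf =>
    obtain ⟨k, rfl⟩ := hf
    obtain ⟨m, rfl | rfl⟩ := k.eq_nat_or_neg
    · refine ⟨fun z => z ^ m, fun z => -Complex.I * z ^ m, by fun_prop, by fun_prop, fun x => ?_⟩
      rw [fourier_apply, AddCircle.toCircle_zsmul]
      simp
    · refine ⟨fun z => z ^ m, fun z => Complex.I * z ^ m, by fun_prop, by fun_prop, fun x => ?_⟩
      rw [fourier_apply, AddCircle.toCircle_zsmul]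
      rw [zpow_neg, zpow_natCast, Circle.coe_inv_eq_conj, Circle.coe_pow]
      simp only [Complex.conj_re, Complex.conj_im, Complex.mul_re, Complex.I_re, Complex.I_im]
      simp
  | smul c f _ hf =>
    obtain ⟨Q, P, hQ, hP, h⟩ := hf
    refine ⟨fun z => (c.re : ℂ) * Q z - (c.im : ℂ) * P z,
      fun z => (c.re : ℂ) * P z + (c.im : ℂ) * Q z, by fun_prop, by fun_prop, fun x => ?_⟩
    simp [h]

lemma exists_toCircle_eq {z : ℂ} (hz : ‖z‖ = 1) :
    ∃ x : AddCircle (1:ℝ), (AddCircle.toCircle x : ℂ) = z := by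
  refine ⟨((z.arg / (2 * Real.pi) : ℝ) : AddCircle (1:ℝ)), ?_⟩
  rw [AddCircle.toCircle_apply_mk, Circle.coe_exp]
  have : 2 * Real.pi / 1 * (z.arg / (2 * Real.pi)) = z.arg := by
    have := Real.pi_pos; field_simp
  rw [this]
  have := Complex.norm_mul_exp_arg_mul_I z
  rwa [hz, Complex.ofReal_one, one_mul] at this

/-- Continuous real functions on the circle are uniform limits of real parts of entire functions. -/
lemma exists_entire_re_near {u : ℂ → ℝ} (hu : ContinuousOn u (sphere 0 1)) {ε : ℝ} (hε : 0 < ε) :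
    ∃ Q : ℂ → ℂ, Differentiable ℂ Q ∧ ∀ z, ‖z‖ = 1 → |(Q z).re - u z| ≤ ε := by
  have hc : Continuous fun x : AddCircle (1:ℝ) => ((u (AddCircle.toCircle x) : ℝ) : ℂ) := by
    refine Complex.continuous_ofReal.comp (hu.comp_continuous ?_ ?_)
    · exact continuous_subtype_val.comp AddCircle.continuous_toCircle
    · intro x; simp [Circle.norm_coe]
  let f : C(AddCircle (1:ℝ), ℂ) := ⟨_, hc⟩
  have hf : f ∈ (Submodule.span ℂ (Set.range (@fourier (1:ℝ)))).topologicalClosure := by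
    rw [span_fourier_closure_eq_top]; trivial
  rw [← SetLike.mem_coe, Submodule.topologicalClosure_coe, Metric.mem_closure_iff] at hf
  obtain ⟨g, hg, hfg⟩ := hf ε hε
  obtain ⟨Q, P, hQ, _, h⟩ := exists_entire_re_im_eq_of_mem_span_fourier g hg
  refine ⟨Q, hQ, fun z hz => ?_⟩
  obtain ⟨x, rfl⟩ := exists_toCircle_eq hz
  have h1 : dist (f x) (g x) < ε := (ContinuousMap.dist_apply_le_dist x).trans_lt hfg
  have h2 : (Q (AddCircle.toCircle x)).re - u (AddCircle.toCircle x) = -(f x - g x).re := by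
    have h3 := (h x).1
    have h4 : (f x).re = u (AddCircle.toCircle x) := Complex.ofReal_re _
    rw [Complex.sub_re, h4]
    linarith
  rw [h2, abs_neg]
  exact (Complex.abs_re_le_norm _).trans (by rw [← dist_eq_norm]; exact h1.le)

lemma poissonKernel_nonneg_of_mem {a z : ℂ} (ha : a ∈ ball (0:ℂ) 1) (hz : ‖z‖ = 1) :
    0 ≤ poissonKernel 0 a z := by
  rw [poissonKernel_def]
  simp only [sub_zero, hz]
  have : ‖a‖ < 1 := by simpa using ha
  have := norm_nonneg a
  apply div_nonneg _ (by positivity)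
  nlinarith

lemma continuousOn_poissonKernel_sphere {a : ℂ} (ha : a ∈ ball (0:ℂ) 1) :
    ContinuousOn (poissonKernel 0 a) (sphere 0 1) := by
  have : ‖a‖ < 1 := by simpa using ha
  unfold poissonKernel
  apply ContinuousOn.div (by fun_prop) (by fun_prop)
  intro z hz
  have hz : ‖z‖ = 1 := by simpa using hz
  have : z - a ≠ 0 := by
    intro h; rw [sub_eq_zero] at h; subst h; linarith
  simpa using this

lemma circleAverage_poissonKernel {a : ℂ} (ha : a ∈ ball (0:ℂ) 1) :
    Real.circleAverage (poissonKernel 0 a) 0 1 = 1 := by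
  have h := InnerProductSpace.HarmonicOnNhd.circleAverage_poissonKernel_smul (R := 1) (c := 0)
    (w := a) (f := fun _ => (1:ℝ)) (fun x _ => InnerProductSpace.harmonicAt_const _) ha
  rw [← h]
  congr 1
  ext z
  simp

/-- Powers of the modulus of a holomorphic function are dominated by their Poisson integrals. -/
theorem norm_rpow_le_circleAverage_poissonKernel {h : ℂ → ℂ} (hh : DiffContOnCl ℂ h (ball 0 1))
    {s : ℝ} (hs : 0 < s) {a : ℂ} (ha : a ∈ ball (0:ℂ) 1) :
    ‖h a‖ ^ s ≤ Real.circleAverage (fun z => poissonKernel 0 a z * ‖h z‖ ^ s) 0 1 := by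
  have hcl : closure (ball (0:ℂ) 1) = closedBall 0 1 := closure_ball _ one_ne_zero
  have hhc : ContinuousOn h (sphere 0 1) :=
    hh.continuousOn.mono (by rw [hcl]; exact sphere_subset_closedBall)
  have hhs : ContinuousOn (fun z => ‖h z‖ ^ s) (sphere 0 1) :=
    hhc.norm.rpow_const (fun _ _ => Or.inr hs.le)
  have hP := continuousOn_poissonKernel_sphere ha
  have hi : ∀ {u : ℂ → ℝ}, ContinuousOn u (sphere 0 1) → CircleIntegrable u 0 1 := fun hu =>
    ContinuousOn.circleIntegrable (by norm_num) hu
  have key : ∀ ε : ℝ, 0 < ε → ‖h a‖ ^ s ≤ Real.exp (2 * ε) *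
      (Real.circleAverage (fun z => poissonKernel 0 a z * ‖h z‖ ^ s) 0 1 + ε) := by
    intro ε hε
    have hpos : ∀ z, 0 < ‖h z‖ ^ s + ε := fun z => by positivity
    obtain ⟨Q, hQ, hQu⟩ := exists_entire_re_near (u := fun z => Real.log (‖h z‖ ^ s + ε))
      ((hhs.add continuousOn_const).log (fun z _ => (hpos z).ne')) hε
    have hE : Differentiable ℂ fun z => Complex.exp (Q z) := hQ.cexp
    have hF : DiffContOnCl ℂ (fun z => h z * Complex.exp (-Q z / s)) (ball 0 1) :=
      hh.smul (Differentiable.diffContOnCl (by fun_prop))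
    have hle : ∀ z, ‖z‖ = 1 → ‖h z‖ ^ s ≤ Real.exp ε * Real.exp (Q z).re := by
      intro z hz
      have h1 := abs_le.1 (hQu z hz)
      have h2 : Real.log (‖h z‖ ^ s + ε) ≤ ε + (Q z).re := by linarith
      rw [← Real.exp_add]
      have := (Real.log_le_iff_le_exp (hpos z)).1 h2
      linarith
    have hge : ∀ z, ‖z‖ = 1 → Real.exp (Q z).re ≤ Real.exp ε * (‖h z‖ ^ s + ε) := by
      intro z hz
      have h1 := abs_le.1 (hQu z hz)
      have h2 : (Q z).re - ε ≤ Real.log (‖h z‖ ^ s + ε) := by linarith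
      have := (Real.le_log_iff_exp_le (hpos z)).1 h2
      rw [Real.exp_sub, div_le_iff₀ (Real.exp_pos _)] at this
      linarith
    have hnorm : ∀ z, ‖h z * Complex.exp (-Q z / s)‖ = ‖h z‖ * Real.exp (-(Q z).re / s) := by
      intro z
      rw [norm_mul, Complex.norm_exp]
      congr 2
      rw [Complex.div_ofReal_re, Complex.neg_re]
    have hmax : ‖h a * Complex.exp (-Q a / s)‖ ≤ Real.exp (ε / s) := by
      refine Complex.norm_le_of_forall_mem_frontier_norm_le isBounded_ball hF ?_
        (subset_closure ha)
      intro z hz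
      rw [frontier_ball _ one_ne_zero] at hz
      have hz : ‖z‖ = 1 := by simpa using hz
      have h1 : ‖h z‖ ≤ Real.exp ((ε + (Q z).re) / s) := by
        have := Real.rpow_le_rpow (by positivity) (hle z hz) (inv_nonneg.2 hs.le)
        rw [Real.rpow_rpow_inv (norm_nonneg _) hs.ne', ← Real.exp_add, ← Real.exp_mul] at this
        simpa [div_eq_mul_inv] using this
      rw [hnorm]
      calc _ ≤ Real.exp ((ε + (Q z).re) / s) * Real.exp (-(Q z).re / s) := by gcongr
        _ = _ := by rw [← Real.exp_add]; congr 1; ring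
    have ha1 : ‖h a‖ ^ s ≤ Real.exp ε * Real.exp (Q a).re := by
      rw [hnorm] at hmax
      have h1 : ‖h a‖ ≤ Real.exp ((ε + (Q a).re) / s) := by
        calc ‖h a‖ = ‖h a‖ * Real.exp (-(Q a).re / s) * Real.exp ((Q a).re / s) := by
              rw [mul_assoc, ← Real.exp_add, ← add_div]; simp
          _ ≤ Real.exp (ε / s) * Real.exp ((Q a).re / s) := by gcongr
          _ = _ := by rw [← Real.exp_add]; congr 1; ring
      have := Real.rpow_le_rpow (norm_nonneg _) h1 hs.le
      rwa [← Real.exp_mul, div_mul_cancel₀ _ hs.ne', Real.exp_add] at this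
    have hEc : ContinuousOn (fun z => Real.exp (Q z).re) (sphere 0 1) :=
      (Real.continuous_exp.comp (Complex.continuous_re.comp hQ.continuous)).continuousOn
    have ha2 : Real.exp (Q a).re ≤
        Real.circleAverage (fun z => poissonKernel 0 a z * Real.exp (Q z).re) 0 1 := by
      have h1 := DiffContOnCl.circleAverage_poissonKernel_smul (hE.diffContOnCl (s := ball 0 1)) ha
      rw [← Complex.norm_exp, ← h1, Real.circleAverage, Real.circleAverage, norm_smul, smul_eq_mul]
      have : ‖(2 * Real.pi)⁻¹‖ = (2 * Real.pi)⁻¹ := by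
        rw [Real.norm_of_nonneg]; positivity
      rw [this]
      gcongr
      refine (intervalIntegral.norm_integral_le_integral_norm (by positivity)).trans (le_of_eq ?_)
      congr 1
      ext θ
      simp only [Pi.smul_apply', norm_smul, Complex.norm_exp]
      rw [Real.norm_of_nonneg]
      exact poissonKernel_nonneg_of_mem ha (by simp)
    have ha3 : Real.circleAverage (fun z => poissonKernel 0 a z * Real.exp (Q z).re) 0 1 ≤
        Real.circleAverage (fun z => Real.exp ε * (poissonKernel 0 a z * ‖h z‖ ^ s) +
          Real.exp ε * ε * poissonKernel 0 a z) 0 1 := by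
      refine Real.circleAverage_mono (hi (hP.mul hEc))
        (hi ((continuousOn_const.mul (hP.mul hhs)).add (continuousOn_const.mul hP))) ?_
      intro z hz
      have hz : ‖z‖ = 1 := by simpa using hz
      have := mul_le_mul_of_nonneg_left (hge z hz) (poissonKernel_nonneg_of_mem ha hz)
      linarith
    have ha4 : Real.circleAverage (fun z => Real.exp ε * (poissonKernel 0 a z * ‖h z‖ ^ s) +
          Real.exp ε * ε * poissonKernel 0 a z) 0 1 = Real.exp ε *
        (Real.circleAverage (fun z => poissonKernel 0 a z * ‖h z‖ ^ s) 0 1 + ε) := by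
      rw [Real.circleAverage_fun_add
        (f₁ := fun z => Real.exp ε * (poissonKernel 0 a z * ‖h z‖ ^ s))
        (f₂ := fun z => Real.exp ε * ε * poissonKernel 0 a z)
        (hi (continuousOn_const.mul (hP.mul hhs))) (hi (continuousOn_const.mul hP))]
      have e1 := Real.circleAverage_fun_smul (a := Real.exp ε) (c := (0:ℂ)) (R := 1)
        (f := fun z => poissonKernel 0 a z * ‖h z‖ ^ s)
      have e2 := Real.circleAverage_fun_smul (a := Real.exp ε * ε) (c := (0:ℂ)) (R := 1)
        (f := poissonKernel 0 a)
      simp only [smul_eq_mul] at e1 e2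
      rw [e1, e2, circleAverage_poissonKernel ha]
      ring
    have h5 := (ha2.trans ha3).trans_eq ha4
    have h6 := mul_le_mul_of_nonneg_left h5 (Real.exp_pos ε).le
    rw [two_mul, Real.exp_add]
    linarith
  have hlim : Tendsto (fun ε : ℝ => Real.exp (2 * ε) *
      (Real.circleAverage (fun z => poissonKernel 0 a z * ‖h z‖ ^ s) 0 1 + ε)) (𝓝[>] 0)
      (𝓝 (Real.circleAverage (fun z => poissonKernel 0 a z * ‖h z‖ ^ s) 0 1)) := by
    have : ContinuousAt (fun ε : ℝ => Real.exp (2 * ε) *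
      (Real.circleAverage (fun z => poissonKernel 0 a z * ‖h z‖ ^ s) 0 1 + ε)) 0 := by fun_prop
    have := this.tendsto
    simp only [mul_zero, Real.exp_zero, one_mul, add_zero] at this
    exact this.mono_left nhdsWithin_le_nhds
  exact ge_of_tendsto hlim (eventually_mem_nhdsWithin.mono fun ε hε => key ε hε)

lemma sq_lintegral_mul_le {X : Type*} [MeasurableSpace X] (μ : Measure X) {f g : X → ℝ≥0∞}
    (hf : AEMeasurable f μ) (hg : AEMeasurable g μ) :
    (∫⁻ x, f x * g x ∂μ) ^ 2 ≤ (∫⁻ x, f x ^ 2 ∂μ) * ∫⁻ x, g x ^ 2 ∂μ := by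
  have h := ENNReal.lintegral_mul_le_Lp_mul_Lq μ Real.HolderConjugate.two_two hf hg
  have h2 := pow_le_pow_left₀ (zero_le) h 2
  have e : ∀ a : ℝ≥0∞, (a ^ (1 / (2:ℝ))) ^ 2 = a := fun a => by
    rw [← ENNReal.rpow_natCast, ← ENNReal.rpow_mul]; norm_num
  rw [mul_pow, e, e] at h2
  simpa [Pi.mul_apply] using h2

/-- A positive integral operator `T` whose composition with its adjoint is controlled by
`T + T*` is bounded on `L²`. -/
theorem lintegral_sq_lintegral_mul_le {X : Type*} [MeasurableSpace X] (μ : Measure X)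
    [IsProbabilityMeasure μ] {k : X → X → ℝ≥0∞} (hk : Measurable (Function.uncurry k))
    {B : ℝ≥0∞} (hB : B ≠ ⊤) (hkB : ∀ x y, k x y ≤ B)
    (H : ∀ x x', ∫⁻ z, k x z * k x' z ∂μ ≤ 8 * (k x x' + k x' x))
    {φ : X → ℝ≥0∞} (hφ : Measurable φ) :
    ∫⁻ x, (∫⁻ z, k x z * φ z ∂μ) ^ 2 ∂μ ≤ 256 * ∫⁻ z, φ z ^ 2 ∂μ := by
  let T : (X → ℝ≥0∞) → X → ℝ≥0∞ := fun φ x => ∫⁻ z, k x z * φ z ∂μ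
  have hT : ∀ φ, Measurable φ → Measurable (T φ) := fun φ hφ =>
    Measurable.lintegral_prod_right' (f := fun q : X × X => k q.1 q.2 * φ q.2)
      (hk.mul (hφ.comp measurable_snd))
  have hk1 : ∀ x, Measurable fun z => k x z := fun x => hk.comp measurable_prodMk_left
  have hk2 : ∀ z, Measurable fun x => k x z := fun z => hk.comp measurable_prodMk_right
  let S : Set ℝ≥0∞ := {M | ∀ φ, Measurable φ → ∫⁻ z, φ z ^ 2 ∂μ ≠ ⊤ → ∫⁻ x, T φ x ^ 2 ∂μ ≤ M * ∫⁻ z, φ z ^ 2 ∂μ}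
  have hS0 : B ^ 2 ∈ S := by
    intro φ hφ _
    have h1 : ∀ x, T φ x ^ 2 ≤ B ^ 2 * ∫⁻ z, φ z ^ 2 ∂μ := by
      intro x
      have := sq_lintegral_mul_le μ (hk1 x).aemeasurable hφ.aemeasurable
      refine this.trans ?_
      gcongr
      calc _ ≤ ∫⁻ _, B ^ 2 ∂μ := by gcongr; exact hkB _ _
        _ = _ := by simp
    calc _ ≤ ∫⁻ _, (B ^ 2 * ∫⁻ z, φ z ^ 2 ∂μ) ∂μ := lintegral_mono h1
      _ = _ := by simp
  have hSmap : ∀ M ∈ S, M ≠ ⊤ → 16 * M ^ (1 / 2 : ℝ) ∈ S := by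
    intro M hM hMt φ hφ hPt
    set P := ∫⁻ z, φ z ^ 2 ∂μ with hP
    set F := T φ with hF
    have hFm : Measurable F := hT φ hφ
    set A := ∫⁻ x, F x ^ 2 ∂μ with hA
    have hAt : A ≠ ⊤ := ne_top_of_le_ne_top (ENNReal.mul_ne_top hMt hPt) (hM φ hφ hPt)
    let G : X → ℝ≥0∞ := fun z => ∫⁻ x, F x * k x z ∂μ
    have hGm : Measurable G := Measurable.lintegral_prod_left'
      (f := fun q : X × X => F q.1 * k q.1 q.2) ((hFm.comp measurable_fst).mul hk)
    have h1 : A = ∫⁻ z, φ z * G z ∂μ := by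
      calc A = ∫⁻ x, ∫⁻ z, F x * (k x z * φ z) ∂μ ∂μ := by
            refine lintegral_congr fun x => ?_
            rw [lintegral_const_mul _ ((hk1 x).fun_mul hφ), sq]
        _ = ∫⁻ z, ∫⁻ x, F x * (k x z * φ z) ∂μ ∂μ := lintegral_lintegral_swap
            (((hFm.comp measurable_fst).mul (hk.mul (hφ.comp measurable_snd))).aemeasurable)
        _ = _ := by
            refine lintegral_congr fun z => ?_
            rw [← lintegral_const_mul _ (hFm.fun_mul (hk2 z))]
            exact lintegral_congr fun x => by ring
    have h2 : ∫⁻ z, G z ^ 2 ∂μ ≤ 16 * ∫⁻ x, F x * T F x ∂μ := by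
      calc ∫⁻ z, G z ^ 2 ∂μ
          = ∫⁻ z, ∫⁻ x, F x * k x z * G z ∂μ ∂μ := by
            refine lintegral_congr fun z => ?_
            rw [lintegral_mul_const _ (hFm.fun_mul (hk2 z)), sq]
        _ = ∫⁻ x, ∫⁻ z, F x * k x z * G z ∂μ ∂μ := lintegral_lintegral_swap
            ((((hFm.comp measurable_snd).mul (hk.comp measurable_swap)).mul
              (hGm.comp measurable_fst)).aemeasurable)
        _ = ∫⁻ x, ∫⁻ z, ∫⁻ x', F x * F x' * (k x z * k x' z) ∂μ ∂μ ∂μ := by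
            refine lintegral_congr fun x => lintegral_congr fun z => ?_
            rw [← lintegral_const_mul _ (hFm.fun_mul (hk2 z))]
            exact lintegral_congr fun x' => by ring
        _ = ∫⁻ x, ∫⁻ x', ∫⁻ z, F x * F x' * (k x z * k x' z) ∂μ ∂μ ∂μ := by
            refine lintegral_congr fun x => lintegral_lintegral_swap ?_
            exact ((measurable_const.mul (hFm.comp measurable_snd)).mul
              (((hk1 x).comp measurable_fst).mul (hk.comp measurable_swap))).aemeasurable
        _ ≤ ∫⁻ x, ∫⁻ x', F x * F x' * (8 * (k x x' + k x' x)) ∂μ ∂μ := by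
            refine lintegral_mono fun x => lintegral_mono fun x' => ?_
            dsimp only
            rw [lintegral_const_mul _ ((hk1 x).fun_mul (hk1 x'))]
            gcongr
            exact H x x'
        _ = ∫⁻ x, (∫⁻ x', F x * F x' * (8 * k x x') ∂μ + ∫⁻ x', F x * F x' * (8 * k x' x) ∂μ)
              ∂μ := by
            refine lintegral_congr fun x => ?_
            rw [← lintegral_add_left ((measurable_const.fun_mul hFm).fun_mul
              (measurable_const.fun_mul (hk1 x)))]
            exact lintegral_congr fun x' => by ring
        _ = ∫⁻ x, ∫⁻ x', F x * F x' * (8 * k x x') ∂μ ∂μ +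
              ∫⁻ x, ∫⁻ x', F x * F x' * (8 * k x' x) ∂μ ∂μ := by
            refine lintegral_add_left ?_ _
            exact Measurable.lintegral_prod_right'
              (f := fun q : X × X => F q.1 * F q.2 * (8 * k q.1 q.2))
              (((hFm.comp measurable_fst).mul (hFm.comp measurable_snd)).mul
                (measurable_const.mul hk))
        _ = ∫⁻ x, ∫⁻ x', F x * F x' * (8 * k x x') ∂μ ∂μ +
              ∫⁻ x, ∫⁻ x', F x * F x' * (8 * k x x') ∂μ ∂μ := by
            congr 1
            rw [lintegral_lintegral_swap]
            · refine lintegral_congr fun x => lintegral_congr fun x' => by ring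
            · exact (((hFm.comp measurable_fst).mul (hFm.comp measurable_snd)).mul
                (measurable_const.mul (hk.comp measurable_swap))).aemeasurable
        _ = 16 * ∫⁻ x, F x * T F x ∂μ := by
            have : ∀ x, ∫⁻ x', F x * F x' * (8 * k x x') ∂μ = 8 * (F x * T F x) := by
              intro x
              rw [← lintegral_const_mul _ ((hk1 x).fun_mul hFm),
                ← lintegral_const_mul _ (measurable_const.fun_mul ((hk1 x).fun_mul hFm))]
              exact lintegral_congr fun x' => by ring
            simp_rw [this]
            rw [lintegral_const_mul _ (hFm.fun_mul (hT F hFm))]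
            ring
    have h3 : A ^ 2 ≤ P * ∫⁻ z, G z ^ 2 ∂μ := by
      rw [h1]; exact sq_lintegral_mul_le μ hφ.aemeasurable hGm.aemeasurable
    have h4 : (∫⁻ x, F x * T F x ∂μ) ^ 2 ≤ A * (M * A) :=
      (sq_lintegral_mul_le μ hFm.aemeasurable (hT F hFm).aemeasurable).trans
        (by gcongr; exact hM F hFm hAt)
    rcases eq_or_ne A 0 with hA0 | hA0
    · rw [hA0]; exact zero_le
    have h5 : A ^ 2 * A ^ 2 ≤ (256 * M * P ^ 2) * A ^ 2 := by
      calc A ^ 2 * A ^ 2 = (A ^ 2) ^ 2 := by ring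
        _ ≤ (P * (16 * ∫⁻ x, F x * T F x ∂μ)) ^ 2 := by gcongr; exact h3.trans (by gcongr)
        _ = 256 * P ^ 2 * (∫⁻ x, F x * T F x ∂μ) ^ 2 := by ring
        _ ≤ 256 * P ^ 2 * (A * (M * A)) := by gcongr
        _ = _ := by ring
    have h6 : A ^ 2 ≤ 256 * M * P ^ 2 :=
      (ENNReal.mul_le_mul_iff_left (pow_ne_zero 2 hA0) (ENNReal.pow_ne_top hAt)).1 h5
    have h7 : 256 * M * P ^ 2 = (16 * M ^ (1 / 2 : ℝ) * P) ^ 2 := by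
      have : (M ^ (1 / (2:ℝ))) ^ 2 = M := by
        rw [← ENNReal.rpow_natCast, ← ENNReal.rpow_mul]; norm_num
      rw [mul_pow, mul_pow, this]; norm_num
    rw [h7] at h6
    exact (ENNReal.pow_le_pow_left_iff two_ne_zero).1 h6
  have hSinf : sInf S ∈ S := by
    intro φ hφ ht
    rcases eq_or_ne (∫⁻ z, φ z ^ 2 ∂μ) 0 with h0 | h0
    · have := hS0 φ hφ ht
      rw [h0, mul_zero] at this ⊢
      exact this
    rw [← ENNReal.div_le_iff h0 ht]
    exact le_sInf fun M hM => ENNReal.div_le_of_le_mul (hM φ hφ ht)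
  have hlt : sInf S ≠ ⊤ := ne_top_of_le_ne_top (ENNReal.pow_ne_top hB) (sInf_le hS0)
  have h8 : sInf S ≤ 256 := by
    have h9 := sInf_le (hSmap _ hSinf hlt)
    rcases eq_or_ne (sInf S) 0 with hs | hs
    · rw [hs]; exact zero_le
    have h10 : sInf S * sInf S ≤ 256 * sInf S := by
      calc sInf S * sInf S ≤ (16 * sInf S ^ (1 / 2 : ℝ)) * (16 * sInf S ^ (1 / 2 : ℝ)) := by gcongr
        _ = 256 * (sInf S ^ (1 / 2 : ℝ)) ^ 2 := by ring
        _ = _ := by rw [← ENNReal.rpow_natCast, ← ENNReal.rpow_mul]; norm_num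
    exact (ENNReal.mul_le_mul_iff_left hs hlt).1 h10
  rcases eq_or_ne (∫⁻ z, φ z ^ 2 ∂μ) ⊤ with ht | ht
  · rw [ht, ENNReal.mul_top (by norm_num)]; exact le_top
  exact (hSinf φ hφ ht).trans (by gcongr)

/-- Normalized Lebesgue measure on the interval `(0, 2π]`. -/
def angleMeasure : Measure ℝ :=
  ENNReal.ofReal (2 * Real.pi)⁻¹ • volume.restrict (Ioc 0 (2 * Real.pi))

instance : IsProbabilityMeasure angleMeasure := by
  constructor
  rw [angleMeasure, Measure.smul_apply, Measure.restrict_apply MeasurableSet.univ, univ_inter,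
    Real.volume_Ioc, smul_eq_mul, ← ENNReal.ofReal_mul (by positivity), sub_zero,
    inv_mul_cancel₀ (by positivity), ENNReal.ofReal_one]

lemma circleAverage_eq_integral_angleMeasure {E : Type*} [NormedAddCommGroup E] [NormedSpace ℝ E]
    (u : ℂ → E) : Real.circleAverage u 0 1 = ∫ θ, u (circleMap 0 1 θ) ∂angleMeasure := by
  rw [angleMeasure, integral_smul_measure, Real.circleAverage,
    intervalIntegral.integral_of_le (by positivity), ENNReal.toReal_ofReal (by positivity)]

lemma integrable_angleMeasure {E : Type*} [NormedAddCommGroup E]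
    {u : ℝ → E} (hu : Continuous u) : Integrable u angleMeasure := by
  refine Integrable.smul_measure ?_ ENNReal.ofReal_ne_top
  exact (hu.integrableOn_Icc (a := 0) (b := 2 * Real.pi)).mono_set Ioc_subset_Icc_self

lemma continuous_comp_circleMap {E : Type*} [TopologicalSpace E] {u : ℂ → E}
    (hu : ContinuousOn u (sphere 0 1)) : Continuous fun θ => u (circleMap 0 1 θ) :=
  hu.comp_continuous (continuous_circleMap 0 1) (fun θ => circleMap_mem_sphere 0 zero_le_one θ)

theorem enorm_rpow_le_lintegral_poissonKernel {h : ℂ → ℂ} (hh : DiffContOnCl ℂ h (ball 0 1))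
    {s : ℝ} (hs : 0 < s) {a : ℂ} (ha : a ∈ ball (0:ℂ) 1) :
    ‖h a‖ₑ ^ s ≤ ∫⁻ θ, ENNReal.ofReal (poissonKernel 0 a (circleMap 0 1 θ)) *
      ‖h (circleMap 0 1 θ)‖ₑ ^ s ∂angleMeasure := by
  have hcl : closure (ball (0:ℂ) 1) = closedBall 0 1 := closure_ball _ one_ne_zero
  have hhc : ContinuousOn h (sphere 0 1) :=
    hh.continuousOn.mono (by rw [hcl]; exact sphere_subset_closedBall)
  have hhs : ContinuousOn (fun z => ‖h z‖ ^ s) (sphere 0 1) :=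
    hhc.norm.rpow_const (fun _ _ => Or.inr hs.le)
  have hP := continuousOn_poissonKernel_sphere ha
  have h1 := norm_rpow_le_circleAverage_poissonKernel hh hs ha
  have h2 := ENNReal.ofReal_le_ofReal h1
  rw [circleAverage_eq_integral_angleMeasure,
    ofReal_integral_eq_lintegral_ofReal (integrable_angleMeasure
      (continuous_comp_circleMap (hP.fun_mul hhs))),
    ← ENNReal.ofReal_rpow_of_nonneg (norm_nonneg _) hs.le, ofReal_norm] at h2
  · refine h2.trans_eq (lintegral_congr fun θ => ?_)
    rw [ENNReal.ofReal_mul (poissonKernel_nonneg_of_mem ha (by simp)),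
      ← ENNReal.ofReal_rpow_of_nonneg (norm_nonneg _) hs.le, ofReal_norm]
  · exact ae_of_all _ fun θ => mul_nonneg (poissonKernel_nonneg_of_mem ha (by simp))
      (by positivity)

lemma poissonKernel_eq_re {b z : ℂ} (hz : ‖z‖ = 1) :
    poissonKernel 0 b z =
      ((1 + (starRingEnd ℂ) b * z) / (1 - (starRingEnd ℂ) b * z)).re := by
  have hzz : (starRingEnd ℂ) z * z = 1 := by rw [Complex.conj_mul']; simp [hz]
  have hz0 : (starRingEnd ℂ) z ≠ 0 := by
    intro h; rw [h, zero_mul] at hzz; exact zero_ne_one hzz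
  have h1 : poissonKernel 0 b z = ((z + b) / (z - b)).re := by
    simpa [herglotzRieszKernel_def] using congrFun
      (poissonKernel_eq_re_herglotzRieszKernel (c := 0) (w := b)) z
  rw [h1, ← Complex.conj_re ((1 + (starRingEnd ℂ) b * z) / (1 - (starRingEnd ℂ) b * z)),
    ← mul_div_mul_left (z + b) (z - b) hz0, mul_add, mul_sub, hzz]
  simp only [map_div₀, map_add, map_sub, map_mul, map_one, Complex.conj_conj]
  rw [mul_comm b]

lemma re_one_add_div_one_sub (u : ℂ) :
    ((1 + u) / (1 - u)).re = (1 - ‖u‖ ^ 2) / ‖1 - u‖ ^ 2 := by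
  rw [Complex.div_re, ← add_div, Complex.normSq_eq_norm_sq, Complex.sq_norm u,
    Complex.normSq_apply]
  congr 1
  simp
  ring

lemma re_one_add_div_one_sub_le {e : ℂ} (he : ‖e‖ = 1) {ρ r : ℝ} (h0 : 0 ≤ r) (hr : r < 1)
    (hρ : ρ ≤ r) (hrρ : r ^ 2 ≤ ρ) :
    ((1 + ρ * e) / (1 - ρ * e)).re ≤ 8 * ((1 + r * e) / (1 - r * e)).re := by
  have hρ0 : 0 ≤ ρ := (sq_nonneg r).trans hrρ
  rw [re_one_add_div_one_sub, re_one_add_div_one_sub]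
  have n1 : ‖(ρ:ℂ) * e‖ = ρ := by rw [norm_mul, he, mul_one, Complex.norm_real, Real.norm_of_nonneg hρ0]
  have n2 : ‖(r:ℂ) * e‖ = r := by rw [norm_mul, he, mul_one, Complex.norm_real, Real.norm_of_nonneg h0]
  have d1 : 1 - ρ ≤ ‖1 - (ρ:ℂ) * e‖ := by
    have := norm_sub_norm_le (1:ℂ) ((ρ:ℂ) * e); rwa [n1, norm_one] at this
  have d2 : 1 - r ≤ ‖1 - (r:ℂ) * e‖ := by
    have := norm_sub_norm_le (1:ℂ) ((r:ℂ) * e); rwa [n2, norm_one] at this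
  have d3 : ‖1 - (r:ℂ) * e‖ ≤ 2 * ‖1 - (ρ:ℂ) * e‖ := by
    have h1 : ‖1 - (r:ℂ) * e‖ ≤ ‖1 - (ρ:ℂ) * e‖ + ‖((ρ - r : ℝ):ℂ) * e‖ := by
      refine (norm_add_le _ _).trans' (le_of_eq ?_)
      congr 1; push_cast; ring
    rw [norm_mul, he, mul_one, Complex.norm_real, Real.norm_of_nonpos (by linarith)] at h1
    linarith
  rw [n1, n2]
  have p2 : 0 < ‖1 - (r:ℂ) * e‖ := by linarith
  have p1 : 0 < ‖1 - (ρ:ℂ) * e‖ := by linarith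
  rw [← mul_div_assoc, div_le_div_iff₀ (by positivity) (by positivity)]
  have q1 : ‖1 - (r:ℂ) * e‖ ^ 2 ≤ 4 * ‖1 - (ρ:ℂ) * e‖ ^ 2 := by nlinarith
  have q2 : 1 - ρ ^ 2 ≤ 2 * (1 - r ^ 2) := by nlinarith [sq_nonneg (r^2), pow_le_pow_left₀ (sq_nonneg r) hrρ 2, sq_nonneg (1 - r^2)]
  have q3 : 0 ≤ 1 - ρ ^ 2 := by nlinarith
  calc _ ≤ (1 - ρ ^ 2) * (4 * ‖1 - (ρ:ℂ) * e‖ ^ 2) := by gcongr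
    _ ≤ (2 * (1 - r ^ 2)) * (4 * ‖1 - (ρ:ℂ) * e‖ ^ 2) := by gcongr
    _ = _ := by ring

lemma circleAverage_poissonKernel_mul {a b : ℂ} (ha : a ∈ ball (0:ℂ) 1) (hb : b ∈ ball (0:ℂ) 1) :
    Real.circleAverage (fun z => poissonKernel 0 a z * poissonKernel 0 b z) 0 1 =
      ((1 + (starRingEnd ℂ) b * a) / (1 - (starRingEnd ℂ) b * a)).re := by
  have hb' : ‖b‖ < 1 := by simpa using hb
  let H : ℂ → ℂ := fun z => (1 + (starRingEnd ℂ) b * z) / (1 - (starRingEnd ℂ) b * z)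
  have hH : DiffContOnCl ℂ H (ball 0 1) := by
    refine DifferentiableOn.diffContOnCl ?_
    rw [closure_ball _ one_ne_zero]
    refine DifferentiableOn.fun_div (by fun_prop) (by fun_prop) ?_
    intro z hz h
    have hz : ‖z‖ ≤ 1 := by simpa using hz
    have : ‖(starRingEnd ℂ) b * z‖ = 1 := by rw [← sub_eq_zero.1 h]; simp
    rw [norm_mul, RCLike.norm_conj] at this
    nlinarith [norm_nonneg z, norm_nonneg b]
  have h1 := DiffContOnCl.circleAverage_poissonKernel_smul hH ha
  rw [show ((1 + (starRingEnd ℂ) b * a) / (1 - (starRingEnd ℂ) b * a)) = H a from rfl, ← h1,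
    circleAverage_eq_integral_angleMeasure, circleAverage_eq_integral_angleMeasure]
  have hHs : ContinuousOn H (sphere 0 1) := hH.continuousOn.mono
    (by rw [closure_ball _ one_ne_zero]; exact sphere_subset_closedBall)
  have h2 : Integrable (fun θ => (poissonKernel 0 a • H) (circleMap 0 1 θ)) angleMeasure :=
    integrable_angleMeasure (continuous_comp_circleMap
      ((continuousOn_poissonKernel_sphere ha).smul hHs))
  rw [← Complex.reCLM_apply, ← Complex.reCLM.integral_comp_comm h2]
  congr 1
  ext θ
  simp only [Pi.smul_apply', Complex.reCLM_apply, Complex.smul_re, smul_eq_mul]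
  rw [poissonKernel_eq_re (b := b) (by simp)]

lemma lintegral_poissonKernel_mul_le {r r' θ θ' : ℝ} (h0 : 0 ≤ r') (hr : r' ≤ r) (h1 : r < 1) :
    ∫⁻ t, ENNReal.ofReal (poissonKernel 0 (circleMap 0 r θ) (circleMap 0 1 t)) *
      ENNReal.ofReal (poissonKernel 0 (circleMap 0 r' θ') (circleMap 0 1 t)) ∂angleMeasure ≤
      8 * ENNReal.ofReal (poissonKernel 0 (circleMap 0 r' θ') (circleMap 0 1 θ)) := by
  have ha : circleMap 0 r θ ∈ ball (0:ℂ) 1 := by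
    simp [abs_of_nonneg (h0.trans hr), h1]
  have hb : circleMap 0 r' θ' ∈ ball (0:ℂ) 1 := by
    simp [abs_of_nonneg h0, hr.trans_lt h1]
  have hPa := continuousOn_poissonKernel_sphere ha
  have hPb := continuousOn_poissonKernel_sphere hb
  have e1 : ∫⁻ t, ENNReal.ofReal (poissonKernel 0 (circleMap 0 r θ) (circleMap 0 1 t)) *
      ENNReal.ofReal (poissonKernel 0 (circleMap 0 r' θ') (circleMap 0 1 t)) ∂angleMeasure =
      ENNReal.ofReal (Real.circleAverage (fun z => poissonKernel 0 (circleMap 0 r θ) z *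
        poissonKernel 0 (circleMap 0 r' θ') z) 0 1) := by
    rw [circleAverage_eq_integral_angleMeasure, ofReal_integral_eq_lintegral_ofReal
      (integrable_angleMeasure (continuous_comp_circleMap (hPa.fun_mul hPb)))]
    · refine lintegral_congr fun t => ?_
      rw [ENNReal.ofReal_mul (poissonKernel_nonneg_of_mem ha (by simp))]
    · exact ae_of_all _ fun t => mul_nonneg (poissonKernel_nonneg_of_mem ha (by simp))
        (poissonKernel_nonneg_of_mem hb (by simp))
  rw [e1, circleAverage_poissonKernel_mul ha hb, poissonKernel_eq_re (by simp),
    show (8:ℝ≥0∞) = ENNReal.ofReal 8 by norm_num, ← ENNReal.ofReal_mul (by norm_num)]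
  refine ENNReal.ofReal_le_ofReal ?_
  have hrr : (r:ℝ) * r' ≤ r' := by nlinarith
  have := re_one_add_div_one_sub_le (e := (starRingEnd ℂ) (circleMap 0 1 θ') * circleMap 0 1 θ)
    (by simp) h0 (hr.trans_lt h1) (ρ := r * r') hrr (by nlinarith)
  convert this using 4 <;> simp [circleMap] <;> ring

lemma measurable_poissonKernel_circleMap {r : ℝ → ℝ} (hr : Measurable r) :
    Measurable (Function.uncurry fun θ t : ℝ =>
      ENNReal.ofReal (poissonKernel 0 (circleMap 0 (r θ) θ) (circleMap 0 1 t))) := by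
  simp only [poissonKernel_def, circleMap, Function.uncurry_def]
  fun_prop

lemma lintegral_enorm_rpow_selection_le {h : ℂ → ℂ} (hh : DiffContOnCl ℂ h (ball 0 1))
    {p : ℝ} (hp : 0 < p) {r : ℝ → ℝ} (hr : Measurable r) {R : ℝ} (hR : R < 1)
    (h0 : ∀ θ, 0 ≤ r θ) (hrR : ∀ θ, r θ ≤ R) :
    ∫⁻ θ, ‖h (circleMap 0 (r θ) θ)‖ₑ ^ p ∂angleMeasure ≤
      256 * ∫⁻ θ, ‖h (circleMap 0 1 θ)‖ₑ ^ p ∂angleMeasure := by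
  have hcl : closure (ball (0:ℂ) 1) = closedBall 0 1 := closure_ball _ one_ne_zero
  have hhc : ContinuousOn h (sphere 0 1) :=
    hh.continuousOn.mono (by rw [hcl]; exact sphere_subset_closedBall)
  have hp2 : 0 < p / 2 := by positivity
  have hsq : ∀ x : ℝ≥0∞, (x ^ (p / 2)) ^ 2 = x ^ p := fun x => by
    rw [← ENNReal.rpow_natCast, ← ENNReal.rpow_mul]; norm_num
  have hmem : ∀ θ, circleMap 0 (r θ) θ ∈ ball (0:ℂ) 1 := fun θ => by
    simp [abs_of_nonneg (h0 θ), (hrR θ).trans_lt hR]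
  have hφ : Measurable fun θ => ‖h (circleMap 0 1 θ)‖ₑ ^ (p / 2) :=
    (continuous_comp_circleMap hhc).measurable.enorm.pow_const _
  have key := lintegral_sq_lintegral_mul_le angleMeasure (measurable_poissonKernel_circleMap hr)
    (B := ENNReal.ofReal ((1 - R) ^ 2)⁻¹) ENNReal.ofReal_ne_top ?_ ?_ hφ
  · simp_rw [hsq] at key
    refine le_trans (lintegral_mono fun θ => ?_) key
    rw [← hsq]
    gcongr
    exact enorm_rpow_le_lintegral_poissonKernel hh hp2 (hmem θ)
  · intro θ t
    refine ENNReal.ofReal_le_ofReal ?_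
    have hd : 1 - R ≤ ‖circleMap 0 1 t - circleMap 0 (r θ) θ‖ := by
      have := norm_sub_norm_le (circleMap 0 1 t) (circleMap 0 (r θ) θ)
      simp only [norm_circleMap_zero, abs_one, abs_of_nonneg (h0 θ)] at this
      linarith [hrR θ]
    rw [poissonKernel_def, div_eq_mul_inv]
    simp only [sub_zero]
    have h1 : ‖circleMap 0 1 t‖ ^ 2 - ‖circleMap 0 (r θ) θ‖ ^ 2 ≤ 1 := by
      simp only [norm_circleMap_zero, abs_one]; nlinarith [sq_nonneg |r θ|]
    have hR' : 0 < 1 - R := by linarith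
    calc _ ≤ 1 * (‖circleMap 0 1 t - circleMap 0 (r θ) θ‖ ^ 2)⁻¹ := by gcongr
      _ ≤ _ := by rw [one_mul]; gcongr
  · intro θ θ'
    rcases le_total (r θ') (r θ) with hle | hle
    · refine (lintegral_poissonKernel_mul_le (h0 θ') hle ((hrR θ).trans_lt hR)).trans ?_
      gcongr
      exact le_add_self
    · simp_rw [mul_comm (ENNReal.ofReal (poissonKernel 0 (circleMap 0 (r θ) θ) _))]
      refine (lintegral_poissonKernel_mul_le (h0 θ) hle ((hrR θ').trans_lt hR)).trans ?_
      gcongr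
      exact le_self_add

lemma exists_measurable_selection {u : ℝ → ℝ → ℝ} {ρ : ℕ → ℝ} (hu : ∀ i, Measurable (u (ρ i)))
    (N : ℕ) : ∃ r : ℝ → ℝ, Measurable r ∧ Measurable (fun θ => u (r θ) θ) ∧
      (∀ θ, ∃ i ≤ N, r θ = ρ i) ∧ ∀ i ≤ N, ∀ θ, u (ρ i) θ ≤ u (r θ) θ := by
  induction N with
  | zero => exact ⟨fun _ => ρ 0, measurable_const, hu 0, fun θ => ⟨0, le_rfl, rfl⟩,
      fun i hi θ => by rw [Nat.le_zero.1 hi]⟩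
  | succ N ih =>
    obtain ⟨r, hr, hur, hmem, hmax⟩ := ih
    have hs : MeasurableSet {θ | u (ρ (N + 1)) θ ≤ u (r θ) θ} := measurableSet_le (hu _) hur
    classical
    refine ⟨fun θ => if u (ρ (N + 1)) θ ≤ u (r θ) θ then r θ else ρ (N + 1),
      Measurable.ite hs hr measurable_const, ?_, fun θ => ?_, fun i hi θ => ?_⟩
    · have e : (fun θ => u (if u (ρ (N + 1)) θ ≤ u (r θ) θ then r θ else ρ (N + 1)) θ) =
          fun θ => if u (ρ (N + 1)) θ ≤ u (r θ) θ then u (r θ) θ else u (ρ (N + 1)) θ := by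
        ext θ
        split_ifs <;> rfl
      rw [e]
      exact Measurable.ite hs hur (hu (N + 1))
    · dsimp only
      split_ifs
      · obtain ⟨i, hi, h⟩ := hmem θ
        exact ⟨i, by omega, h⟩
      · exact ⟨N + 1, le_rfl, rfl⟩
    · dsimp only
      rcases Nat.le_succ_iff.1 hi with hi | rfl
      · split_ifs with h
        · exact hmax i hi θ
        · exact (hmax i hi θ).trans (not_le.1 h).le
      · split_ifs with h
        · exact h
        · exact le_rfl

/-- The radial maximal theorem on the unit disc. -/
theorem lintegral_iSup_enorm_rpow_le {h : ℂ → ℂ} (hh : DiffContOnCl ℂ h (ball 0 1))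
    {p : ℝ} (hp : 0 < p) {ρ : ℕ → ℝ} (h0 : ∀ i, 0 ≤ ρ i) (h1 : ∀ i, ρ i < 1) :
    ∫⁻ θ, ⨆ i, ‖h (circleMap 0 (ρ i) θ)‖ₑ ^ p ∂angleMeasure ≤
      256 * ∫⁻ θ, ‖h (circleMap 0 1 θ)‖ₑ ^ p ∂angleMeasure := by
  have hu : ∀ i, Measurable fun θ => ‖h (circleMap 0 (ρ i) θ)‖ := fun i =>
    (hh.continuousOn.comp_continuous (continuous_circleMap 0 _) (fun θ => subset_closure
      (by simp [abs_of_nonneg (h0 i), h1 i]))).norm.measurable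
  have e : ∀ θ, ⨆ i, ‖h (circleMap 0 (ρ i) θ)‖ₑ ^ p =
      ⨆ N : ℕ, ⨆ i ≤ N, ‖h (circleMap 0 (ρ i) θ)‖ₑ ^ p := fun θ =>
    (biSup_le_eq_iSup (f := fun i => ‖h (circleMap 0 (ρ i) θ)‖ₑ ^ p)).symm
  have hm : ∀ i, Measurable fun θ => ‖h (circleMap 0 (ρ i) θ)‖ₑ ^ p := fun i => by
    have := (hu i).ennreal_ofReal.pow_const p
    simpa only [ofReal_norm] using this
  simp_rw [e]
  rw [lintegral_iSup]
  · refine iSup_le fun N => ?_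
    obtain ⟨r, hr, -, hmem, hmax⟩ := exists_measurable_selection
      (u := fun s θ => ‖h (circleMap 0 s θ)‖) hu N
    have hR : ∃ R < 1, ∀ i ≤ N, ρ i ≤ R := by
      refine ⟨(Finset.range (N + 1)).sup' Finset.nonempty_range_add_one ρ, ?_, fun i hi => ?_⟩
      · exact (Finset.sup'_lt_iff _).2 fun i _ => h1 i
      · exact Finset.le_sup' ρ (by simp; omega)
    obtain ⟨R, hR, hρR⟩ := hR
    refine le_trans (lintegral_mono fun θ => ?_)
      (lintegral_enorm_rpow_selection_le hh hp hr hR (fun θ => ?_) (fun θ => ?_))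
    · refine iSup₂_le fun i hi => ?_
      rw [← ofReal_norm, ← ofReal_norm]
      gcongr
      exact hmax i hi θ
    · obtain ⟨i, -, h⟩ := hmem θ
      rw [h]; exact h0 i
    · obtain ⟨i, hi, h⟩ := hmem θ
      rw [h]; exact hρR i hi
  · intro N
    exact Measurable.iSup fun i => Measurable.iSup fun _ => hm i
  · intro N M hNM θ
    exact biSup_mono fun i hi => hi.trans hNM

lemma norm_inv_norm_smul_sub_le {E : Type*} [NormedAddCommGroup E] [NormedSpace ℝ E] {u w : E} (hu : 1 ≤ ‖u‖) (hw : 1 ≤ ‖w‖) :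
    ‖‖u‖⁻¹ • u - ‖w‖⁻¹ • w‖ ≤ 2 * ‖u - w‖ := by
  have hu0 : 0 < ‖u‖ := by linarith
  have hw0 : 0 < ‖w‖ := by linarith
  have e : ‖u‖⁻¹ • u - ‖w‖⁻¹ • w = ‖u‖⁻¹ • ((u - w) + ((‖w‖ - ‖u‖) * ‖w‖⁻¹) • w) := by
    rw [smul_add, smul_sub, smul_smul]
    have : ‖u‖⁻¹ * ((‖w‖ - ‖u‖) * ‖w‖⁻¹) = ‖u‖⁻¹ - ‖w‖⁻¹ := by field_simp
    rw [this, sub_smul]; abel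
  have h1 : ‖((‖w‖ - ‖u‖) * ‖w‖⁻¹) • w‖ ≤ ‖u - w‖ := by
    rw [norm_smul, norm_mul, norm_inv, norm_norm, mul_assoc, inv_mul_cancel₀ hw0.ne', mul_one,
      Real.norm_eq_abs, norm_sub_rev]
    exact abs_norm_sub_norm_le w u
  rw [e, norm_smul, norm_inv, norm_norm]
  calc ‖u‖⁻¹ * _ ≤ 1 * (‖u - w‖ + ‖u - w‖) := by
        gcongr
        · exact inv_le_one_of_one_le₀ hu
        · exact (norm_add_le _ _).trans (by gcongr)
    _ = _ := by ring

section HausdorffSphere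

variable {E : Type*} [NormedAddCommGroup E] [InnerProductSpace ℝ E] [FiniteDimensional ℝ E]
  [MeasurableSpace E] [BorelSpace E]

lemma hausdorffMeasure_sphere_lt_top {d : ℕ} (hd : Module.finrank ℝ E = d + 1) :
    μH[d] (sphere (0:E) 1) < ⊤ := by
  refine (isCompact_sphere (0:E) 1).measure_lt_top_of_nhdsWithin fun v hv => ?_
  have hv : ‖v‖ = 1 := by simpa using hv
  refine ⟨{x ∈ sphere (0:E) 1 | 1 / 2 < inner ℝ v x}, ?_, ?_⟩
  · refine inter_mem self_mem_nhdsWithin (mem_nhdsWithin_of_mem_nhds ?_)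
    have ho : IsOpen {x : E | (1 / 2 : ℝ) < inner ℝ v x} :=
      isOpen_lt continuous_const (Continuous.inner (𝕜 := ℝ) continuous_const continuous_id)
    refine ho.mem_nhds ?_
    simp only [mem_ofPred_eq, real_inner_self_eq_norm_sq, hv]; norm_num
  · have hv0 : v ≠ 0 := by intro h; simp [h] at hv
    have : Fact (Module.finrank ℝ E = d + 1) := ⟨hd⟩
    let F := (ℝ ∙ v)ᗮ
    have hF : Module.finrank ℝ F = d := Submodule.finrank_orthogonal_span_singleton hv0
    let Φ : F → E := fun w => ‖v + (w:E)‖⁻¹ • (v + (w:E))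
    have hn : ∀ w : F, 1 ≤ ‖v + (w:E)‖ := by
      intro w
      have h0 : inner ℝ v (w:E) = 0 := Submodule.mem_orthogonal_singleton_iff_inner_right.1 w.2
      have := norm_add_sq_eq_norm_sq_add_norm_sq_real h0
      rw [hv] at this
      nlinarith [norm_nonneg (v + (w:E)), norm_nonneg (w:E)]
    have hΦ : LipschitzWith 2 Φ := LipschitzWith.of_dist_le_mul fun w w' => by
      rw [dist_eq_norm]
      refine (norm_inv_norm_smul_sub_le (hn w) (hn w')).trans (le_of_eq ?_)
      rw [add_sub_add_left_eq_sub, dist_eq_norm]; rfl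
    have hsub : {x ∈ sphere (0:E) 1 | 1 / 2 < inner ℝ v x} ⊆ Φ '' closedBall 0 3 := by
      rintro x ⟨hx, hvx⟩
      have hx : ‖x‖ = 1 := by simpa using hx
      have hpos : 0 < inner ℝ v x := by linarith
      have hi : (inner ℝ v x)⁻¹ ≤ 2 := by
        rw [inv_le_comm₀ hpos (by norm_num)]; linarith
      refine ⟨⟨(inner ℝ v x)⁻¹ • x - v, ?_⟩, ?_, ?_⟩
      · rw [Submodule.mem_orthogonal_singleton_iff_inner_right, inner_sub_right, inner_smul_right,
          inv_mul_cancel₀ hpos.ne', real_inner_self_eq_norm_sq, hv]; norm_num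
      · rw [mem_closedBall_zero_iff, Submodule.coe_norm]
        refine (norm_sub_le _ _).trans ?_
        rw [norm_smul, hx, hv, norm_inv, Real.norm_of_nonneg hpos.le]
        linarith
      · simp only [Φ, add_sub_cancel]
        rw [norm_smul, hx, norm_inv, Real.norm_of_nonneg hpos.le, mul_one, inv_inv, smul_smul,
          mul_inv_cancel₀ hpos.ne', one_smul]
    refine (measure_mono hsub).trans_lt (((hΦ.lipschitzOnWith (s := closedBall 0 3)).hausdorffMeasure_image_le
      (Nat.cast_nonneg d)).trans_lt ?_)
    refine ENNReal.mul_lt_top (by simp) ?_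
    have : (μH[d] : Measure F).IsAddHaarMeasure := by
      rw [← hF]; exact isAddHaarMeasure_hausdorffMeasure
    exact measure_closedBall_lt_top

lemma hausdorffMeasure_sphere_pos {d : ℕ} (hd : Module.finrank ℝ E = d + 1) :
    0 < μH[d] (sphere (0:E) 1) := by
  have : Nontrivial E := Module.nontrivial_of_finrank_pos (R := ℝ) (by omega)
  obtain ⟨v, hv⟩ := exists_norm_eq E zero_le_one
  have hv0 : v ≠ 0 := by intro h; simp [h] at hv
  have : Fact (Module.finrank ℝ E = d + 1) := ⟨hd⟩
  let F := (ℝ ∙ v)ᗮ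
  have hF : Module.finrank ℝ F = d := Submodule.finrank_orthogonal_span_singleton hv0
  have : (μH[d] : Measure F).IsAddHaarMeasure := by
    rw [← hF]; exact isAddHaarMeasure_hausdorffMeasure
  have hP : LipschitzWith 1 (F.orthogonalProjectionOnto) := by
    have := F.orthogonalProjectionOnto.lipschitz
    exact this.weaken (by exact_mod_cast F.orthogonalProjectionOnto_norm_le)
  have hsub : closedBall (0:F) 1 ⊆ F.orthogonalProjectionOnto '' sphere (0:E) 1 := by
    intro w hw
    have hw : ‖(w:E)‖ ≤ 1 := by simpa using hw
    have h0 : inner ℝ (w:E) v = 0 := by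
      rw [real_inner_comm]; exact Submodule.mem_orthogonal_singleton_iff_inner_right.1 w.2
    have hs : 0 ≤ 1 - ‖(w:E)‖ ^ 2 := by nlinarith [norm_nonneg (w:E)]
    refine ⟨(w:E) + √(1 - ‖(w:E)‖ ^ 2) • v, ?_, ?_⟩
    · rw [mem_sphere_zero_iff_norm]
      have h1 := norm_add_sq_eq_norm_sq_add_norm_sq_real
        (x := (w:E)) (y := √(1 - ‖(w:E)‖ ^ 2) • v) (by rw [inner_smul_right, h0, mul_zero])
      rw [norm_smul, hv, mul_one, Real.norm_of_nonneg (Real.sqrt_nonneg _),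
        Real.mul_self_sqrt hs] at h1
      nlinarith [norm_nonneg ((w:E) + √(1 - ‖(w:E)‖ ^ 2) • v)]
    · rw [map_add, map_smul, Submodule.orthogonalProjectionOnto_mem_subspace_eq_self,
        Submodule.orthogonalProjectionOnto_orthogonalComplement_singleton_eq_zero, smul_zero, add_zero]
  have h1 : 0 < μH[d] (closedBall (0:F) 1) := measure_closedBall_pos _ _ one_pos
  have h2 := (hP.lipschitzOnWith (s := sphere (0:E) 1)).hausdorffMeasure_image_le (Nat.cast_nonneg d)
  simp only [ENNReal.coe_one, ENNReal.one_rpow, one_mul] at h2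
  exact (h1.trans_le (measure_mono hsub)).trans_le h2

end HausdorffSphere

section InvariantMeasures

variable {E : Type*} [NormedAddCommGroup E] [InnerProductSpace ℝ E]
  [MeasurableSpace E] [BorelSpace E]

lemma measure_ball_eq_of_invariant {μ : Measure E}
    (hμ : ∀ L : E ≃ₗᵢ[ℝ] E, μ.map L = μ) {η η' : E} (h : ‖η‖ = ‖η'‖) (δ : ℝ) :
    μ (ball η δ) = μ (ball η' δ) := by
  have hL : ((ℝ ∙ (η - η'))ᗮ).reflection η = η' := Submodule.reflection_sub h
  conv_rhs => rw [← hμ ((ℝ ∙ (η - η'))ᗮ).reflection]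
  rw [Measure.map_apply (LinearIsometryEquiv.continuous _).measurable measurableSet_ball]
  congr 1
  ext x
  have := LinearIsometryEquiv.dist_map ((ℝ ∙ (η - η'))ᗮ.reflection) x η
  rw [hL] at this
  simp only [mem_preimage, mem_ball, this]

variable [FiniteDimensional ℝ E]

lemma lintegral_le_of_invariant {μ ν : Measure E} [IsFiniteMeasure μ] [IsFiniteMeasure ν]
    (hμs : ∀ᵐ x ∂μ, ‖x‖ = 1) (hνs : ∀ᵐ x ∂ν, ‖x‖ = 1) (h : μ univ = ν univ)
    (hμ : ∀ L : E ≃ₗᵢ[ℝ] E, μ.map L = μ) (hν : ∀ L : E ≃ₗᵢ[ℝ] E, ν.map L = ν)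
    {f : E → ℝ≥0} (hf : Continuous f) : ∫⁻ x, f x ∂μ ≤ ∫⁻ x, f x ∂ν := by
  rcases eq_or_ne (μ univ) 0 with h0 | h0
  · rw [Measure.measure_univ_eq_zero.1 h0]; simp
  have hMt : ν univ ≠ ⊤ := measure_ne_top _ _
  suffices key : ∀ ε : ℝ≥0, 0 < ε → ∫⁻ x, f x ∂μ ≤ ∫⁻ x, f x ∂ν + ε * ν univ by
    refine ENNReal.le_of_forall_pos_le_add fun ε hε _ => ?_
    have hM0 : 0 < (ν univ).toNNReal := ENNReal.toNNReal_pos (h ▸ h0) hMt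
    refine (key (ε / (ν univ).toNNReal) (by positivity)).trans (le_of_eq ?_)
    nth_rewrite 2 [← ENNReal.coe_toNNReal hMt]
    rw [← ENNReal.coe_mul, div_mul_cancel₀ _ hM0.ne']
  intro ε hε
  have huc : UniformContinuousOn f (sphere 0 1) :=
    (isCompact_sphere (0:E) 1).uniformContinuousOn_of_continuous hf.continuousOn
  obtain ⟨δ, hδ, hfδ⟩ := Metric.uniformContinuousOn_iff.1 huc ε (by exact_mod_cast hε)
  have hS0 : μ (sphere 0 1) ≠ 0 := by
    rwa [measure_congr (t := univ)]
    filter_upwards [hμs] with x hx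
    exact eq_iff_iff.2 ⟨fun _ => mem_univ x, fun _ => mem_sphere_zero_iff_norm.2 hx⟩
  obtain ⟨η, hη, hpos⟩ := exists_mem_forall_mem_nhdsWithin_pos_measure hS0
  have hη : ‖η‖ = 1 := by simpa using hη
  have hh0 : 0 < μ (ball η δ) := hpos _ (mem_nhdsWithin_of_mem_nhds (ball_mem_nhds η hδ))
  let I : E → E → ℝ≥0∞ := fun x => (ball x δ).indicator 1
  have hI : Measurable (Function.uncurry I) := by
    have : Function.uncurry I = {q : E × E | dist q.2 q.1 < δ}.indicator 1 := by
      ext ⟨x, y⟩; rfl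
    rw [this]
    exact measurable_one.indicator (measurableSet_lt (measurable_snd.dist measurable_fst)
      measurable_const)
  have hIsymm : ∀ x y, I x y = I y x := fun x y => by
    simp only [I, indicator, mem_ball, dist_comm, Pi.one_apply]
  have hIx : ∀ x, Measurable (I x) := fun x => hI.comp measurable_prodMk_left
  have hIint : ∀ (ρ : Measure E) x, ∫⁻ y, I x y ∂ρ = ρ (ball x δ) := fun ρ x =>
    lintegral_indicator_one measurableSet_ball
  have hfm : Measurable fun x => (f x : ℝ≥0∞) := hf.measurable.coe_nnreal_ennreal
  have hk : ∀ {u : E → ℝ≥0∞}, Measurable u →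
      ∫⁻ x, ∫⁻ y, u x * I x y ∂ν ∂μ = (∫⁻ x, u x ∂μ) * ν (ball η δ) := by
    intro u hu
    rw [← lintegral_mul_const _ hu]
    refine lintegral_congr_ae ?_
    filter_upwards [hμs] with x hx
    rw [lintegral_const_mul _ (hIx x), hIint,
      measure_ball_eq_of_invariant hν (hx.trans hη.symm)]
  have hh : ∀ {u : E → ℝ≥0∞}, Measurable u →
      ∫⁻ x, ∫⁻ y, u y * I x y ∂ν ∂μ = (∫⁻ y, u y ∂ν) * μ (ball η δ) := by
    intro u hu
    rw [lintegral_lintegral_swap (((hu.comp measurable_snd).mul hI).aemeasurable),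
      ← lintegral_mul_const _ hu]
    refine lintegral_congr_ae ?_
    filter_upwards [hνs] with y hy
    simp_rw [fun x => hIsymm x y]
    rw [lintegral_const_mul _ (hIx y), hIint,
      measure_ball_eq_of_invariant hμ (hy.trans hη.symm)]
  have hkh : ν (ball η δ) = μ (ball η δ) := by
    have := (hk (u := fun _ => 1) measurable_const).symm.trans
      (hh (u := fun _ => 1) measurable_const)
    simp only [lintegral_const, one_mul, h] at this
    exact (ENNReal.mul_right_inj (h ▸ h0) hMt).1 this
  have hle : ∫⁻ x, ∫⁻ y, f x * I x y ∂ν ∂μ ≤ ∫⁻ x, ∫⁻ y, (f y + ε) * I x y ∂ν ∂μ := by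
    refine lintegral_mono_ae ?_
    filter_upwards [hμs] with x hx
    refine lintegral_mono_ae ?_
    filter_upwards [hνs] with y hy
    by_cases hxy : y ∈ ball x δ
    · gcongr
      have h1 := hfδ x (by simpa using hx) y (by simpa using hy) (by rw [dist_comm]; exact hxy)
      rw [NNReal.dist_eq] at h1
      have h2 : (f x : ℝ) ≤ f y + ε := by linarith [(abs_lt.1 h1).2]
      exact_mod_cast h2
    · simp [I, hxy]
  rw [hk hfm, hh (hfm.add_const _), hkh, lintegral_add_right _ measurable_const,
    lintegral_const] at hle
  exact (ENNReal.mul_le_mul_iff_left hh0.ne' (measure_ne_top _ _)).1 hle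

/-- A finite measure on the unit sphere which is invariant under linear isometries is determined by
its total mass. -/
theorem eq_of_invariant {μ ν : Measure E} [IsFiniteMeasure μ] [IsFiniteMeasure ν]
    (hμs : ∀ᵐ x ∂μ, ‖x‖ = 1) (hνs : ∀ᵐ x ∂ν, ‖x‖ = 1) (h : μ univ = ν univ)
    (hμ : ∀ L : E ≃ₗᵢ[ℝ] E, μ.map L = μ) (hν : ∀ L : E ≃ₗᵢ[ℝ] E, ν.map L = ν) : μ = ν :=
  ext_of_forall_lintegral_eq_of_IsFiniteMeasure fun f =>
    le_antisymm (lintegral_le_of_invariant hμs hνs h hμ hν f.continuous)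
      (lintegral_le_of_invariant hνs hμs h.symm hν hμ f.continuous)

/-- Polar integration for finite measures invariant under linear isometries. -/
theorem lintegral_eq_lintegral_lintegral_norm_smul {σ ν : Measure E} [IsProbabilityMeasure σ]
    [IsFiniteMeasure ν] (hσs : ∀ᵐ x ∂σ, ‖x‖ = 1) (hσ : ∀ L : E ≃ₗᵢ[ℝ] E, σ.map L = σ)
    (hν : ∀ L : E ≃ₗᵢ[ℝ] E, ν.map L = ν) (hν0 : ν {0} = 0) {G : E → ℝ≥0∞} (hG : Measurable G) :
    ∫⁻ z, G z ∂ν = ∫⁻ z, ∫⁻ ζ, G (‖z‖ • ζ) ∂σ ∂ν := by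
  let D : E → E := fun z => ‖z‖⁻¹ • z
  have hD : Measurable D := measurable_norm.inv.smul measurable_id
  have hne : ∀ᵐ z ∂ν, z ≠ 0 := by
    rw [ae_iff]; simpa using hν0
  have key : σ.prod (ν.map norm) = ν.map (fun z => (D z, ‖z‖)) := by
    refine Measure.prod_eq fun s t hs ht => ?_
    have hnt : MeasurableSet ((norm : E → ℝ) ⁻¹' t) := measurable_norm ht
    have h1 : (ν.restrict (norm ⁻¹' t)).map D = (ν (norm ⁻¹' t)) • σ := by
      have : IsFiniteMeasure (ν (norm ⁻¹' t) • σ) := σ.smul_finite (measure_ne_top _ _)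
      refine eq_of_invariant ?_ ?_ ?_ ?_ ?_
      · rw [ae_map_iff hD.aemeasurable (measurableSet_eq_fun measurable_norm measurable_const)]
        refine ae_restrict_of_ae ?_
        filter_upwards [hne] with z hz
        have : ‖z‖ ≠ 0 := norm_ne_zero_iff.2 hz
        simp only [D, norm_smul, norm_inv, norm_norm]
        exact inv_mul_cancel₀ this
      · exact Measure.ae_smul_measure hσs _
      · rw [Measure.map_apply hD MeasurableSet.univ]
        simp
      · intro L
        have hL : Measurable L := L.continuous.measurable
        rw [Measure.map_map hL hD]
        have e1 : L ∘ D = D ∘ L := by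
          ext z; simp [D]
        rw [e1, ← Measure.map_map hD hL]
        congr 1
        have e2 : (norm : E → ℝ) ⁻¹' t = L ⁻¹' (norm ⁻¹' t) := by
          ext z; simp
        conv_lhs => rw [e2]
        rw [← Measure.restrict_map hL hnt, hν]
      · intro L
        rw [Measure.map_smul, hσ]
    have h2 := congrArg (fun m => m s) h1
    simp only [Measure.smul_apply, smul_eq_mul] at h2
    rw [Measure.map_apply hD hs, Measure.restrict_apply (hD hs)] at h2
    rw [Measure.map_apply (hD.prodMk measurable_norm) (hs.prod ht), Measure.map_apply
      measurable_norm ht, mul_comm, ← h2]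
    rfl
  have hm : Measurable fun q : E × ℝ => G (q.2 • q.1) :=
    hG.comp (measurable_snd.smul measurable_fst)
  calc ∫⁻ z, G z ∂ν = ∫⁻ z, G (‖z‖ • D z) ∂ν := by
        refine lintegral_congr_ae ?_
        filter_upwards [hne] with z hz
        have : ‖z‖ ≠ 0 := norm_ne_zero_iff.2 hz
        simp only [D, smul_smul, mul_inv_cancel₀ this, one_smul]
    _ = ∫⁻ q, G (q.2 • q.1) ∂(ν.map (fun z => (D z, ‖z‖))) := by
        rw [lintegral_map hm (hD.prodMk measurable_norm)]
    _ = ∫⁻ r, ∫⁻ ζ, G (r • ζ) ∂σ ∂(ν.map norm) := by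
        rw [← key, lintegral_prod_symm _ hm.aemeasurable]
    _ = _ := by
        rw [lintegral_map _ measurable_norm]
        exact Measurable.lintegral_prod_left' (f := fun q : E × ℝ => G (q.2 • q.1)) hm

end InvariantMeasures

lemma finrank_real_En (n : ℕ) : Module.finrank ℝ (En n) = 2 * n := by
  rw [finrank_real_of_complex, finrank_euclideanSpace_fin]

lemma nontrivial_En {n : ℕ} (hn : 1 ≤ n) : Nontrivial (En n) :=
  Module.nontrivial_of_finrank_pos (R := ℝ) (by rw [finrank_real_En]; omega)

lemma isProbabilityMeasure_sigmaS {n : ℕ} (hn : 1 ≤ n) : IsProbabilityMeasure (sigmaS n) := by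
  have hd : Module.finrank ℝ (En n) = (2 * n - 1) + 1 := by rw [finrank_real_En]; omega
  have hc : (2 * n - 1 : ℝ) = ((2 * n - 1 : ℕ) : ℝ) := by
    rw [Nat.cast_sub (by omega)]; push_cast; ring
  constructor
  rw [sigmaS, Measure.smul_apply, Measure.restrict_apply MeasurableSet.univ, univ_inter, Sn, hc,
    smul_eq_mul]
  exact ENNReal.inv_mul_cancel (hausdorffMeasure_sphere_pos hd).ne'
    (hausdorffMeasure_sphere_lt_top hd).ne

lemma ae_norm_eq_one_sigmaS (n : ℕ) : ∀ᵐ ζ ∂(sigmaS n), ‖ζ‖ = 1 := by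
  refine Measure.ae_smul_measure ?_ _
  filter_upwards [ae_restrict_mem (s := Sn n) isClosed_sphere.measurableSet] with ζ hζ
  exact mem_sphere_zero_iff_norm.1 hζ

lemma map_linearIsometryEquiv_sigmaS {n : ℕ} (L : En n ≃ₗᵢ[ℝ] En n) :
    (sigmaS n).map L = sigmaS n := by
  have hpre : Sn n = L ⁻¹' (Sn n) := by
    ext z; simp [Sn]
  rw [sigmaS, Measure.map_smul]
  congr 1
  conv_lhs => rw [hpre]
  rw [← Measure.restrict_map L.continuous.measurable (show MeasurableSet (Sn n) from isClosed_sphere.measurableSet)]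
  congr 1
  exact (L.toIsometryEquiv.measurePreserving_hausdorffMeasure _).map_eq

/-- Multiplication by `circleMap 0 1 θ` as a real linear isometry of `ℂⁿ`. -/
def circleRotation (n : ℕ) (θ : ℝ) : En n ≃ₗᵢ[ℝ] En n where
  toFun z := circleMap 0 1 θ • z
  invFun z := circleMap 0 1 (-θ) • z
  map_add' := smul_add _
  map_smul' c z := smul_comm _ c z
  left_inv z := by
    simp only [smul_smul, circleMap, Complex.ofReal_neg]
    rw [show (0 + ((1:ℝ):ℂ) * Complex.exp (-(θ:ℂ) * Complex.I)) *
      (0 + ((1:ℝ):ℂ) * Complex.exp ((θ:ℂ) * Complex.I)) = 1 by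
        rw [zero_add, zero_add, Complex.ofReal_one, one_mul, one_mul, ← Complex.exp_add]; simp,
      one_smul]
  right_inv z := by
    simp only [smul_smul, circleMap, Complex.ofReal_neg]
    rw [show (0 + ((1:ℝ):ℂ) * Complex.exp ((θ:ℂ) * Complex.I)) *
      (0 + ((1:ℝ):ℂ) * Complex.exp (-(θ:ℂ) * Complex.I)) = 1 by
        rw [zero_add, zero_add, Complex.ofReal_one, one_mul, one_mul, ← Complex.exp_add]; simp,
      one_smul]
  norm_map' z := by
    change ‖circleMap 0 1 θ • z‖ = ‖z‖
    rw [norm_smul]; simp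

/-- Integration over the sphere by slices. -/
theorem lintegral_sigmaS_eq_lintegral_slices {n : ℕ} (hn : 1 ≤ n) {Φ : En n → ℝ≥0∞}
    (hΦ : Measurable Φ) :
    ∫⁻ ζ, Φ ζ ∂(sigmaS n) =
      ∫⁻ ζ, ∫⁻ θ, Φ (circleMap 0 1 θ • ζ) ∂angleMeasure ∂(sigmaS n) := by
  have := isProbabilityMeasure_sigmaS hn
  have hm : Measurable fun q : En n × ℝ => Φ (circleMap 0 1 q.2 • q.1) :=
    hΦ.comp (((continuous_circleMap 0 1).measurable.comp measurable_snd).smul measurable_fst)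
  rw [lintegral_lintegral_swap (f := fun ζ θ => Φ (circleMap 0 1 θ • ζ)) hm.aemeasurable]
  have h1 : ∀ θ, ∫⁻ ζ, Φ (circleMap 0 1 θ • ζ) ∂(sigmaS n) = ∫⁻ ζ, Φ ζ ∂(sigmaS n) := by
    intro θ
    conv_rhs => rw [← map_linearIsometryEquiv_sigmaS (circleRotation n θ)]
    rw [lintegral_map hΦ (circleRotation n θ).continuous.measurable]
    rfl
  simp_rw [h1]
  simp

/-- Lebesgue measure on `ℂⁿ`, up to normalization. -/
def lebE (n : ℕ) : Measure (En n) := μH[Module.finrank ℝ (En n)]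

instance (n : ℕ) : (lebE n).IsAddHaarMeasure := isAddHaarMeasure_hausdorffMeasure

lemma map_linearIsometryEquiv_lebE {n : ℕ} (L : En n ≃ₗᵢ[ℝ] En n) :
    (lebE n).map L = lebE n :=
  (L.toIsometryEquiv.measurePreserving_hausdorffMeasure _).map_eq

/-- Polar integration over a spherical shell. -/
theorem setLIntegral_lebE_shell {n : ℕ} (hn : 1 ≤ n) {T : Set ℝ} (hT : MeasurableSet T)
    (hTb : T ⊆ Iio 1) {G : En n → ℝ≥0∞} (hG : Measurable G) :
    ∫⁻ z in norm ⁻¹' T, G z ∂(lebE n) =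
      ∫⁻ z in norm ⁻¹' T, ∫⁻ ζ, G (‖z‖ • ζ) ∂(sigmaS n) ∂(lebE n) := by
  have := isProbabilityMeasure_sigmaS hn
  have := nontrivial_En hn
  have hfin : IsFiniteMeasure ((lebE n).restrict (norm ⁻¹' T)) := by
    refine isFiniteMeasure_restrict.2 (ne_top_of_le_ne_top ?_ (measure_mono
      (t := ball (0 : En n) 1) ?_))
    · exact measure_ball_lt_top.ne
    · intro z hz; simpa using hTb hz
  refine lintegral_eq_lintegral_lintegral_norm_smul (ae_norm_eq_one_sigmaS n)
    map_linearIsometryEquiv_sigmaS (fun L => ?_) ?_ hG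
  · have e2 : (norm : En n → ℝ) ⁻¹' T = L ⁻¹' (norm ⁻¹' T) := by
      ext z; simp
    conv_lhs => rw [e2]
    rw [← Measure.restrict_map L.continuous.measurable (measurable_norm hT),
      map_linearIsometryEquiv_lebE]
  · exact le_antisymm ((Measure.restrict_apply_le _ _).trans (measure_singleton _).le) zero_le

/-- The diagonal map `z ↦ (l k * z k)` on `ℂⁿ`. -/
def diagE {n : ℕ} (l : Fin n → ℝ) : En n →ₗ[ℂ] En n :=
  Matrix.toLin (EuclideanSpace.basisFun (Fin n) ℂ).toBasis (EuclideanSpace.basisFun (Fin n) ℂ).toBasis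
    (Matrix.diagonal fun k => (l k : ℂ))

lemma diagE_apply {n : ℕ} (l : Fin n → ℝ) (z : En n) (k : Fin n) :
    diagE l z k = l k * z k := by
  have h := Matrix.repr_toLin (EuclideanSpace.basisFun (Fin n) ℂ).toBasis
    (EuclideanSpace.basisFun (Fin n) ℂ).toBasis
    (Matrix.diagonal fun k => (l k : ℂ)) z
  have h2 := congrFun h k
  rw [Matrix.mulVec_diagonal] at h2
  simpa [diagE] using h2

lemma det_restrictScalars_diagE {n : ℕ} (l : Fin n → ℝ) :
    LinearMap.det ((diagE l).restrictScalars ℝ) = ∏ k, l k ^ 2 := by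
  rw [LinearMap.det_restrictScalars, diagE, LinearMap.det_toLin, Matrix.det_diagonal,
    Algebra.norm_complex_eq, map_prod]
  simp [Complex.normSq_apply, sq]

lemma lintegral_add_diagE {n : ℕ} {l : Fin n → ℝ} (hl : ∀ k, 0 < l k) (a : En n)
    {G : En n → ℝ≥0∞} (hG : Measurable G) :
    ∫⁻ w, G (a + diagE l w) ∂(lebE n) =
      ENNReal.ofReal (∏ k, l k ^ 2)⁻¹ * ∫⁻ z, G z ∂(lebE n) := by
  have hpos : 0 < ∏ k, l k ^ 2 := Finset.prod_pos fun k _ => pow_pos (hl k) 2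
  have hdet : LinearMap.det ((diagE l).restrictScalars ℝ) ≠ 0 := by
    rw [det_restrictScalars_diagE]; exact hpos.ne'
  have h := Measure.map_linearMap_addHaar_eq_smul_addHaar (lebE n) hdet
  rw [det_restrictScalars_diagE, abs_of_pos (inv_pos.2 hpos)] at h
  have hm : Measurable ((diagE l).restrictScalars ℝ) :=
    (LinearMap.continuous_of_finiteDimensional _).measurable
  calc ∫⁻ w, G (a + diagE l w) ∂(lebE n)
      = ∫⁻ w, G (a + w) ∂((lebE n).map ((diagE l).restrictScalars ℝ)) := by
        exact (lintegral_map (f := fun w => G (a + w)) (hG.comp (measurable_const_add a)) hm).symm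
    _ = ENNReal.ofReal (∏ k, l k ^ 2)⁻¹ * ∫⁻ w, G (a + w) ∂(lebE n) := by
        rw [h, lintegral_smul_measure, smul_eq_mul]
    _ = _ := by rw [lintegral_add_left_eq_self]

lemma lebE_ball {n : ℕ} {r : ℝ} (hr : 0 < r) :
    lebE n (ball 0 r) = ENNReal.ofReal (r ^ (2 * n)) * lebE n (ball 0 1) := by
  rw [Measure.addHaar_ball_of_pos (lebE n) 0 hr, finrank_real_En]

lemma lebE_ball_pos (n : ℕ) : 0 < lebE n (ball 0 1) := measure_ball_pos _ _ one_pos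

lemma lebE_ball_ne_top (n : ℕ) : lebE n (ball 0 1) ≠ ⊤ := measure_ball_lt_top.ne

lemma lebE_shell_le {n : ℕ} (hn : 1 ≤ n) {x : ℝ} :
    lebE n (norm ⁻¹' (Ioo (1 - x) 1)) ≤
      ENNReal.ofReal (2 * n * x) * lebE n (ball 0 1) := by
  have hn' : (1 : ℝ) ≤ n := by exact_mod_cast hn
  rcases le_or_gt 1 x with h1 | h1
  · calc lebE n (norm ⁻¹' (Ioo (1 - x) 1)) ≤ lebE n (ball 0 1) :=
        measure_mono fun z hz => by simpa using hz.2
      _ ≤ _ := le_mul_of_one_le_left zero_le (by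
        rw [← ENNReal.ofReal_one]; exact ENNReal.ofReal_le_ofReal (by nlinarith))
  · have hsub : (norm : En n → ℝ) ⁻¹' (Ioo (1 - x) 1) ⊆ ball 0 1 \ ball 0 (1 - x) := by
      intro z hz
      refine ⟨by simpa using hz.2, ?_⟩
      have h2 := hz.1
      simp only [mem_ball, dist_zero_right]
      linarith
    rcases lt_or_ge x 0 with h0 | h0
    · have : (norm : En n → ℝ) ⁻¹' (Ioo (1 - x) 1) = ∅ := by
        ext z
        simp only [mem_preimage, mem_Ioo, mem_empty_iff_false, iff_false]
        intro h; linarith [h.1, h.2]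
      rw [this]; simp
    refine (measure_mono hsub).trans ?_
    rw [measure_sdiff (ball_subset_ball (by linarith)) measurableSet_ball.nullMeasurableSet
      measure_ball_lt_top.ne, lebE_ball (r := 1 - x) (by linarith)]
    refine tsub_le_iff_right.2 ?_
    rw [← add_mul, ← ENNReal.ofReal_add (by positivity) (pow_nonneg (by linarith) _)]
    refine le_mul_of_one_le_left zero_le ?_
    rw [← ENNReal.ofReal_one]
    refine ENNReal.ofReal_le_ofReal ?_
    have := one_add_mul_le_pow (a := -x) (by linarith) (2 * n)
    push_cast at this
    rw [← sub_eq_add_neg] at this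
    linarith

theorem setLIntegral_shell_le {n : ℕ} (hn : 1 ≤ n) {x : ℝ} {G : En n → ℝ≥0∞} (hG : Measurable G)
    {H : ℝ≥0∞} (hH : ∀ r ∈ Ioo (0 : ℝ) 1, ∫⁻ ζ, G (r • ζ) ∂(sigmaS n) ≤ H) :
    ∫⁻ z in norm ⁻¹' (Ioo (1 - x) 1), G z ∂(lebE n) ≤
      H * (ENNReal.ofReal (2 * n * x) * lebE n (ball 0 1)) := by
  have := nontrivial_En hn
  rw [setLIntegral_lebE_shell hn measurableSet_Ioo (fun t ht => ht.2) hG]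
  calc _ ≤ ∫⁻ z in (norm : En n → ℝ) ⁻¹' (Ioo (1 - x) 1), H ∂(lebE n) := by
        refine lintegral_mono_ae ?_
        have h0 : ∀ᵐ z ∂(lebE n).restrict (norm ⁻¹' (Ioo (1 - x) 1)), z ≠ (0 : En n) :=
          ae_restrict_of_ae (compl_mem_ae_iff.2 (measure_singleton _))
        filter_upwards [h0, ae_restrict_mem (measurable_norm measurableSet_Ioo)] with z hz hz2
        exact hH _ ⟨norm_pos_iff.2 hz, hz2.2⟩
    _ = H * lebE n (norm ⁻¹' (Ioo (1 - x) 1)) := by simp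
    _ ≤ _ := by gcongr; exact lebE_shell_le hn

lemma norm_add_diagE_sq {n : ℕ} (i : Fin n) {ρ d : ℝ} (hd : 0 < d) {w : En n} :
    ‖EuclideanSpace.single i (ρ : ℂ) + diagE (fun k => if k = i then d / 4 else √d / 2) w‖ ^ 2 =
      ‖(ρ : ℂ) + (d / 4 : ℝ) * w i‖ ^ 2 + d / 4 * (‖w‖ ^ 2 - ‖w i‖ ^ 2) := by
  rw [EuclideanSpace.norm_sq_eq, EuclideanSpace.norm_sq_eq,
    ← Finset.add_sum_erase _ _ (Finset.mem_univ i), ← Finset.add_sum_erase (a := i) _ (fun k => ‖w k‖ ^ 2) (Finset.mem_univ i),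
    add_sub_cancel_left, Finset.mul_sum]
  congr 1
  · simp [diagE_apply]
  · refine Finset.sum_congr rfl fun k hk => ?_
    have hk : k ≠ i := (Finset.mem_erase.1 hk).1
    simp [diagE_apply, hk, mul_pow, div_pow, Real.sq_sqrt hd.le]
    exact Or.inl (by norm_num)

lemma norm_add_diagE_mem {n : ℕ} (i : Fin n) {ρ : ℝ} (h0 : 0 ≤ ρ) (h1 : ρ < 1) {w : En n}
    (hw : ‖w‖ < 1) :
    ‖EuclideanSpace.single i (ρ : ℂ) +
      diagE (fun k => if k = i then (1 - ρ) / 4 else √(1 - ρ) / 2) w‖ ∈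
        Ioo (1 - 5 / 4 * (1 - ρ)) 1 := by
  have hsq := norm_add_diagE_sq (ρ := ρ) i (d := 1 - ρ) (by linarith) (w := w)
  set z := EuclideanSpace.single i (ρ : ℂ) +
      diagE (fun k => if k = i then (1 - ρ) / 4 else √(1 - ρ) / 2) w with hz
  have hwi : ‖w i‖ ≤ ‖w‖ := PiLp.norm_apply_le w i
  set d := 1 - ρ
  have hρ : ρ = 1 - d := by simp [d]
  have hd : 0 < d := by simp [d, h1]
  have hnr : ‖((d / 4 : ℝ) : ℂ) * w i‖ = d / 4 * ‖w i‖ := by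
    rw [norm_mul, Complex.norm_real, Real.norm_of_nonneg (by positivity)]
  have hnρ : ‖(ρ : ℂ)‖ = ρ := by rw [Complex.norm_real, Real.norm_of_nonneg h0]
  constructor
  · have h2 : ‖z i‖ ≤ ‖z‖ := PiLp.norm_apply_le z i
    have h3 : z i = (ρ : ℂ) + ((d / 4 : ℝ) : ℂ) * w i := by simp [hz, diagE_apply]
    have h4 := norm_sub_le_norm_add (ρ : ℂ) (((d / 4 : ℝ) : ℂ) * w i)
    rw [hnr, hnρ, ← h3] at h4
    nlinarith [norm_nonneg (w i)]
  · have h4 := norm_add_le (ρ : ℂ) (((d / 4 : ℝ) : ℂ) * w i)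
    rw [hnr, hnρ] at h4
    have h5 : ‖(ρ : ℂ) + ((d / 4 : ℝ) : ℂ) * w i‖ ≤ ρ + d / 4 := by nlinarith
    have h6 : ‖(ρ : ℂ) + ((d / 4 : ℝ) : ℂ) * w i‖ ^ 2 ≤ (ρ + d / 4) ^ 2 := by gcongr
    have h7 : ‖w‖ ^ 2 < 1 := by nlinarith [norm_nonneg w]
    have h8 : ‖z‖ ^ 2 < 1 := by
      rw [hsq]
      nlinarith [sq_nonneg ‖w i‖]
    nlinarith [norm_nonneg z]

/-- Sub-mean value inequality on complex discs contained in the ball. -/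
def LineSubharmonic {n : ℕ} (U : En n → ℝ≥0∞) : Prop :=
  ∀ a v : En n, (∀ c : ℂ, ‖c‖ ≤ 1 → a + c • v ∈ Bn n) →
    U a ≤ ∫⁻ θ, U (a + circleMap 0 1 θ • v) ∂angleMeasure

lemma prod_diag_weights {n : ℕ} (i : Fin n) {d : ℝ} (hd : 0 < d) :
    ∏ k, (if k = i then d / 4 else √d / 2) ^ 2 = (d / 4) ^ (n + 1) := by
  rw [← Finset.mul_prod_erase _ _ (Finset.mem_univ i),
    Finset.prod_congr rfl (g := fun _ => d / 4)]
  · rw [Finset.prod_const, Finset.card_erase_of_mem (Finset.mem_univ i), Finset.card_univ,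
      Fintype.card_fin, if_pos rfl, ← pow_add]
    have := i.pos
    congr 1; omega
  · intro k hk
    rw [if_neg (Finset.mem_erase.1 hk).1, div_pow, Real.sq_sqrt hd.le]; norm_num

lemma LineSubharmonic.le_axis {n : ℕ} (hn : 1 ≤ n) {U : En n → ℝ≥0∞} (hU : LineSubharmonic U)
    (hm : Measurable U) {H : ℝ≥0∞}
    (hH : ∀ r ∈ Ioo (0 : ℝ) 1, ∫⁻ ζ, U (r • ζ) ∂(sigmaS n) ≤ H) (i : Fin n)
    {ρ : ℝ} (h0 : 0 ≤ ρ) (h1 : ρ < 1) :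
    U (EuclideanSpace.single i (ρ : ℂ)) ≤
      ENNReal.ofReal ((4 / (1 - ρ)) ^ (n + 1) * (2 * n * (5 / 4 * (1 - ρ)))) * H := by
  set d := 1 - ρ with hdd
  have hd : 0 < d := by linarith
  set a : En n := EuclideanSpace.single i (ρ : ℂ)
  set l : Fin n → ℝ := fun k => if k = i then d / 4 else √d / 2 with hl
  have hlpos : ∀ k, 0 < l k := by intro k; simp only [hl]; split_ifs <;> positivity
  have hprod : ∏ k, l k ^ 2 = (d / 4) ^ (n + 1) := prod_diag_weights i hd
  have hLm : Measurable (diagE l) :=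
    (LinearMap.continuous_of_finiteDimensional (diagE l)).measurable
  have hcm : Measurable (circleMap 0 1) := (continuous_circleMap 0 1).measurable
  set B := lebE n (ball 0 1)
  have key : U a * B ≤ ENNReal.ofReal ((4 / d) ^ (n + 1)) *
      (H * (ENNReal.ofReal (2 * n * (5 / 4 * d)) * B)) := by
    calc U a * B = ∫⁻ w in ball (0 : En n) 1, U a ∂(lebE n) := by simp [B]
      _ ≤ ∫⁻ w in ball (0 : En n) 1, ∫⁻ θ, U (a + diagE l (circleMap 0 1 θ • w))
            ∂angleMeasure ∂(lebE n) := by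
          refine setLIntegral_mono' measurableSet_ball fun w hw => ?_
          simp only [map_smul]
          refine hU _ _ fun c hc => ?_
          have : ‖c • w‖ < 1 := by
            rw [norm_smul]
            nlinarith [norm_nonneg w, norm_nonneg c, mem_ball_zero_iff.1 hw]
          have := norm_add_diagE_mem i h0 h1 this
          rw [map_smul] at this
          simpa [Bn] using this.2
      _ = ∫⁻ θ, ∫⁻ w in ball (0 : En n) 1, U (a + diagE l (circleMap 0 1 θ • w))
            ∂(lebE n) ∂angleMeasure := by
          refine lintegral_lintegral_swap (Measurable.aemeasurable ?_)
          exact hm.comp (measurable_const.add (hLm.comp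
            ((hcm.comp measurable_snd).smul measurable_fst)))
      _ = ∫⁻ θ, ∫⁻ w in ball (0 : En n) 1, U (a + diagE l w) ∂(lebE n) ∂angleMeasure := by
          refine lintegral_congr fun θ => ?_
          have hmp : MeasurePreserving (circleRotation n θ) (lebE n) (lebE n) :=
            ⟨(circleRotation n θ).continuous.measurable, map_linearIsometryEquiv_lebE _⟩
          have hpre : ball (0 : En n) 1 = circleRotation n θ ⁻¹' ball 0 1 := by
            ext z; simp
          conv_lhs => rw [hpre]
          exact hmp.setLIntegral_comp_preimage measurableSet_ball
            (f := fun w => U (a + diagE l w)) (hm.comp (measurable_const.add hLm))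
      _ = ∫⁻ w in ball (0 : En n) 1, U (a + diagE l w) ∂(lebE n) := by simp
      _ ≤ ∫⁻ w, ((norm : En n → ℝ) ⁻¹' Ioo (1 - 5 / 4 * d) 1).indicator U (a + diagE l w)
            ∂(lebE n) := by
          rw [← lintegral_indicator measurableSet_ball]
          refine lintegral_mono fun w => ?_
          by_cases hw : w ∈ ball (0 : En n) 1
          · rw [indicator_of_mem hw, indicator_of_mem]
            exact norm_add_diagE_mem i h0 h1 (mem_ball_zero_iff.1 hw)
          · rw [indicator_of_notMem hw]; exact zero_le
      _ = ENNReal.ofReal ((4 / d) ^ (n + 1)) *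
            ∫⁻ z in norm ⁻¹' Ioo (1 - 5 / 4 * d) 1, U z ∂(lebE n) := by
          rw [lintegral_add_diagE hlpos a (hm.indicator (measurable_norm measurableSet_Ioo)),
            lintegral_indicator (measurable_norm measurableSet_Ioo), hprod, ← inv_pow, inv_div]
      _ ≤ _ := by gcongr; exact setLIntegral_shell_le hn hm hH
  have hB0 : B ≠ 0 := (lebE_ball_pos n).ne'
  have hBt : B ≠ ⊤ := lebE_ball_ne_top n
  rw [← ENNReal.mul_le_mul_iff_left hB0 hBt]
  refine key.trans_eq ?_
  rw [ENNReal.ofReal_mul (p := (4 / d) ^ (n + 1)) (by positivity)]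
  ring

lemma exists_unitary_single {n : ℕ} (i : Fin n) (a : En n) :
    ∃ T : En n ≃ₗᵢ[ℂ] En n, T (EuclideanSpace.single i (‖a‖ : ℂ)) = a := by
  rcases eq_or_ne a 0 with rfl | ha
  · exact ⟨LinearIsometryEquiv.refl ℂ _, by simp⟩
  have hon : Orthonormal ℂ (({i} : Set (Fin n)).domRestrict
      fun _ => ((‖a‖ : ℂ)⁻¹ • a : En n)) := by
    have h1 : ‖((‖a‖ : ℂ)⁻¹ • a : En n)‖ = 1 := by
      rw [norm_smul, norm_inv, Complex.norm_real, norm_norm, inv_mul_cancel₀ (norm_ne_zero_iff.2 ha)]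
    refine ⟨fun _ => h1, fun j k hjk => ?_⟩
    exact absurd (Subsingleton.elim j k) hjk
  obtain ⟨b, hb⟩ := hon.exists_orthonormalBasis_extension_of_card_eq (by simp)
  refine ⟨b.repr.symm, ?_⟩
  have h2 : EuclideanSpace.single i (‖a‖ : ℂ) = (‖a‖ : ℂ) • EuclideanSpace.single i (1 : ℂ) := by
    ext k; simp
  rw [h2, map_smul, b.repr_symm_single, hb i rfl, smul_smul, mul_inv_cancel₀, one_smul]
  exact_mod_cast norm_ne_zero_iff.2 ha

lemma measurePreserving_unitary_sigmaS {n : ℕ} (T : En n ≃ₗᵢ[ℂ] En n) :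
    MeasurePreserving T (sigmaS n) (sigmaS n) := by
  let T' : En n ≃ₗᵢ[ℝ] En n :=
    { T.toLinearEquiv.restrictScalars ℝ with norm_map' := T.norm_map }
  exact ⟨T.continuous.measurable, map_linearIsometryEquiv_sigmaS T'⟩

theorem LineSubharmonic.le_hardy {n : ℕ} (hn : 1 ≤ n) {U : En n → ℝ≥0∞} (hU : LineSubharmonic U)
    (hm : Measurable U) {H : ℝ≥0∞}
    (hH : ∀ r ∈ Ioo (0 : ℝ) 1, ∫⁻ ζ, U (r • ζ) ∂(sigmaS n) ≤ H) {a : En n} (ha : ‖a‖ < 1) :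
    U a ≤ ENNReal.ofReal (10 * n * 4 ^ n * (1 - ‖a‖) ^ (-n : ℝ)) * H := by
  obtain ⟨T, hT⟩ := exists_unitary_single ⟨0, hn⟩ a
  have hUT : LineSubharmonic (U ∘ T) := by
    intro b v h
    simp only [Function.comp, map_add, map_smul]
    refine hU _ _ fun c hc => ?_
    rw [← map_smul, ← map_add]
    have h2 := h c hc
    rw [Bn, mem_ball_zero_iff] at h2 ⊢
    rwa [T.norm_map]
  have hHT : ∀ r ∈ Ioo (0 : ℝ) 1, ∫⁻ ζ, (U ∘ T) (r • ζ) ∂(sigmaS n) ≤ H := by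
    intro r hr
    refine le_trans (le_of_eq ?_) (hH r hr)
    rw [← (measurePreserving_unitary_sigmaS T).lintegral_comp (f := fun ζ => U (r • ζ))
      (hm.comp (measurable_const_smul r))]
    refine lintegral_congr fun ζ => ?_
    simp only [Function.comp]
    congr 1
    exact LinearMap.map_smul_of_tower (T.toLinearEquiv : En n →ₗ[ℂ] En n) r ζ
  have h := hUT.le_axis hn (hm.comp T.continuous.measurable) hHT ⟨0, hn⟩ (norm_nonneg a) ha
  simp only [Function.comp, hT] at h
  refine h.trans_eq ?_
  congr 2
  have hd : 0 < 1 - ‖a‖ := by linarith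
  rw [Real.rpow_neg hd.le, Real.rpow_natCast, div_pow]
  field_simp
  ring

/-- Holomorphy along every complex line in the ball. -/
def LineHol {n : ℕ} (F : En n → ℂ) : Prop :=
  ∀ z w : En n, DifferentiableOn ℂ (fun c : ℂ => F (z + c • w)) {c | z + c • w ∈ Bn n}

lemma DifferentiableOn.lineHol {n : ℕ} {f : En n → ℂ} (hf : DifferentiableOn ℂ f (Bn n)) :
    LineHol f := fun z w =>
  hf.comp (f := fun c : ℂ => z + c • w) (by fun_prop) fun _ hc => hc

/-- The `p`-th power of the Hardy quasinorm. -/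
def hSup (n : ℕ) (p : ℝ) (f : En n → ℂ) : ℝ≥0∞ :=
  ⨆ r ∈ Set.Ioo (0 : ℝ) 1, ∫⁻ ζ, ‖f (r • ζ)‖ₑ ^ p ∂(sigmaS n)

lemma hNorm_eq (n : ℕ) (p : ℝ) (f : En n → ℂ) : hNorm n p f = hSup n p f ^ (1 / p) := rfl

lemma hNorm_rpow {n : ℕ} {p : ℝ} (hp : 0 < p) (f : En n → ℂ) : hNorm n p f ^ p = hSup n p f := by
  rw [hNorm_eq, ← ENNReal.rpow_mul, one_div_mul_cancel hp.ne', ENNReal.rpow_one]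

lemma LineHol.lineSubharmonic {n : ℕ} {F : En n → ℂ} (hF : LineHol F) {p : ℝ} (hp : 0 < p) :
    LineSubharmonic ((Bn n).indicator fun z => ‖F z‖ₑ ^ p) := by
  intro a v h
  have hd : DiffContOnCl ℂ (fun c : ℂ => F (a + c • v)) (ball 0 1) := by
    refine ((hF a v).mono ?_).diffContOnCl
    intro c hc
    rw [closure_ball _ one_ne_zero, mem_closedBall_zero_iff] at hc
    exact h c hc
  have h0 := enorm_rpow_le_lintegral_poissonKernel hd hp (a := 0) (by simp)
  have ha : a ∈ Bn n := by simpa using h 0 (by simp)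
  rw [indicator_of_mem ha]
  simp only [zero_smul, add_zero] at h0
  refine h0.trans_eq (lintegral_congr fun θ => ?_)
  rw [indicator_of_mem (h _ (by simp))]
  simp [poissonKernel]

theorem LineHol.enorm_rpow_le_hSup {n : ℕ} (hn : 1 ≤ n) {F : En n → ℂ} (hF : LineHol F)
    (hm : Measurable ((Bn n).indicator F)) {p : ℝ} (hp : 0 < p) {a : En n} (ha : ‖a‖ < 1) :
    ‖F a‖ₑ ^ p ≤ ENNReal.ofReal (10 * n * 4 ^ n * (1 - ‖a‖) ^ (-n : ℝ)) * hSup n p F := by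
  have hm' : Measurable ((Bn n).indicator fun z => ‖F z‖ₑ ^ p) := by
    have : ((Bn n).indicator fun z => ‖F z‖ₑ ^ p) = fun z => ‖(Bn n).indicator F z‖ₑ ^ p := by
      ext z
      by_cases hz : z ∈ Bn n <;> simp [hz, hp]
    rw [this]
    exact hm.enorm.pow_const p
  have h := (hF.lineSubharmonic hp).le_hardy hn hm' (H := hSup n p F) (fun r hr => ?_) ha
  · rwa [indicator_of_mem (by simpa [Bn] using ha)] at h
  · refine le_trans (lintegral_mono fun ζ => indicator_le_self _ _ _)
      (le_iSup₂_of_le r hr le_rfl)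

lemma ContinuousOn.measurable_indicator_ball {n : ℕ} {f : En n → ℂ} (hf : ContinuousOn f (Bn n)) :
    Measurable ((Bn n).indicator f) := by
  classical
  rw [← piecewise_eq_indicator]
  exact hf.measurable_piecewise continuousOn_const isOpen_ball.measurableSet

/-- A sequence with dense range in `[0, 1)`. -/
def radialSeq (i : ℕ) : ℝ := Int.fract (TopologicalSpace.denseSeq ℝ i)

lemma radialSeq_nonneg (i : ℕ) : 0 ≤ radialSeq i := Int.fract_nonneg _
lemma radialSeq_lt_one (i : ℕ) : radialSeq i < 1 := Int.fract_lt_one _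

/-- The radial maximal function of `‖f‖ ^ p`. -/
def radialMax {n : ℕ} (p : ℝ) (f : En n → ℂ) (ζ : En n) : ℝ≥0∞ :=
  ⨆ i, ‖f (radialSeq i • ζ)‖ₑ ^ p

lemma enorm_rpow_le_radialMax {n : ℕ} {p : ℝ} {f : En n → ℂ}
    (hf : ContinuousOn f (Bn n)) {ζ : En n} (hζ : ‖ζ‖ = 1) {t : ℝ} (ht : t ∈ Ioo (0 : ℝ) 1) :
    ‖f (t • ζ)‖ₑ ^ p ≤ radialMax p f ζ := by
  have hc : ContinuousAt (fun s : ℝ => ‖f (s • ζ)‖ₑ ^ p) t := by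
    have hmem : t • ζ ∈ Bn n := by
      rw [Bn, mem_ball_zero_iff, norm_smul, hζ, mul_one, Real.norm_of_nonneg ht.1.le]; exact ht.2
    have h1 : ContinuousAt f (t • ζ) := hf.continuousAt (isOpen_ball.mem_nhds hmem)
    have h2 : ContinuousAt (fun s : ℝ => f (s • ζ)) t :=
      ContinuousAt.comp (f := fun s : ℝ => s • ζ) h1 (by fun_prop)
    exact (ENNReal.continuous_rpow_const.continuousAt).comp (f := fun s : ℝ => ‖f (s • ζ)‖ₑ) h2.enorm
  refine le_of_forall_lt fun b hb => ?_
  have h1 := (hc.eventually (lt_mem_nhds hb)).and (Ioo_mem_nhds ht.1 ht.2)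
  obtain ⟨i, hi⟩ := (TopologicalSpace.denseRange_denseSeq ℝ).exists_mem_open isOpen_interior
    (⟨t, mem_interior_iff_mem_nhds.2 h1⟩ :
      (interior {s : ℝ | b < ‖f (s • ζ)‖ₑ ^ p ∧ s ∈ Ioo (0 : ℝ) 1}).Nonempty)
  have hi' := interior_subset hi
  have : radialSeq i = TopologicalSpace.denseSeq ℝ i :=
    Int.fract_eq_self.2 ⟨hi'.2.1.le, hi'.2.2⟩
  refine hi'.1.trans_le ?_
  rw [← this]
  exact le_iSup (fun i => ‖f (radialSeq i • ζ)‖ₑ ^ p) i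

theorem lintegral_radialMax_le {n : ℕ} (hn : 1 ≤ n) {p : ℝ} (hp : 0 < p) {f : En n → ℂ}
    (hf : DifferentiableOn ℂ f (Bn n)) :
    ∫⁻ ζ, radialMax p f ζ ∂(sigmaS n) ≤ 256 * hSup n p f := by
  set F := (Bn n).indicator f with hF
  have hFm : Measurable F := hf.continuousOn.measurable_indicator_ball
  have hmem : ∀ {ζ : En n} {s : ℝ}, ‖ζ‖ = 1 → 0 ≤ s → s < 1 → s • ζ ∈ Bn n := by
    intro ζ s h h0 h1
    rw [Bn, mem_ball_zero_iff, norm_smul, h, mul_one, Real.norm_of_nonneg h0]; exact h1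
  have hFi : ∀ (R : ℝ) (i : ℕ), Measurable fun ζ : En n => ‖F ((R * radialSeq i) • ζ)‖ₑ ^ p :=
    fun R i => ((hFm.comp (measurable_const_smul _)).enorm).pow_const p
  have hR : ∀ R ∈ Ioo (0 : ℝ) 1,
      ∫⁻ ζ, ⨆ i, ‖F ((R * radialSeq i) • ζ)‖ₑ ^ p ∂(sigmaS n) ≤ 256 * hSup n p f := by
    intro R hR
    have hFR : Measurable fun ζ : En n => ‖F (R • ζ)‖ₑ ^ p :=
      ((hFm.comp (measurable_const_smul _)).enorm).pow_const p
    calc ∫⁻ ζ, ⨆ i, ‖F ((R * radialSeq i) • ζ)‖ₑ ^ p ∂(sigmaS n)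
        = ∫⁻ ζ, ∫⁻ θ, ⨆ i, ‖F ((R * radialSeq i) • (circleMap 0 1 θ • ζ))‖ₑ ^ p
            ∂angleMeasure ∂(sigmaS n) :=
          lintegral_sigmaS_eq_lintegral_slices hn (Measurable.iSup (hFi R))
      _ ≤ ∫⁻ ζ, 256 * ∫⁻ θ, ‖F (R • (circleMap 0 1 θ • ζ))‖ₑ ^ p ∂angleMeasure ∂(sigmaS n) := by
          refine lintegral_mono_ae ?_
          filter_upwards [ae_norm_eq_one_sigmaS n] with ζ hζ
          have hd : DiffContOnCl ℂ (fun c : ℂ => f ((0 : En n) + c • (R • ζ))) (ball 0 1) := by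
            refine ((hf.lineHol 0 (R • ζ)).mono ?_).diffContOnCl
            intro c hc
            rw [closure_ball _ one_ne_zero, mem_closedBall_zero_iff] at hc
            rw [mem_ofPred_eq, zero_add, Bn, mem_ball_zero_iff, norm_smul, norm_smul, hζ, mul_one,
              Real.norm_of_nonneg hR.1.le]
            nlinarith [hR.1, hR.2, norm_nonneg c]
          have h := lintegral_iSup_enorm_rpow_le hd hp (ρ := radialSeq) radialSeq_nonneg
            radialSeq_lt_one
          have hcirc : ∀ θ : ℝ, ‖circleMap 0 1 θ • ζ‖ = 1 := by
            intro θ; rw [norm_smul, hζ]; simp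
          refine le_trans (le_of_eq ?_) (h.trans_eq ?_)
          · refine lintegral_congr fun θ => iSup_congr fun i => ?_
            rw [hF, indicator_of_mem (hmem (hcirc θ)
              (mul_nonneg hR.1.le (radialSeq_nonneg i))
              (by nlinarith [hR.1, hR.2, radialSeq_nonneg i, radialSeq_lt_one i]))]
            congr 3
            rw [zero_add, smul_comm _ R ζ, ← smul_smul]
            congr 1
            rw [← Complex.coe_smul, smul_smul, circleMap, circleMap]
            simp
          · congr 1
            refine lintegral_congr fun θ => ?_
            rw [hF, indicator_of_mem (hmem (hcirc θ) hR.1.le hR.2), zero_add, smul_comm]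
      _ = 256 * ∫⁻ ζ, ‖F (R • ζ)‖ₑ ^ p ∂(sigmaS n) := by
          rw [lintegral_const_mul, ← lintegral_sigmaS_eq_lintegral_slices hn hFR]
          refine Measurable.lintegral_prod_right'
            (f := fun q : En n × ℝ => ‖F (R • (circleMap 0 1 q.2 • q.1))‖ₑ ^ p) ?_
          exact hFR.comp (((continuous_circleMap 0 1).measurable.comp measurable_snd).smul
            measurable_fst)
      _ ≤ 256 * hSup n p f := by
          gcongr
          refine le_trans (lintegral_mono fun ζ => ?_) (le_iSup₂_of_le R hR le_rfl)
          dsimp only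
          gcongr
          rw [hF]
          exact enorm_indicator_le_enorm_self _ _
  let Rk : ℕ → ℝ := fun k => 1 - 1 / ((k : ℝ) + 2)
  have hRk : ∀ k, Rk k ∈ Ioo (0 : ℝ) 1 := by
    intro k
    have h2 : (0 : ℝ) < k + 2 := by positivity
    have h3 : 1 / ((k : ℝ) + 2) < 1 := by rw [div_lt_one h2]; linarith [k.cast_nonneg (α := ℝ)]
    have h4 : 0 < 1 / ((k : ℝ) + 2) := by positivity
    exact ⟨by simp only [Rk]; linarith, by simp only [Rk]; linarith⟩
  have hRt : Tendsto Rk atTop (𝓝 1) := by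
    have := (tendsto_one_div_add_atTop_nhds_zero_nat (𝕜 := ℝ)).comp (tendsto_add_atTop_nat 1)
    have h2 := this.const_sub 1
    rw [sub_zero] at h2
    refine h2.congr fun k => ?_
    simp only [Rk, Function.comp]; push_cast; ring
  calc ∫⁻ ζ, radialMax p f ζ ∂(sigmaS n)
      ≤ ∫⁻ ζ, liminf (fun k => ⨆ i, ‖F ((Rk k * radialSeq i) • ζ)‖ₑ ^ p) atTop ∂(sigmaS n) := by
        refine lintegral_mono_ae ?_
        filter_upwards [ae_norm_eq_one_sigmaS n] with ζ hζ
        refine iSup_le fun i => ?_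
        have hm := hmem hζ (radialSeq_nonneg i) (radialSeq_lt_one i)
        have hFc : ContinuousAt F (radialSeq i • ζ) := by
          refine (hf.continuousOn.continuousAt (isOpen_ball.mem_nhds hm)).congr ?_
          filter_upwards [isOpen_ball.mem_nhds hm] with z hz
          rw [hF, indicator_of_mem (show z ∈ Bn n from hz)]
        have ht : Tendsto (fun k => (Rk k * radialSeq i) • ζ) atTop (𝓝 (radialSeq i • ζ)) := by
          have := (hRt.mul_const (radialSeq i)).smul_const ζ
          rwa [one_mul] at this
        have ht2 : Tendsto (fun k => ‖F ((Rk k * radialSeq i) • ζ)‖ₑ ^ p) atTop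
            (𝓝 (‖F (radialSeq i • ζ)‖ₑ ^ p)) :=
          (ENNReal.continuous_rpow_const.tendsto _).comp ((hFc.tendsto.comp ht).enorm)
        rw [show f (radialSeq i • ζ) = F (radialSeq i • ζ) by rw [hF, indicator_of_mem hm],
          ← ht2.liminf_eq]
        exact liminf_le_liminf (Eventually.of_forall fun k =>
          le_iSup (fun i => ‖F ((Rk k * radialSeq i) • ζ)‖ₑ ^ p) i)
    _ ≤ liminf (fun k => ∫⁻ ζ, ⨆ i, ‖F ((Rk k * radialSeq i) • ζ)‖ₑ ^ p ∂(sigmaS n)) atTop :=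
        lintegral_liminf_le fun k => Measurable.iSup (hFi _)
    _ ≤ 256 * hSup n p f :=
        liminf_le_of_le (by isBoundedDefault) fun b hb => by
          obtain ⟨k, hk⟩ := hb.exists
          exact hk.trans (hR _ (hRk k))

lemma lebE_cap_le {n : ℕ} (i : Fin n) {δ : ℝ} (hδ : 0 < δ) :
    lebE n {z | ‖z‖ < 1 ∧ ‖1 - z i‖ < δ} ≤
      ENNReal.ofReal ((2 * δ) ^ (n + 1)) * lebE n (closedBall 0 n) := by
  set A : Set (En n) := {z | ‖z‖ < 1 ∧ ‖1 - z i‖ < δ}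
  have hA : MeasurableSet A :=
    ((isOpen_lt continuous_norm continuous_const).inter
      (isOpen_lt (by fun_prop : Continuous fun z : En n => ‖1 - z i‖) continuous_const)).measurableSet
  set l : Fin n → ℝ := fun k => if k = i then (8 * δ) / 4 else √(8 * δ) / 2 with hl
  have hlpos : ∀ k, 0 < l k := by intro k; simp only [hl]; split_ifs <;> positivity
  have hprod : ∏ k, l k ^ 2 = (2 * δ) ^ (n + 1) := by
    rw [hl, prod_diag_weights i (by positivity)]; congr 1; ring
  have h := lintegral_add_diagE hlpos (EuclideanSpace.single i (1 : ℂ))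
    (G := A.indicator 1) (measurable_one.indicator hA)
  rw [lintegral_indicator_one hA, hprod] at h
  have hpos : (0 : ℝ) < (2 * δ) ^ (n + 1) := by positivity
  have h2 : lebE n A = ENNReal.ofReal ((2 * δ) ^ (n + 1)) *
      ∫⁻ w, A.indicator 1 (EuclideanSpace.single i (1 : ℂ) + diagE l w) ∂(lebE n) := by
    rw [h, ← mul_assoc, ← ENNReal.ofReal_mul hpos.le, mul_inv_cancel₀ hpos.ne', ENNReal.ofReal_one,
      one_mul]
  rw [h2]
  gcongr
  rw [← lintegral_indicator_one isClosed_closedBall.measurableSet]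
  refine lintegral_mono fun w => ?_
  by_cases hw : EuclideanSpace.single i (1 : ℂ) + diagE l w ∈ A
  swap
  · rw [indicator_of_notMem hw]; exact zero_le
  have hwm : w ∈ closedBall (0 : En n) n := by
    rw [mem_closedBall_zero_iff]
    have hk : ∀ k, ‖w k‖ ^ 2 ≤ 1 := by
      intro k
      obtain ⟨hz, hzi⟩ := hw
      set z := EuclideanSpace.single i (1 : ℂ) + diagE l w with hzdef
      have hl1 : ‖(l k : ℂ)‖ = l k := by
        rw [Complex.norm_real, Real.norm_of_nonneg (hlpos k).le]
      by_cases hki : k = i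
      · subst hki
        have e : 1 - z k = -(l k * w k) := by simp [hzdef, diagE_apply]
        rw [e, norm_neg, norm_mul, hl1] at hzi
        have : l k = 2 * δ := by simp [hl]; ring
        rw [this] at hzi
        have : ‖w k‖ < 1 := by nlinarith [norm_nonneg (w k)]
        nlinarith [norm_nonneg (w k)]
      · have e : z k = l k * w k := by simp [hzdef, diagE_apply, hki]
        have h3 : ‖z k‖ ^ 2 + ‖z i‖ ^ 2 ≤ ‖z‖ ^ 2 := by
          rw [EuclideanSpace.norm_sq_eq, ← Finset.add_sum_erase _ _ (Finset.mem_univ i), add_comm]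
          gcongr
          exact Finset.single_le_sum (f := fun k => ‖z k‖ ^ 2) (fun _ _ => by positivity)
            (Finset.mem_erase.2 ⟨hki, Finset.mem_univ k⟩)
        have h4 : 1 - ‖z i‖ ≤ ‖1 - z i‖ := by
          have := norm_sub_norm_le (1 : ℂ) (z i); simpa using this
        have h5 : ‖z k‖ ^ 2 ≤ 2 * δ := by
          have : ‖z‖ ^ 2 < 1 := by nlinarith [norm_nonneg z]
          nlinarith [norm_nonneg (z i), sq_nonneg (1 - ‖z i‖)]
        have h6 : l k ^ 2 = 2 * δ := by
          simp only [hl, if_neg hki]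
          rw [div_pow, Real.sq_sqrt (by positivity)]; ring
        rw [e, norm_mul, hl1, mul_pow, h6] at h5
        nlinarith
    have h7 : ‖w‖ ^ 2 ≤ n := by
      rw [EuclideanSpace.norm_sq_eq]
      refine (Finset.sum_le_sum fun k _ => hk k).trans (by simp)
    have hn : (1 : ℝ) ≤ n := by exact_mod_cast i.pos
    nlinarith [norm_nonneg w]
  rw [indicator_of_mem hw, indicator_of_mem hwm, Pi.one_apply, Pi.one_apply]

lemma inv_max_pow_le_tsum {d t : ℝ} (hd : 0 < d) (m : ℕ) :
    ENNReal.ofReal ((max d (t / 2)) ^ m)⁻¹ ≤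
      ∑' j : ℕ, if t < 4 * (2 ^ j * d) then ENNReal.ofReal ((2 ^ j * d) ^ m)⁻¹ else 0 := by
  obtain ⟨j, hj1, hj2⟩ := exists_nat_pow_near (x := max d (t / 2) / d) (y := 2)
    (by rw [one_le_div hd]; exact le_max_left _ _) one_lt_two
  rw [le_div_iff₀ hd] at hj1
  rw [div_lt_iff₀ hd] at hj2
  have ht : t < 4 * (2 ^ j * d) := by
    have := (le_max_right d (t / 2)).trans_lt hj2
    rw [pow_succ] at this
    linarith
  refine le_trans ?_ (ENNReal.le_tsum j)
  rw [if_pos ht]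
  refine ENNReal.ofReal_le_ofReal ?_
  gcongr

lemma setLIntegral_ball_inv_max_le {n : ℕ} (i : Fin n) {d : ℝ} (hd : 0 < d) :
    ∫⁻ z in ball (0 : En n) 1, ENNReal.ofReal ((max d (‖1 - z i‖ / 2)) ^ (n + 2))⁻¹ ∂(lebE n) ≤
      ENNReal.ofReal (2 * 8 ^ (n + 1) / d) * lebE n (closedBall 0 n) := by
  have hAm : ∀ j : ℕ, MeasurableSet {z : En n | ‖1 - z i‖ < 4 * (2 ^ j * d)} := fun j =>
    (isOpen_lt (by fun_prop : Continuous fun z : En n => ‖1 - z i‖) continuous_const).measurableSet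
  calc _ ≤ ∫⁻ z in ball (0 : En n) 1, ∑' j : ℕ, {z : En n | ‖1 - z i‖ < 4 * (2 ^ j * d)}.indicator
          (fun _ => ENNReal.ofReal ((2 ^ j * d) ^ (n + 2))⁻¹) z ∂(lebE n) := by
        refine lintegral_mono fun z => (inv_max_pow_le_tsum hd _).trans_eq ?_
        refine tsum_congr fun j => ?_
        rw [indicator_apply]; rfl
    _ = ∑' j : ℕ, ENNReal.ofReal ((2 ^ j * d) ^ (n + 2))⁻¹ *
          lebE n ({z : En n | ‖1 - z i‖ < 4 * (2 ^ j * d)} ∩ ball 0 1) := by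
        rw [lintegral_tsum fun j => (measurable_const.indicator (hAm j)).aemeasurable]
        refine tsum_congr fun j => ?_
        rw [lintegral_indicator_const (hAm j), Measure.restrict_apply (hAm j)]
    _ ≤ ∑' j : ℕ, ENNReal.ofReal (8 ^ (n + 1) / d * (1 / 2) ^ j) * lebE n (closedBall 0 n) := by
        refine ENNReal.tsum_le_tsum fun j => ?_
        have h1 : {z : En n | ‖1 - z i‖ < 4 * (2 ^ j * d)} ∩ ball 0 1 =
            {z | ‖z‖ < 1 ∧ ‖1 - z i‖ < 4 * (2 ^ j * d)} := by
          ext z; simp [and_comm]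
        rw [h1]
        refine (mul_le_mul_right (lebE_cap_le i (by positivity)) _).trans_eq ?_
        rw [← mul_assoc, ← ENNReal.ofReal_mul (by positivity)]
        congr 2
        rw [show 2 * (4 * (2 ^ j * d)) = 8 * (2 ^ j * d) by ring, mul_pow 8, one_div, inv_pow,
          pow_succ (2 ^ j * d) (n + 1)]
        field_simp
    _ = _ := by
        rw [ENNReal.tsum_mul_right, ← ENNReal.ofReal_tsum_of_nonneg (fun j => by positivity)
          (summable_geometric_two.mul_left _), tsum_mul_left, tsum_geometric_two]
        congr 2; ring

lemma le_lebE_shell {n : ℕ} (hn : 1 ≤ n) {ρ : ℝ} (h0 : 0 ≤ ρ) (h1 : ρ < 1) :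
    ENNReal.ofReal (1 - ρ) * lebE n (ball 0 1) ≤ lebE n (norm ⁻¹' Ico ρ 1) := by
  have := nontrivial_En hn
  have hsub : (norm : En n → ℝ) ⁻¹' Ico ρ 1 = ball 0 1 \ ball 0 ρ := by
    ext z; simp [and_comm]
  have hpow : ρ ^ (2 * n) ≤ ρ := pow_le_of_le_one h0 h1.le (by omega)
  rw [hsub, measure_sdiff (ball_subset_ball h1.le) measurableSet_ball.nullMeasurableSet
      measure_ball_lt_top.ne, Measure.addHaar_ball (lebE n) 0 h0, finrank_real_En]
  refine ENNReal.le_sub_of_add_le_right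
    (ENNReal.mul_ne_top ENNReal.ofReal_ne_top (lebE_ball_ne_top n)) ?_
  rw [← add_mul, ← ENNReal.ofReal_add (by linarith) (by positivity)]
  refine mul_le_of_le_one_left zero_le ?_
  rw [← ENNReal.ofReal_one]
  exact ENNReal.ofReal_le_ofReal (by linarith)

/-- Constant in the estimate of the kernel integral over the sphere. -/
def kernelConst (n : ℕ) : ℝ≥0∞ :=
  ENNReal.ofReal (2 * 8 ^ (n + 1)) * lebE n (closedBall 0 n) * (lebE n (ball 0 1))⁻¹

lemma kernelConst_ne_top (n : ℕ) : kernelConst n ≠ ⊤ :=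
  ENNReal.mul_ne_top (ENNReal.mul_ne_top ENNReal.ofReal_ne_top
    (isCompact_closedBall _ _).measure_lt_top.ne) (ENNReal.inv_ne_top.2 (lebE_ball_pos n).ne')

lemma lintegral_sphere_kernel_axis_le {n : ℕ} (i : Fin n) {ρ : ℝ} (h0 : 0 ≤ ρ) (h1 : ρ < 1) :
    ∫⁻ ζ : En n, ENNReal.ofReal (‖1 - (ρ : ℂ) * ζ i‖ ^ (n + 2))⁻¹ ∂(sigmaS n) ≤
      kernelConst n * ENNReal.ofReal ((1 - ρ) ^ 2)⁻¹ := by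
  have hn : 1 ≤ n := i.pos
  set d := 1 - ρ with hdd
  have hd : 0 < d := by linarith
  set I := ∫⁻ ζ : En n, ENNReal.ofReal (‖1 - (ρ : ℂ) * ζ i‖ ^ (n + 2))⁻¹ ∂(sigmaS n) with hI
  set G : En n → ℝ≥0∞ := fun z => ENNReal.ofReal ((max d (‖1 - z i‖ / 2)) ^ (n + 2))⁻¹
  have hG : Measurable G := by
    have : Continuous fun z : En n => (max d (‖1 - z i‖ / 2)) ^ (n + 2) := by fun_prop
    exact (this.measurable.inv).ennreal_ofReal
  have hIr : ∀ r ∈ Ico ρ 1, I ≤ ∫⁻ ζ, G (r • ζ) ∂(sigmaS n) := by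
    intro r hr
    refine lintegral_mono_ae ?_
    filter_upwards [ae_norm_eq_one_sigmaS n] with ζ hζ
    refine ENNReal.ofReal_le_ofReal ?_
    have hζi : ‖ζ i‖ ≤ 1 := hζ ▸ PiLp.norm_apply_le ζ i
    have hρ : d ≤ ‖1 - (ρ : ℂ) * ζ i‖ := by
      have h2 := norm_sub_norm_le (1 : ℂ) ((ρ : ℂ) * ζ i)
      rw [norm_mul, Complex.norm_real, Real.norm_of_nonneg h0, norm_one] at h2
      nlinarith
    have h3 : ‖1 - (r • ζ) i‖ ≤ ‖1 - (ρ : ℂ) * ζ i‖ + (r - ρ) := by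
      have e : 1 - (r • ζ) i = (1 - (ρ : ℂ) * ζ i) + -(((r - ρ : ℝ) : ℂ) * ζ i) := by
        simp; ring
      rw [e]
      refine (norm_add_le _ _).trans ?_
      rw [norm_neg, norm_mul, Complex.norm_real, Real.norm_of_nonneg (by linarith [hr.1])]
      nlinarith [hr.1]
    have h4 : max d (‖1 - (r • ζ) i‖ / 2) ≤ ‖1 - (ρ : ℂ) * ζ i‖ :=
      max_le hρ (by linarith [hr.2])
    gcongr
  have hTm : MeasurableSet ((norm : En n → ℝ) ⁻¹' Ico ρ 1) := measurable_norm measurableSet_Ico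
  set B := lebE n (ball 0 1)
  have key : I * (ENNReal.ofReal d * B) ≤
      ENNReal.ofReal (2 * 8 ^ (n + 1) / d) * lebE n (closedBall 0 n) := by
    calc I * (ENNReal.ofReal d * B) ≤ I * lebE n (norm ⁻¹' Ico ρ 1) := by
          gcongr; exact le_lebE_shell hn h0 h1
      _ = ∫⁻ z in (norm : En n → ℝ) ⁻¹' Ico ρ 1, I ∂(lebE n) := by simp
      _ ≤ ∫⁻ z in (norm : En n → ℝ) ⁻¹' Ico ρ 1, ∫⁻ ζ, G (‖z‖ • ζ) ∂(sigmaS n) ∂(lebE n) :=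
          setLIntegral_mono' hTm fun z hz => hIr _ hz
      _ = ∫⁻ z in (norm : En n → ℝ) ⁻¹' Ico ρ 1, G z ∂(lebE n) :=
          (setLIntegral_lebE_shell hn measurableSet_Ico (fun t ht => ht.2) hG).symm
      _ ≤ ∫⁻ z in ball (0 : En n) 1, G z ∂(lebE n) :=
          lintegral_mono_set fun z hz => by simpa using hz.2
      _ ≤ _ := setLIntegral_ball_inv_max_le i hd
  have hB0 : B ≠ 0 := (lebE_ball_pos n).ne'
  have hBt : B ≠ ⊤ := lebE_ball_ne_top n
  have hc0 : ENNReal.ofReal d * B ≠ 0 := mul_ne_zero (by simpa using hd) hB0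
  have hct : ENNReal.ofReal d * B ≠ ⊤ := ENNReal.mul_ne_top ENNReal.ofReal_ne_top hBt
  rw [← ENNReal.mul_le_mul_iff_left hc0 hct]
  refine key.trans_eq ?_
  rw [kernelConst]
  have e1 : ENNReal.ofReal (2 * 8 ^ (n + 1) / d) =
      ENNReal.ofReal (2 * 8 ^ (n + 1)) * (ENNReal.ofReal (d ^ 2)⁻¹ * ENNReal.ofReal d) := by
    rw [← ENNReal.ofReal_mul (by positivity), ← ENNReal.ofReal_mul (by positivity)]
    congr 1; field_simp
  have e2 : B⁻¹ * B = 1 := ENNReal.inv_mul_cancel hB0 hBt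
  rw [e1]
  calc _ = ENNReal.ofReal (2 * 8 ^ (n + 1)) * (ENNReal.ofReal (d ^ 2)⁻¹ * ENNReal.ofReal d) *
        lebE n (closedBall 0 n) * (B⁻¹ * B) := by rw [e2, mul_one]
    _ = _ := by ring

lemma herm_eq_inner {n : ℕ} (z w : En n) : herm z w = inner ℂ w z := by
  simp [herm, PiLp.inner_apply]

theorem lintegral_sphere_kernel_le {n : ℕ} (hn : 1 ≤ n) {w : En n} (hw : ‖w‖ < 1) :
    ∫⁻ ζ : En n, ENNReal.ofReal (‖1 - herm ζ w‖ ^ (n + 2))⁻¹ ∂(sigmaS n) ≤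
      kernelConst n * ENNReal.ofReal ((1 - ‖w‖) ^ 2)⁻¹ := by
  obtain ⟨T, hT⟩ := exists_unitary_single ⟨0, hn⟩ w
  refine le_trans (le_of_eq ?_)
    (lintegral_sphere_kernel_axis_le ⟨0, hn⟩ (norm_nonneg w) hw)
  rw [← (measurePreserving_unitary_sigmaS T).lintegral_comp]
  · refine lintegral_congr fun ζ => ?_
    congr 5
    conv_lhs => rw [← hT]
    rw [herm_eq_inner, T.inner_map_map, EuclideanSpace.inner_single_left]
    simp
  · have : Continuous fun ζ : En n => ‖1 - herm ζ w‖ ^ (n + 2) := by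
      unfold herm; fun_prop
    exact (this.measurable.inv).ennreal_ofReal

/-- The test functions `(1 - ⟨z, a⟩) ^ (-(n + 2) / p)`. -/
def testF (n : ℕ) (p : ℝ) (a z : En n) : ℂ := (1 - herm z a) ^ ((-(n + 2) / p : ℝ) : ℂ)

lemma norm_herm_le {n : ℕ} (z w : En n) : ‖herm z w‖ ≤ ‖z‖ * ‖w‖ := by
  rw [herm_eq_inner, mul_comm]; exact norm_inner_le_norm w z

lemma one_sub_herm_mem_slitPlane {n : ℕ} {z a : En n} (hz : ‖z‖ < 1) (ha : ‖a‖ < 1) :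
    1 - herm z a ∈ Complex.slitPlane := by
  refine Or.inl ?_
  have h1 := norm_herm_le z a
  have h2 := (Complex.abs_re_le_norm (herm z a)).trans h1
  have h3 := le_abs_self (herm z a).re
  rw [Complex.sub_re, Complex.one_re]
  nlinarith [norm_nonneg z, norm_nonneg a]

lemma differentiableOn_testF {n : ℕ} (p : ℝ) {a : En n} (ha : ‖a‖ < 1) :
    DifferentiableOn ℂ (testF n p a) (Bn n) := by
  intro z hz
  have h : DifferentiableAt ℂ (fun z : En n => 1 - herm z a) z := by
    unfold herm; fun_prop
  exact (h.cpow (differentiableAt_const _)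
    (one_sub_herm_mem_slitPlane (mem_ball_zero_iff.1 hz) ha)).differentiableWithinAt

lemma norm_testF {n : ℕ} (p : ℝ) {a z : En n} (hz : ‖z‖ < 1) (ha : ‖a‖ < 1) :
    ‖testF n p a z‖ = ‖1 - herm z a‖ ^ (-(n + 2) / p : ℝ) := by
  have h0 := Complex.slitPlane_ne_zero (one_sub_herm_mem_slitPlane hz ha)
  rw [testF, Complex.norm_cpow_of_ne_zero h0]
  simp

lemma herm_smul_left {n : ℕ} (r : ℝ) (z w : En n) : herm (r • z) w = herm z (r • w) := by
  simp only [herm]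
  refine Finset.sum_congr rfl fun k _ => ?_
  simp; ring

theorem hSup_testF_le {n : ℕ} (hn : 1 ≤ n) {p : ℝ} (hp : 0 < p) {a : En n} (ha : ‖a‖ < 1) :
    hSup n p (testF n p a) ≤ kernelConst n * ENNReal.ofReal ((1 - ‖a‖) ^ 2)⁻¹ := by
  refine iSup₂_le fun r hr => ?_
  have hra : ‖r • a‖ ≤ ‖a‖ := by
    rw [norm_smul, Real.norm_of_nonneg hr.1.le]
    exact mul_le_of_le_one_left (norm_nonneg a) hr.2.le
  calc _ = ∫⁻ ζ : En n, ENNReal.ofReal (‖1 - herm ζ (r • a)‖ ^ (n + 2))⁻¹ ∂(sigmaS n) := by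
        refine lintegral_congr_ae ?_
        filter_upwards [ae_norm_eq_one_sigmaS n] with ζ hζ
        have hrz : ‖r • ζ‖ < 1 := by
          rw [norm_smul, hζ, mul_one, Real.norm_of_nonneg hr.1.le]; exact hr.2
        rw [← ofReal_norm, ENNReal.ofReal_rpow_of_nonneg (norm_nonneg _) hp.le,
          norm_testF p hrz ha, ← Real.rpow_mul (norm_nonneg _), div_mul_cancel₀ _ hp.ne',
          Real.rpow_neg (norm_nonneg _), herm_smul_left]
        norm_cast
    _ ≤ kernelConst n * ENNReal.ofReal ((1 - ‖r • a‖) ^ 2)⁻¹ :=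
        lintegral_sphere_kernel_le hn (hra.trans_lt ha)
    _ ≤ _ := by
        have : 0 < 1 - ‖a‖ := by linarith
        gcongr

lemma memHp_testF {n : ℕ} (hn : 1 ≤ n) {p : ℝ} (hp : 0 < p) {a : En n} (ha : ‖a‖ < 1) :
    MemHp n p (testF n p a) := by
  refine ⟨differentiableOn_testF p ha, ?_⟩
  rw [hNorm_eq]
  refine ENNReal.rpow_lt_top_of_nonneg (by positivity) (ne_top_of_le_ne_top ?_ (hSup_testF_le hn hp ha))
  exact ENNReal.mul_ne_top (kernelConst_ne_top n) ENNReal.ofReal_ne_top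

lemma norm_testF_self {n : ℕ} (p : ℝ) {a : En n} (ha : ‖a‖ < 1) :
    ‖testF n p a a‖ = (1 - ‖a‖ ^ 2) ^ (-(n + 2) / p : ℝ) := by
  rw [norm_testF p ha ha, herm_eq_inner, inner_self_eq_norm_sq_to_K]
  congr 1
  have : (1 : ℂ) - (‖a‖ : ℂ) ^ 2 = ((1 - ‖a‖ ^ 2 : ℝ) : ℂ) := by push_cast; ring
  have h2 : 0 ≤ 1 - ‖a‖ ^ 2 := by nlinarith [norm_nonneg a]
  calc _ = ‖(1 : ℂ) - (‖a‖ : ℂ) ^ 2‖ := rfl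
    _ = _ := by rw [this, Complex.norm_real, Real.norm_of_nonneg h2]

theorem differentiableAt_integral_of_bounded {X : Type*} [MeasurableSpace X] {μ : Measure X}
    [IsFiniteMeasure μ] {Φ : ℂ → X → ℂ} {c₀ : ℂ} {r M : ℝ} (hr : 0 < r)
    (hd : ∀ᵐ x ∂μ, DifferentiableOn ℂ (Φ · x) (ball c₀ r))
    (hb : ∀ᵐ x ∂μ, ∀ c ∈ ball c₀ r, ‖Φ c x‖ ≤ M)
    (hm : ∀ c ∈ ball c₀ r, AEStronglyMeasurable (Φ c) μ) :
    DifferentiableAt ℂ (fun c => ∫ x, Φ c x ∂μ) c₀ := by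
  have hc₀ : c₀ ∈ ball c₀ r := mem_ball_self hr
  have hderiv : ∀ᵐ x ∂μ, ∀ c ∈ ball c₀ (r / 2), HasDerivAt (Φ · x) (deriv (Φ · x) c) c := by
    filter_upwards [hd] with x hx c hc
    exact ((hx.differentiableAt (isOpen_ball.mem_nhds
      (ball_subset_ball (by linarith) hc)))).hasDerivAt
  have hmeas : AEStronglyMeasurable (fun x => deriv (Φ · x) c₀) μ := by
    let s : ℕ → ℝ := fun k => r / 2 * (1 / ((k : ℝ) + 1))
    have hs0 : ∀ k, 0 < s k := fun k => by positivity
    have hs1 : ∀ k, s k < r := fun k => by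
      have : 1 / ((k : ℝ) + 1) ≤ 1 := by
        rw [div_le_one (by positivity)]; linarith [k.cast_nonneg (α := ℝ)]
      simp only [s]; nlinarith
    have hst : Tendsto s atTop (𝓝 0) := by
      have := (tendsto_one_div_add_atTop_nhds_zero_nat (𝕜 := ℝ)).const_mul (r / 2)
      rwa [mul_zero] at this
    have hst' : Tendsto (fun k => (s k : ℂ)) atTop (𝓝[≠] 0) := by
      refine tendsto_nhdsWithin_iff.2 ⟨?_, Eventually.of_forall fun k => ?_⟩
      · exact_mod_cast (Complex.continuous_ofReal.tendsto 0).comp hst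
      · simpa using (hs0 k).ne'
    refine aestronglyMeasurable_of_tendsto_ae atTop
      (f := fun k x => (s k : ℂ)⁻¹ • (Φ (c₀ + s k) x - Φ c₀ x)) (fun k => ?_) ?_
    · refine AEStronglyMeasurable.const_smul (AEStronglyMeasurable.sub (hm _ ?_) (hm _ hc₀)) (s k : ℂ)⁻¹
      rw [mem_ball, dist_self_add_left, Complex.norm_real, Real.norm_of_nonneg (hs0 k).le]
      exact hs1 k
    · filter_upwards [hderiv] with x hx
      exact (hx c₀ (mem_ball_self (by positivity))).tendsto_slope_zero.comp hst'
  refine (hasDerivAt_integral_of_dominated_loc_of_deriv_le (F' := fun c x => deriv (Φ · x) c)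
    (bound := fun _ => M / (r / 2)) (ball_mem_nhds c₀ (half_pos hr)) ?_ ?_ hmeas ?_
    (integrable_const _) hderiv).2.differentiableAt
  · filter_upwards [ball_mem_nhds c₀ hr] with c hc using hm c hc
  · exact Integrable.of_bound (hm _ hc₀) M (hb.mono fun x hx => hx _ hc₀)
  · filter_upwards [hd, hb] with x hx hbx c hc
    have hsub : closedBall c (r / 2) ⊆ ball c₀ r :=
      fun y hy => by
        rw [mem_ball] at *; rw [mem_closedBall] at hy
        linarith [dist_triangle y c c₀]
    refine Complex.norm_deriv_le_of_forall_mem_sphere_norm_le (half_pos hr) ?_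
      fun z hz => hbx z (hsub (sphere_subset_closedBall hz))
    refine (hx.mono ?_).diffContOnCl
    rwa [closure_ball _ (half_pos hr).ne']

lemma fderiv_apply_eq_deriv {n : ℕ} {g : En n → ℂ} (hg : DifferentiableOn ℂ g (Bn n)) {y : En n}
    (hy : y ∈ Bn n) (v : En n) :
    HasDerivAt (fun c : ℂ => g (y + c • v)) (fderiv ℂ g y v) 0 := by
  have h1 : HasFDerivAt g (fderiv ℂ g y) (y + (0 : ℂ) • v) := by
    rw [zero_smul, add_zero]
    exact (hg.differentiableAt (isOpen_ball.mem_nhds hy)).hasFDerivAt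
  have h2 : HasDerivAt (fun c : ℂ => y + c • v) v 0 := by
    simpa using ((hasDerivAt_id (0 : ℂ)).smul_const v).const_add y
  exact h1.comp_hasDerivAt (0 : ℂ) h2

lemma radD_lineHol {n : ℕ} {g : En n → ℂ} (hg : DifferentiableOn ℂ g (Bn n)) :
    LineHol (radD g) := by
  intro z w c₀ hc₀
  refine DifferentiableAt.differentiableWithinAt ?_
  set y₀ := z + c₀ • w with hy₀
  have hy₀m : y₀ ∈ Bn n := hc₀
  have hgc : ContinuousAt g y₀ := hg.continuousOn.continuousAt (isOpen_ball.mem_nhds hy₀m)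
  set M := ‖g y₀‖ + 1
  have hev : ∀ᶠ y in 𝓝 y₀, y ∈ Bn n ∧ ‖g y‖ ≤ M := by
    filter_upwards [isOpen_ball.mem_nhds hy₀m, hgc.norm.eventually (gt_mem_nhds (lt_add_one ‖g y₀‖))] with y hy1 hy
    exact ⟨hy1, hy.le⟩
  let Y : ℂ × ℂ → En n := fun q => (z + q.1 • w) + q.2 • (z + q.1 • w)
  have hYc : Continuous Y := by fun_prop
  have hY0 : Y (c₀, 0) = y₀ := by simp [Y, hy₀]
  have hev2 : ∀ᶠ q in 𝓝 (c₀, (0 : ℂ)), Y q ∈ Bn n ∧ ‖g (Y q)‖ ≤ M := by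
    have := hYc.tendsto (c₀, 0)
    rw [hY0] at this
    exact this.eventually hev
  obtain ⟨r, hr, hball⟩ := Metric.eventually_nhds_iff_ball.1 hev2
  have hmemq : ∀ c ∈ ball c₀ r, ∀ m : ℂ, ‖m‖ < r → (c, m) ∈ ball (c₀, (0 : ℂ)) r := by
    intro c hc m hm
    rw [← ball_prod_same]
    exact ⟨hc, by simpa using hm⟩
  have hr2 : 0 < r / 2 := half_pos hr
  have hcirc : ∀ θ, ‖circleMap 0 (r / 2) θ‖ < r := fun θ => by
    rw [norm_circleMap_zero, abs_of_pos hr2]; linarith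
  have heq : (fun c => radD g (z + c • w)) =ᶠ[𝓝 c₀] fun c =>
      (2 * (Real.pi : ℂ) * Complex.I)⁻¹ • ∫ θ in Ioc 0 (2 * Real.pi),
        deriv (circleMap 0 (r / 2)) θ • ((circleMap 0 (r / 2) θ - 0) ^ 2)⁻¹ •
          g (Y (c, circleMap 0 (r / 2) θ)) := by
    filter_upwards [ball_mem_nhds c₀ hr] with c hc
    have hd : DifferentiableOn ℂ (fun m : ℂ => g (Y (c, m))) (ball 0 r) := by
      refine hg.comp (f := fun m : ℂ => Y (c, m)) (fun m _ => ?_) fun m hm =>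
        (hball _ (hmemq c hc m (by simpa using hm))).1
      simp only [Y]
      fun_prop
    have hyc : z + c • w ∈ Bn n := by
      have := (hball _ (hmemq c hc 0 (by simpa using hr))).1
      simpa [Y] using this
    have h1 := (fderiv_apply_eq_deriv hg hyc (z + c • w)).deriv
    have h2 := Complex.cderiv_eq_deriv isOpen_ball hd hr2
      (closedBall_subset_ball (by linarith : r / 2 < r))
    rw [radD, ← h1]
    refine h2.symm.trans ?_
    rw [Complex.cderiv, circleIntegral, intervalIntegral.integral_of_le (by positivity)]
  refine DifferentiableAt.congr_of_eventuallyEq ?_ heq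
  refine DifferentiableAt.fun_const_smul ?_ _
  refine differentiableAt_integral_of_bounded (r := r)
    (M := r / 2 * (((r / 2) ^ 2)⁻¹ * M)) hr ?_ ?_ ?_
  · refine Eventually.of_forall fun θ => ?_
    refine (DifferentiableOn.fun_const_smul ?_ _).fun_const_smul _
    refine hg.comp (f := fun c : ℂ => Y (c, circleMap 0 (r / 2) θ)) (fun m _ => ?_) fun c hc =>
        (hball _ (hmemq c hc _ (hcirc θ))).1
    simp only [Y]
    fun_prop
  · refine Eventually.of_forall fun θ c hc => ?_
    have h := (hball _ (hmemq c hc _ (hcirc θ))).2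
    rw [norm_smul, norm_smul, sub_zero, deriv_circleMap, norm_inv, norm_pow, norm_mul]
    simp only [norm_circleMap_zero, Complex.norm_I, mul_one, abs_of_pos hr2]
    gcongr
  · intro c hc
    refine Continuous.aestronglyMeasurable ?_
    have hgY : Continuous fun θ => g (Y (c, circleMap 0 (r / 2) θ)) := by
      refine hg.continuousOn.comp_continuous (by fun_prop) fun θ =>
        (hball _ (hmemq c hc _ (hcirc θ))).1
    have hne : ∀ θ, (circleMap 0 (r / 2) θ - 0) ^ 2 ≠ 0 := fun θ => by
      rw [sub_zero]; exact pow_ne_zero _ (circleMap_ne_center hr2.ne')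
    have hcm : Continuous fun θ => ((circleMap 0 (r / 2) θ - 0) ^ 2)⁻¹ :=
      Continuous.inv₀ (by fun_prop) hne
    simp only [deriv_circleMap]
    exact ((continuous_circleMap 0 (r / 2)).mul continuous_const).smul (hcm.smul hgY)

lemma measurable_radD {n : ℕ} (g : En n → ℂ) : Measurable (radD g) := by
  have h : radD g = fun z => ∑ k, z k * fderiv ℂ g z (EuclideanSpace.single k 1) := by
    ext z
    have hz : z = ∑ k, z k • EuclideanSpace.single k (1 : ℂ) := by
      ext j; simp [Pi.single_apply]
    rw [radD]
    conv_lhs => rw [hz]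
    rw [map_sum]
    refine Finset.sum_congr rfl fun k _ => ?_
    rw [map_smul, smul_eq_mul, ← hz]
  rw [h]
  refine Finset.measurable_sum _ fun k _ => ?_
  exact ((by fun_prop : Continuous fun z : En n => z k).measurable).mul
    (measurable_fderiv_apply_const ℂ g _)

lemma smul_mem_Bn {n : ℕ} {z : En n} (hz : z ∈ Bn n) {t : ℝ} (ht : t ∈ Ioo (0 : ℝ) 1) :
    t • z ∈ Bn n := by
  rw [Bn, mem_ball_zero_iff] at *
  rw [norm_smul, Real.norm_of_nonneg ht.1.le]
  nlinarith [ht.1, ht.2, norm_nonneg z]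

lemma measurable_indicator_J {n : ℕ} {f : En n → ℂ} (g : En n → ℂ)
    (hf : DifferentiableOn ℂ f (Bn n)) : Measurable ((Bn n).indicator (J g f)) := by
  have hFm := hf.continuousOn.measurable_indicator_ball
  set F := (Bn n).indicator f with hF
  have hs : Measurable fun q : En n × ℝ => q.2 • q.1 := measurable_snd.smul measurable_fst
  have hm : Measurable fun q : En n × ℝ => F (q.2 • q.1) * radD g (q.2 • q.1) / (q.2 : ℂ) :=
    ((hFm.comp hs).mul ((measurable_radD g).comp hs)).div
      (Complex.measurable_ofReal.comp measurable_snd)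
  have h1 : Measurable (J g F) :=
    (hm.stronglyMeasurable.integral_prod_right' (ν := volume.restrict (Ioo 0 1))).measurable
  have h2 : (Bn n).indicator (J g f) = (Bn n).indicator (J g F) := by
    refine indicator_congr fun z hz => ?_
    refine setIntegral_congr_fun measurableSet_Ioo fun t ht => ?_
    simp only [hF, indicator_of_mem (smul_mem_Bn hz ht)]
  rw [h2]
  exact h1.indicator isOpen_ball.measurableSet

/-- The integrand of the integration operator has a primitive along slices. -/
lemma isExactOn_slice {n : ℕ} {g f : En n → ℂ} (hg : DifferentiableOn ℂ g (Bn n))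
    (hf : DifferentiableOn ℂ f (Bn n)) {y : En n} {R : ℝ}
    (hR : ∀ c ∈ ball (0 : ℂ) R, c • y ∈ Bn n) :
    ∃ K : ℂ → ℂ, ∀ c ∈ ball (0 : ℂ) R,
      HasDerivAt K (f (c • y) * fderiv ℂ g (c • y) y) c := by
  have hgs : DifferentiableOn ℂ (fun c : ℂ => g (c • y)) (ball 0 R) :=
    hg.comp (f := fun c : ℂ => c • y) (by fun_prop) hR
  have hfs : DifferentiableOn ℂ (fun c : ℂ => f (c • y)) (ball 0 R) :=
    hf.comp (f := fun c : ℂ => c • y) (by fun_prop) hR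
  obtain ⟨K, hK⟩ := (hfs.mul (hgs.deriv isOpen_ball)).isExactOn_ball
  refine ⟨K, fun c hc => ?_⟩
  have h1 : HasDerivAt (fun c : ℂ => g (c • y)) (fderiv ℂ g (c • y) y) c := by
    have h2 : HasDerivAt (fun c : ℂ => c • y) y c := by
      simpa using (hasDerivAt_id c).smul_const y
    exact (hg.differentiableAt (isOpen_ball.mem_nhds (hR c hc))).hasFDerivAt.comp_hasDerivAt c h2
  have := hK c hc
  rwa [Pi.mul_apply, h1.deriv] at this

lemma radD_smul_div {n : ℕ} (g : En n → ℂ) (y : En n) {t : ℝ} (ht : t ≠ 0) (x : En n)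
    (hx : x = t • y) : radD g x / (t : ℂ) = fderiv ℂ g x y := by
  have h : (t : ℂ) • y = x := by rw [hx, Complex.coe_smul]
  have : fderiv ℂ g x x = (t : ℂ) * fderiv ℂ g x y := by
    calc fderiv ℂ g x x = fderiv ℂ g x ((t : ℂ) • y) := by rw [h]
      _ = _ := by rw [map_smul, smul_eq_mul]
  rw [radD, this, mul_div_cancel_left₀]
  exact_mod_cast ht

lemma J_slice_eq {n : ℕ} {g f : En n → ℂ} {y : En n} {R : ℝ} {K : ℂ → ℂ}
    (hK : ∀ c ∈ ball (0 : ℂ) R, HasDerivAt K (f (c • y) * fderiv ℂ g (c • y) y) c)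
    {c : ℂ} (hc : c ∈ ball (0 : ℂ) R) :
    IntegrableOn (fun t : ℝ => f (t • c • y) * radD g (t • c • y) / (t : ℂ)) (Ioo 0 1) ∧
      J g f (c • y) = K c - K 0 := by
  have hmem : ∀ t ∈ Icc (0 : ℝ) 1, (t : ℂ) * c ∈ ball (0 : ℂ) R := by
    intro t ht
    rw [mem_ball_zero_iff] at *
    rw [norm_mul, Complex.norm_real, Real.norm_of_nonneg ht.1]
    nlinarith [ht.1, ht.2, norm_nonneg c]
  have hderiv : ∀ t ∈ Icc (0 : ℝ) 1, HasDerivAt (fun s : ℝ => K ((s : ℂ) * c))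
      (f (((t : ℂ) * c) • y) * fderiv ℂ g (((t : ℂ) * c) • y) y * c) t := by
    intro t ht
    have h1 : HasDerivAt (fun s : ℝ => (s : ℂ) * c) c t := by
      simpa using (Complex.ofRealCLM.hasDerivAt (x := t)).mul_const c
    exact (hK _ (hmem t ht)).comp t h1
  have hKd : DifferentiableOn ℂ K (ball 0 R) := fun z hz =>
    (hK z hz).differentiableAt.differentiableWithinAt
  have hcont : ContinuousOn (fun t : ℝ =>
      f (((t : ℂ) * c) • y) * fderiv ℂ g (((t : ℂ) * c) • y) y * c) (Icc 0 1) := by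
    have h1 : ContinuousOn (fun t : ℝ => deriv K ((t : ℂ) * c)) (Icc 0 1) :=
      (hKd.deriv isOpen_ball).continuousOn.comp (by fun_prop) hmem
    refine (h1.mul (continuousOn_const (c := c))).congr fun t ht => ?_
    change _ = deriv K ((t : ℂ) * c) * c
    rw [(hK _ (hmem t ht)).deriv]
  have hcong : EqOn (fun t : ℝ => f (t • c • y) * radD g (t • c • y) / (t : ℂ))
      (fun t : ℝ => f (((t : ℂ) * c) • y) * fderiv ℂ g (((t : ℂ) * c) • y) y * c) (Ioo 0 1) := by
    intro t ht
    have e : t • c • y = ((t : ℂ) * c) • y := by rw [← Complex.coe_smul, smul_smul]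
    simp only
    rw [mul_div_assoc, radD_smul_div g (c • y) ht.1.ne' _ rfl, map_smul, e, smul_eq_mul]
    ring
  have hint : IntervalIntegrable (fun t : ℝ =>
      f (((t : ℂ) * c) • y) * fderiv ℂ g (((t : ℂ) * c) • y) y * c) volume 0 1 := by
    refine ContinuousOn.intervalIntegrable ?_
    rwa [uIcc_of_le zero_le_one]
  constructor
  · refine IntegrableOn.congr_fun ?_ hcong.symm measurableSet_Ioo
    exact (hcont.integrableOn_Icc).mono_set Ioo_subset_Icc_self
  · rw [J, setIntegral_congr_fun measurableSet_Ioo hcong, ← integral_Ioc_eq_integral_Ioo,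
      ← intervalIntegral.integral_of_le zero_le_one,
      intervalIntegral.integral_eq_sub_of_hasDerivAt
        (fun t ht => hderiv t (by rwa [uIcc_of_le zero_le_one] at ht)) hint]
    simp

lemma exists_ball_smul_mem {n : ℕ} {y : En n} (hy : y ∈ Bn n) :
    ∃ R : ℝ, 1 < R ∧ ∀ c ∈ ball (0 : ℂ) R, c • y ∈ Bn n := by
  rw [Bn, mem_ball_zero_iff] at hy
  refine ⟨2 / (1 + ‖y‖), by rw [lt_div_iff₀ (by positivity)]; linarith, fun c hc => ?_⟩
  rw [mem_ball_zero_iff, lt_div_iff₀ (by positivity)] at hc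
  rw [Bn, mem_ball_zero_iff, norm_smul]
  nlinarith [norm_nonneg c, norm_nonneg y]

theorem hasDerivAt_J_slice {n : ℕ} {g f : En n → ℂ} (hg : DifferentiableOn ℂ g (Bn n))
    (hf : DifferentiableOn ℂ f (Bn n)) {y : En n} (hy : y ∈ Bn n) :
    HasDerivAt (fun c : ℂ => J g f (c • y)) (f y * radD g y) 1 := by
  obtain ⟨R, hR1, hR⟩ := exists_ball_smul_mem hy
  obtain ⟨K, hK⟩ := isExactOn_slice hg hf hR
  have h1 : (1 : ℂ) ∈ ball (0 : ℂ) R := by simpa using hR1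
  have h2 := (hK 1 h1).sub_const (K 0)
  rw [one_smul] at h2
  refine h2.congr_of_eventuallyEq ?_
  filter_upwards [isOpen_ball.mem_nhds h1] with c hc
  exact (J_slice_eq hK hc).2

lemma integrableOn_J {n : ℕ} {g f : En n → ℂ} (hg : DifferentiableOn ℂ g (Bn n))
    (hf : DifferentiableOn ℂ f (Bn n)) {y : En n} (hy : y ∈ Bn n) :
    IntegrableOn (fun t : ℝ => f (t • y) * radD g (t • y) / (t : ℂ)) (Ioo 0 1) := by
  obtain ⟨R, hR1, hR⟩ := exists_ball_smul_mem hy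
  obtain ⟨K, hK⟩ := isExactOn_slice hg hf hR
  have := (J_slice_eq hK (c := 1) (by simpa using hR1)).1
  simpa using this

lemma exists_bound_closedBall {n : ℕ} {g : En n → ℂ} (hg : ContinuousOn g (Bn n)) {ρ : ℝ}
    (hρ : ρ < 1) : ∃ M : ℝ, 0 ≤ M ∧ ∀ x : En n, ‖x‖ ≤ ρ → ‖g x‖ ≤ M := by
  obtain ⟨M, hM⟩ := (isCompact_closedBall (0 : En n) ρ).exists_bound_of_continuousOn
    (hg.mono (closedBall_subset_ball hρ))
  exact ⟨max M 0, le_max_right _ _, fun x hx =>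
    (hM x (mem_closedBall_zero_iff.2 hx)).trans (le_max_left _ _)⟩

lemma exists_bound_fderiv {n : ℕ} {g : En n → ℂ} (hg : DifferentiableOn ℂ g (Bn n)) {ρ : ℝ}
    (hρ : ρ < 1) :
    ∃ M : ℝ, 0 ≤ M ∧ ∀ x y : En n, ‖x‖ ≤ ρ → ‖y‖ ≤ 1 → ‖fderiv ℂ g x y‖ ≤ M := by
  obtain ⟨M, hM0, hM⟩ := exists_bound_closedBall hg.continuousOn (ρ := (1 + ρ) / 2) (by linarith)
  have hε : 0 < (1 - ρ) / 2 := by linarith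
  refine ⟨M / ((1 - ρ) / 2), by positivity, fun x y hx hy => ?_⟩
  have hxB : x ∈ Bn n := by rw [Bn, mem_ball_zero_iff]; linarith
  have hle : ∀ c ∈ closedBall (0 : ℂ) ((1 - ρ) / 2), ‖x + c • y‖ ≤ (1 + ρ) / 2 := by
    intro c hc
    rw [mem_closedBall_zero_iff] at hc
    refine (norm_add_le _ _).trans ?_
    rw [norm_smul]
    nlinarith [norm_nonneg c, norm_nonneg y]
  rw [← (fderiv_apply_eq_deriv hg hxB y).deriv]
  refine Complex.norm_deriv_le_of_forall_mem_sphere_norm_le hε ?_ fun c hc =>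
    hM _ (hle c (sphere_subset_closedBall hc))
  refine ((hg.lineHol x y).mono ?_).diffContOnCl
  rw [closure_ball _ hε.ne']
  intro c hc
  have := hle c hc
  rw [mem_ofPred_eq, Bn, mem_ball_zero_iff]
  linarith

theorem J_lineHol {n : ℕ} {g f : En n → ℂ} (hg : DifferentiableOn ℂ g (Bn n))
    (hf : DifferentiableOn ℂ f (Bn n)) : LineHol (J g f) := by
  intro z w c₀ hc₀
  refine DifferentiableAt.differentiableWithinAt ?_
  have hc₀' : ‖z + c₀ • w‖ < 1 := mem_ball_zero_iff.1 hc₀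
  obtain ⟨ρ, hρ0, hρ1⟩ := exists_between hc₀'
  have hcont : Continuous fun c : ℂ => ‖z + c • w‖ := by fun_prop
  obtain ⟨r, hr, hball⟩ := Metric.eventually_nhds_iff_ball.1
    (hcont.continuousAt.eventually (gt_mem_nhds hρ0))
  obtain ⟨Mf, hMf0, hMf⟩ := exists_bound_closedBall hf.continuousOn hρ1
  obtain ⟨Mg, hMg0, hMg⟩ := exists_bound_fderiv hg hρ1
  have hnorm : ∀ c ∈ ball c₀ r, ∀ t ∈ Ioo (0 : ℝ) 1, ‖t • (z + c • w)‖ ≤ ρ := by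
    intro c hc t ht
    rw [norm_smul, Real.norm_of_nonneg ht.1.le]
    have := hball c hc
    nlinarith [ht.1, ht.2, norm_nonneg (z + c • w)]
  unfold J
  refine differentiableAt_integral_of_bounded (r := r) (M := Mf * Mg) hr ?_ ?_ ?_
  · filter_upwards [ae_restrict_mem measurableSet_Ioo] with t ht
    have hsub : ∀ c ∈ ball c₀ r, t • z + c • (t • w) ∈ Bn n := by
      intro c hc
      have := hnorm c hc t ht
      rw [smul_add, smul_comm t c w] at this
      rw [Bn, mem_ball_zero_iff]; linarith
    have h1 := ((hf.lineHol (t • z) (t • w)).mono hsub)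
    have h2 := ((radD_lineHol hg (t • z) (t • w)).mono hsub)
    refine ((h1.mul h2).div_const (t : ℂ)).congr fun c hc => ?_
    simp only [smul_add, smul_comm t c w, Pi.mul_apply]
  · filter_upwards [ae_restrict_mem measurableSet_Ioo] with t ht c hc
    rw [mul_div_assoc, radD_smul_div g (z + c • w) ht.1.ne' _ rfl, norm_mul]
    have := hball c hc
    exact mul_le_mul (hMf _ (hnorm c hc t ht)) (hMg _ _ (hnorm c hc t ht) (by linarith))
      (norm_nonneg _) hMf0
  · intro c hc
    refine (integrableOn_J hg hf ?_).1
    have := hball c hc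
    rw [Bn, mem_ball_zero_iff]; linarith

/-- Constant of the pointwise estimate for Hardy functions. -/
def ptConst (n : ℕ) (p : ℝ) : ℝ := (10 * n * 4 ^ n : ℝ) ^ (1 / p)

lemma ptConst_pos {n : ℕ} (hn : 1 ≤ n) (p : ℝ) : 0 < ptConst n p := by
  have : (0 : ℝ) < n := by exact_mod_cast hn
  exact Real.rpow_pos_of_pos (by positivity) _

theorem LineHol.enorm_le_hNorm {n : ℕ} (hn : 1 ≤ n) {F : En n → ℂ} (hF : LineHol F)
    (hm : Measurable ((Bn n).indicator F)) {p : ℝ} (hp : 0 < p) {a : En n} (ha : ‖a‖ < 1) :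
    ‖F a‖ₑ ≤ ENNReal.ofReal (ptConst n p * (1 - ‖a‖) ^ (-(n / p) : ℝ)) * hNorm n p F := by
  have hd : 0 < 1 - ‖a‖ := by linarith
  have h := hF.enorm_rpow_le_hSup hn hm hp ha
  have h2 := ENNReal.rpow_le_rpow h (by positivity : 0 ≤ 1 / p)
  rw [← ENNReal.rpow_mul, mul_one_div_cancel hp.ne', ENNReal.rpow_one,
    ENNReal.mul_rpow_of_nonneg _ _ (by positivity), ← hNorm_eq] at h2
  refine h2.trans_eq ?_
  rw [ENNReal.ofReal_rpow_of_nonneg (by positivity) (by positivity),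
    Real.mul_rpow (by positivity) (by positivity), ← Real.rpow_mul hd.le, ptConst]
  congr 5
  ring

/-- Constant of the lower estimate for the norm of the integration operator. -/
def lowerConst (n : ℕ) (p q α : ℝ) : ℝ :=
  2 ^ (1 - α + (n + 2) / p) * 2 * (ptConst n q * 2 ^ (n / q : ℝ))

theorem lipNorm_le_of_bounded {n : ℕ} (hn : 1 ≤ n) {p q α : ℝ} (hp : 0 < p) (hpq : p < q)
    (hα : α = (n : ℝ) * (1 / p - 1 / q)) (hα1 : α ≤ 1) {g : En n → ℂ}
    (hg : DifferentiableOn ℂ g (Bn n)) {C : ℝ≥0∞} (hC : C ≠ ⊤)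
    (h : ∀ f, MemHp n p f → hNorm n q (J g f) ≤ C * hNorm n p f) :
    lipNorm n α g ≤ ENNReal.ofReal (lowerConst n p q α) * (C * kernelConst n ^ (1 / p)) := by
  have hq : 0 < q := hp.trans hpq
  refine iSup₂_le fun a ha => ?_
  have ha1 : ‖a‖ < 1 := mem_ball_zero_iff.1 ha
  set d := 1 - ‖a‖ with hd
  have hd0 : 0 < d := by linarith
  have hd1 : d ≤ 1 := by linarith [norm_nonneg a]
  have hf := memHp_testF hn hp ha1
  set f := testF n p a
  set D := C * kernelConst n ^ (1 / p) with hD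
  have hDt : D ≠ ⊤ := ENNReal.mul_ne_top hC
    (ENNReal.rpow_lt_top_of_nonneg (by positivity) (kernelConst_ne_top n)).ne
  have hfn : hNorm n p f ≤ kernelConst n ^ (1 / p) * ENNReal.ofReal (d ^ (-(2 / p))) := by
    rw [hNorm_eq]
    refine (ENNReal.rpow_le_rpow (hSup_testF_le hn hp ha1) (by positivity)).trans_eq ?_
    rw [ENNReal.mul_rpow_of_nonneg _ _ (by positivity),
      ENNReal.ofReal_rpow_of_nonneg (by positivity) (by positivity)]
    congr 2
    rw [← Real.rpow_natCast, ← Real.rpow_neg hd0.le, ← Real.rpow_mul hd0.le]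
    congr 1
    push_cast; ring
  have hJn : hNorm n q (J g f) ≤ D * ENNReal.ofReal (d ^ (-(2 / p))) := by
    refine (h f hf).trans ?_
    rw [hD, mul_assoc]
    gcongr
  have hpt : ∀ b : En n, ‖b‖ ≤ 1 - d / 2 →
      ‖J g f b‖ ≤ ptConst n q * (d / 2) ^ (-(n / q) : ℝ) * (D.toReal * d ^ (-(2 / p))) := by
    intro b hb
    have h1 := (J_lineHol hg hf.1).enorm_le_hNorm hn (measurable_indicator_J g hf.1) hq
      (a := b) (by linarith)
    have h2 : (1 - ‖b‖) ^ (-(n / q) : ℝ) ≤ (d / 2) ^ (-(n / q) : ℝ) :=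
      Real.rpow_le_rpow_of_nonpos (by positivity) (by linarith)
        (neg_nonpos.2 (by positivity))
    have hP := ptConst_pos hn q
    have h3 : ‖J g f b‖ₑ ≤ ENNReal.ofReal (ptConst n q * (d / 2) ^ (-(n / q) : ℝ)) *
        (D * ENNReal.ofReal (d ^ (-(2 / p)))) :=
      h1.trans (mul_le_mul' (ENNReal.ofReal_le_ofReal (by gcongr)) hJn)
    rw [← ENNReal.ofReal_toReal hDt, ← ENNReal.ofReal_mul ENNReal.toReal_nonneg,
      ← ENNReal.ofReal_mul (by positivity), ← ofReal_norm] at h3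
    exact (ENNReal.ofReal_le_ofReal_iff (by positivity)).1 h3
  have hmem : ∀ c ∈ closedBall (1 : ℂ) (d / 2), ‖c • a‖ ≤ 1 - d / 2 := by
    intro c hc
    rw [mem_closedBall, dist_eq_norm] at hc
    have : ‖c‖ ≤ 1 + d / 2 := by
      have := norm_sub_norm_le c 1
      rw [norm_one] at this; linarith
    rw [norm_smul]
    nlinarith [norm_nonneg a]
  have hder := hasDerivAt_J_slice hg hf.1 ha
  have hcau : ‖f a * radD g a‖ ≤
      ptConst n q * (d / 2) ^ (-(n / q) : ℝ) * (D.toReal * d ^ (-(2 / p))) / (d / 2) := by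
    rw [← hder.deriv]
    refine Complex.norm_deriv_le_of_forall_mem_sphere_norm_le (half_pos hd0) ?_ fun c hc =>
      hpt _ (hmem c (sphere_subset_closedBall hc))
    refine DifferentiableOn.diffContOnCl ?_
    rw [closure_ball _ (half_pos hd0).ne']
    have h3 : DifferentiableOn ℂ (fun c : ℂ => J g f ((0 : En n) + c • a))
        (closedBall (1 : ℂ) (d / 2)) := (J_lineHol hg hf.1 0 a).mono (fun c hc => by
      have := hmem c hc
      rw [mem_ofPred_eq, zero_add, Bn, mem_ball_zero_iff]; linarith)
    simpa using h3
  rw [norm_mul, norm_testF_self p ha1] at hcau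
  have hx0 : 0 < 1 - ‖a‖ ^ 2 := by nlinarith [norm_nonneg a]
  have hx2 : 1 - ‖a‖ ^ 2 ≤ 2 * d := by nlinarith [norm_nonneg a]
  set x := 1 - ‖a‖ ^ 2
  have hP := ptConst_pos hn q
  have hfinal : x ^ (1 - α) * ‖radD g a‖ ≤ lowerConst n p q α * D.toReal := by
    have hexp : 0 ≤ 1 - α + (n + 2) / p := by
      have : 0 ≤ ((n : ℝ) + 2) / p := by positivity
      linarith
    have e1 : x ^ (1 - α) * ‖radD g a‖ =
        x ^ (1 - α + (n + 2) / p) * (x ^ (-(n + 2) / p : ℝ) * ‖radD g a‖) := by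
      rw [← mul_assoc, ← Real.rpow_add hx0]
      congr 2; ring
    rw [e1]
    refine (mul_le_mul (Real.rpow_le_rpow hx0.le hx2 hexp) hcau (by positivity)
      (by positivity)).trans_eq ?_
    rw [Real.mul_rpow (by norm_num) hd0.le, Real.div_rpow hd0.le (by norm_num), lowerConst]
    have e2 : d ^ (1 - α + (n + 2) / p) * d ^ (-(n / q) : ℝ) * d ^ (-(2 / p)) = d := by
      rw [← Real.rpow_add hd0, ← Real.rpow_add hd0]
      convert Real.rpow_one d using 2
      rw [hα]; field_simp; ring
    rw [Real.rpow_neg (by norm_num : (0 : ℝ) ≤ 2)]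
    have h2 : (0 : ℝ) < 2 ^ (n / q : ℝ) := by positivity
    generalize (2 : ℝ) ^ (n / q : ℝ) = T at h2 ⊢
    generalize (2 : ℝ) ^ (1 - α + (n + 2) / p) = X
    generalize d ^ (1 - α + (n + 2) / p) = Y at e2 ⊢
    generalize d ^ (-(n / q) : ℝ) = Z at e2 ⊢
    generalize d ^ (-(2 / p)) = W at e2 ⊢
    calc _ = X * 2 * (ptConst n q * T) * D.toReal * ((Y * Z * W) / d) := by
          clear_value d D; clear e2; field_simp
      _ = _ := by rw [e2, div_self hd0.ne', mul_one]
  calc _ = ENNReal.ofReal (x ^ (1 - α) * ‖radD g a‖) := by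
        rw [ENNReal.ofReal_mul (by positivity), ofReal_norm]; rfl
    _ ≤ ENNReal.ofReal (lowerConst n p q α * D.toReal) := ENNReal.ofReal_le_ofReal hfinal
    _ = _ := by
        rw [ENNReal.ofReal_mul (by rw [lowerConst]; positivity), ENNReal.ofReal_toReal hDt]

lemma norm_radD_le {n : ℕ} {g : En n → ℂ} {α : ℝ} (hL : lipNorm n α g ≠ ⊤) {z : En n}
    (hz : z ∈ Bn n) :
    ‖radD g z‖ ≤ (lipNorm n α g).toReal * (1 - ‖z‖ ^ 2) ^ (α - 1) := by
  have hz1 : ‖z‖ < 1 := mem_ball_zero_iff.1 hz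
  have hx : 0 < 1 - ‖z‖ ^ 2 := by nlinarith [norm_nonneg z]
  have h : ENNReal.ofReal ((1 - ‖z‖ ^ 2) ^ (1 - α)) * ‖radD g z‖ₑ ≤ lipNorm n α g :=
    le_iSup₂ (f := fun z (_ : z ∈ Bn n) =>
      ENNReal.ofReal ((1 - ‖z‖ ^ 2) ^ (1 - α)) * (‖radD g z‖₊ : ℝ≥0∞)) z hz
  have h2 := ENNReal.toReal_mono hL h
  rw [ENNReal.toReal_mul, ENNReal.toReal_ofReal (by positivity), toReal_enorm] at h2
  calc ‖radD g z‖ = (1 - ‖z‖ ^ 2) ^ (1 - α) * ‖radD g z‖ * (1 - ‖z‖ ^ 2) ^ (α - 1) := by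
        rw [mul_right_comm, ← Real.rpow_add hx]; simp
    _ ≤ _ := by gcongr

lemma radD_smul {n : ℕ} (g : En n → ℂ) (c : ℂ) (y : En n) :
    radD g (c • y) = c * fderiv ℂ g (c • y) y := by
  rw [radD, map_smul, smul_eq_mul]

lemma norm_fderiv_slice_le {n : ℕ} {g : En n → ℂ} (hg : DifferentiableOn ℂ g (Bn n)) {α : ℝ}
    (hα0 : 0 ≤ α) (hα1 : α ≤ 1) (hL : lipNorm n α g ≠ ⊤) {η : En n} (hη : ‖η‖ = 1) {t : ℝ}
    (ht : t ∈ Ioo (0 : ℝ) 1) :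
    ‖fderiv ℂ g ((t : ℂ) • η) η‖ ≤ 4 * (lipNorm n α g).toReal * (1 - t) ^ (α - 1) := by
  set L := (lipNorm n α g).toReal
  have hL0 : 0 ≤ L := ENNReal.toReal_nonneg
  have hmem : ∀ c ∈ ball (0 : ℂ) 1, c • η ∈ Bn n := by
    intro c hc
    rw [Bn, mem_ball_zero_iff, norm_smul, hη, mul_one]
    exact mem_ball_zero_iff.1 hc
  have key : ∀ c ∈ ball (0 : ℂ) 1, ‖c‖ * ‖fderiv ℂ g (c • η) η‖ ≤
      L * (1 - ‖c‖ ^ 2) ^ (α - 1) := by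
    intro c hc
    have := norm_radD_le hL (hmem c hc)
    rwa [radD_smul, norm_mul, norm_smul, hη, mul_one] at this
  have hder : ∀ c ∈ ball (0 : ℂ) 1,
      HasDerivAt (fun c : ℂ => g (c • η)) (fderiv ℂ g (c • η) η) c := by
    intro c hc
    have h2 : HasDerivAt (fun c : ℂ => c • η) η c := by
      simpa using (hasDerivAt_id c).smul_const η
    exact (hg.differentiableAt (isOpen_ball.mem_nhds
      (hmem c hc))).hasFDerivAt.comp_hasDerivAt c h2
  have hdiff : DifferentiableOn ℂ (fun c : ℂ => fderiv ℂ g (c • η) η) (ball 0 1) := by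
    have h1 : DifferentiableOn ℂ (fun c : ℂ => g (c • η)) (ball 0 1) := fun c hc =>
      (hder c hc).differentiableAt.differentiableWithinAt
    exact (h1.deriv isOpen_ball).congr fun c hc => (hder c hc).deriv.symm
  have ht1 : (t : ℂ) ∈ ball (0 : ℂ) 1 := by
    rw [mem_ball_zero_iff, Complex.norm_real, Real.norm_of_nonneg ht.1.le]; exact ht.2
  rcases le_total t (1 / 2) with h | h
  · have h1 : ‖fderiv ℂ g ((t : ℂ) • η) η‖ ≤ 4 * L := by
      refine Complex.norm_le_of_forall_mem_frontier_norm_le (U := ball (0 : ℂ) (1 / 2))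
        (f := fun c : ℂ => fderiv ℂ g (c • η) η) isBounded_ball ?_ ?_ ?_
      · refine DifferentiableOn.diffContOnCl (hdiff.mono ?_)
        rw [closure_ball _ (by norm_num)]
        exact closedBall_subset_ball (by norm_num)
      · intro c hc
        rw [frontier_ball _ (by norm_num), mem_sphere_zero_iff_norm] at hc
        have h2 := key c (by rw [mem_ball_zero_iff, hc]; norm_num)
        rw [hc] at h2
        have h3 : (1 - (1 / 2 : ℝ) ^ 2) ^ (α - 1) ≤ (1 - (1 / 2 : ℝ) ^ 2) ^ (-1 : ℝ) :=
          Real.rpow_le_rpow_of_exponent_ge (by norm_num) (by norm_num) (by linarith)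
        rw [Real.rpow_neg_one] at h3
        have h4 := mul_le_mul_of_nonneg_left h3 hL0
        norm_num at h2 h4
        linarith
      · rw [closure_ball _ (by norm_num), mem_closedBall_zero_iff, Complex.norm_real,
          Real.norm_of_nonneg ht.1.le]
        exact h
    refine h1.trans (le_mul_of_one_le_right (by positivity) ?_)
    exact Real.one_le_rpow_of_pos_of_le_one_of_nonpos (by linarith [ht.2]) (by linarith [ht.1])
      (by linarith)
  · have h2 := key t ht1
    rw [Complex.norm_real, Real.norm_of_nonneg ht.1.le] at h2
    have h3 : (1 - t ^ 2) ^ (α - 1) ≤ (1 - t) ^ (α - 1) :=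
      Real.rpow_le_rpow_of_nonpos (by linarith [ht.2]) (by nlinarith [ht.1, ht.2]) (by linarith)
    have h4 := mul_le_mul_of_nonneg_left h3 hL0
    have h5 : 0 ≤ L * (1 - t) ^ (α - 1) :=
      mul_nonneg hL0 (Real.rpow_nonneg (by linarith [ht.2]) _)
    have h6 := mul_le_mul_of_nonneg_right h (norm_nonneg (fderiv ℂ g ((t : ℂ) • η) η))
    linarith

lemma norm_J_integrand_le {n : ℕ} {g : En n → ℂ} (hg : DifferentiableOn ℂ g (Bn n)) {α : ℝ}
    (hα0 : 0 ≤ α) (hα1 : α ≤ 1) (hL : lipNorm n α g ≠ ⊤) (f : En n → ℂ) {η : En n}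
    (hη : ‖η‖ = 1) {r : ℝ} (hr : r ∈ Ioo (0 : ℝ) 1) {t : ℝ} (ht : t ∈ Ioo (0 : ℝ) 1) :
    ‖f (t • r • η) * radD g (t • r • η) / (t : ℂ)‖ ≤
      ‖f (t • r • η)‖ * (4 * (lipNorm n α g).toReal * (1 - t) ^ (α - 1)) := by
  have hL0 : 0 ≤ (lipNorm n α g).toReal := ENNReal.toReal_nonneg
  rw [mul_div_assoc, radD_smul_div g (r • η) ht.1.ne' _ rfl, norm_mul]
  refine mul_le_mul_of_nonneg_left ?_ (norm_nonneg _)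
  have e : t • r • η = ((t * r : ℝ) : ℂ) • η := by rw [Complex.coe_smul, smul_smul]
  rw [e, ← Complex.coe_smul r, map_smul, norm_smul, Complex.norm_real,
    Real.norm_of_nonneg hr.1.le]
  have htr : t * r ∈ Ioo (0 : ℝ) 1 :=
    ⟨mul_pos ht.1 hr.1, by nlinarith [ht.1, ht.2, hr.1, hr.2]⟩
  have h1 := norm_fderiv_slice_le hg hα0 hα1 hL hη htr
  have h2 : (1 - t * r) ^ (α - 1) ≤ (1 - t) ^ (α - 1) :=
    Real.rpow_le_rpow_of_nonpos (by linarith [ht.2]) (by nlinarith [ht.1, hr.2]) (by linarith)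
  calc r * _ ≤ 1 * _ := mul_le_mul_of_nonneg_right hr.2.le (norm_nonneg _)
    _ ≤ 4 * (lipNorm n α g).toReal * (1 - t * r) ^ (α - 1) := by rwa [one_mul]
    _ ≤ _ := by gcongr

/-- Hedberg's estimate: an integral of a minimum of two power functions. -/
lemma lintegral_rpow_le_of_le_min {a b M N : ℝ} (ha : 0 < a) (hab : a < b) (hM : 0 ≤ M)
    (hN : 0 ≤ N) {φ : ℝ → ℝ} (hφ0 : ∀ t ∈ Ioo (0 : ℝ) 1, 0 ≤ φ t)
    (hφM : ∀ t ∈ Ioo (0 : ℝ) 1, φ t ≤ M)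
    (hφN : ∀ t ∈ Ioo (0 : ℝ) 1, φ t ≤ N * (1 - t) ^ (-b)) :
    ∫⁻ t in Ioo (0 : ℝ) 1, ENNReal.ofReal (φ t * (1 - t) ^ (a - 1)) ≤
      ENNReal.ofReal ((1 / a + 1 / (b - a)) * (N ^ (a / b) * M ^ (1 - a / b))) := by
  have hb : 0 < b := ha.trans hab
  have hba : 0 < b - a := by linarith
  by_cases hMN : M = 0 ∨ N = 0
  · have h0 : ∀ t ∈ Ioo (0 : ℝ) 1, ENNReal.ofReal (φ t * (1 - t) ^ (a - 1)) = 0 := by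
      intro t ht
      have : φ t = 0 := by
        refine le_antisymm ?_ (hφ0 t ht)
        rcases hMN with h | h
        · exact h ▸ hφM t ht
        · have := hφN t ht
          rwa [h, zero_mul] at this
      rw [this, zero_mul, ENNReal.ofReal_zero]
    rw [setLIntegral_congr_fun measurableSet_Ioo h0, lintegral_zero]
    exact zero_le
  push Not at hMN
  replace hM : 0 < M := hM.lt_of_ne' hMN.1
  replace hN : 0 < N := hN.lt_of_ne' hMN.2
  set δ := (N / M) ^ (1 / b) with hδ
  have hδ0 : 0 < δ := by positivity
  have hi1 : IntegrableOn (fun s : ℝ => M * s ^ (a - 1)) (Ioc 0 δ) :=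
    ((intervalIntegrable_iff_integrableOn_Ioc_of_le hδ0.le).1
      (intervalIntegral.intervalIntegrable_rpow' (by linarith))).const_mul M
  have hi2 : IntegrableOn (fun s : ℝ => N * s ^ (a - b - 1)) (Ioi δ) :=
    (integrableOn_Ioi_rpow_of_lt (by linarith) hδ0).const_mul N
  have v1 : ∫ s in Ioc 0 δ, M * s ^ (a - 1) = M * (δ ^ a / a) := by
    rw [integral_const_mul, ← intervalIntegral.integral_of_le hδ0.le,
      integral_rpow (Or.inl (by linarith)), sub_add_cancel, Real.zero_rpow ha.ne', sub_zero]
  have v2 : ∫ s in Ioi δ, N * s ^ (a - b - 1) = N * (δ ^ (a - b) / (b - a)) := by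
    rw [integral_const_mul, integral_Ioi_rpow_of_lt (by linarith) hδ0, sub_add_cancel,
      ← neg_sub b a, div_neg, neg_div, neg_neg]
  have w1 : M * δ ^ a = N ^ (a / b) * M ^ (1 - a / b) := by
    rw [hδ, ← Real.rpow_mul (by positivity), Real.div_rpow hN.le hM.le, Real.rpow_sub hM,
      Real.rpow_one, one_div_mul_eq_div]
    ring
  have w2 : N * δ ^ (a - b) = N ^ (a / b) * M ^ (1 - a / b) := by
    have : δ ^ b = N / M := by
      rw [hδ, ← Real.rpow_mul (by positivity), one_div_mul_cancel hb.ne', Real.rpow_one]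
    rw [Real.rpow_sub hδ0, this, ← w1]
    field_simp
  have hle : ∀ s ∈ Ioo (0 : ℝ) 1, φ (1 - s) * s ^ (a - 1) ≤ M * s ^ (a - 1) ∧
      φ (1 - s) * s ^ (a - 1) ≤ N * s ^ (a - b - 1) := by
    intro s hs
    have hs' : 1 - s ∈ Ioo (0 : ℝ) 1 := ⟨by linarith [hs.2], by linarith [hs.1]⟩
    have hp : 0 ≤ s ^ (a - 1) := Real.rpow_nonneg hs.1.le _
    refine ⟨mul_le_mul_of_nonneg_right (hφM _ hs') hp, ?_⟩
    have := mul_le_mul_of_nonneg_right (hφN _ hs') hp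
    rwa [sub_sub_cancel, mul_assoc, ← Real.rpow_add hs.1,
      show -b + (a - 1) = a - b - 1 by ring] at this
  have hsub : ∫⁻ t in Ioo (0 : ℝ) 1, ENNReal.ofReal (φ t * (1 - t) ^ (a - 1)) =
      ∫⁻ s in Ioo (0 : ℝ) 1, ENNReal.ofReal (φ (1 - s) * s ^ (a - 1)) := by
    rw [← lintegral_indicator measurableSet_Ioo, ← lintegral_indicator measurableSet_Ioo,
      ← lintegral_sub_left_eq_self _ (1 : ℝ)]
    refine lintegral_congr fun s => ?_
    by_cases hs : s ∈ Ioo (0 : ℝ) 1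
    · have hs' : 1 - s ∈ Ioo (0 : ℝ) 1 := ⟨by linarith [hs.2], by linarith [hs.1]⟩
      rw [indicator_of_mem hs, indicator_of_mem hs', sub_sub_cancel]
    · have hs' : 1 - s ∉ Ioo (0 : ℝ) 1 := fun h => hs ⟨by linarith [h.2], by linarith [h.1]⟩
      rw [indicator_of_notMem hs, indicator_of_notMem hs']
  set ψ : ℝ → ℝ≥0∞ := (Ioo (0 : ℝ) 1).indicator
    fun s => ENNReal.ofReal (φ (1 - s) * s ^ (a - 1)) with hψ
  calc _ = ∫⁻ s, ψ s := by rw [hsub, ← lintegral_indicator measurableSet_Ioo]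
    _ ≤ ∫⁻ s in Ioi 0, ψ s := by
        rw [← lintegral_indicator measurableSet_Ioi]
        refine lintegral_mono fun s => ?_
        by_cases hs : s ∈ Ioi (0 : ℝ)
        · rw [indicator_of_mem hs]
        · rw [hψ, indicator_of_notMem fun h => hs h.1]; exact zero_le
    _ ≤ (∫⁻ s in Ioc 0 δ, ψ s) + ∫⁻ s in Ioi δ, ψ s := by
        rw [← Ioc_union_Ioi_eq_Ioi hδ0.le]
        exact lintegral_union_le _ _ _
    _ ≤ ENNReal.ofReal (∫ s in Ioc 0 δ, M * s ^ (a - 1)) +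
        ENNReal.ofReal (∫ s in Ioi δ, N * s ^ (a - b - 1)) := by
        rw [ofReal_integral_eq_lintegral_ofReal hi1, ofReal_integral_eq_lintegral_ofReal hi2]
        · refine add_le_add (setLIntegral_mono' measurableSet_Ioc fun s _ => ?_)
            (setLIntegral_mono' measurableSet_Ioi fun s _ => ?_)
          · by_cases hs : s ∈ Ioo (0 : ℝ) 1
            · rw [hψ, indicator_of_mem hs]
              exact ENNReal.ofReal_le_ofReal (hle s hs).1
            · rw [hψ, indicator_of_notMem hs]; exact zero_le
          · by_cases hs : s ∈ Ioo (0 : ℝ) 1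
            · rw [hψ, indicator_of_mem hs]
              exact ENNReal.ofReal_le_ofReal (hle s hs).2
            · rw [hψ, indicator_of_notMem hs]; exact zero_le
        · refine (ae_restrict_iff' measurableSet_Ioi).2 (ae_of_all _ fun s hs => ?_)
          have : 0 < s := hδ0.trans hs
          simp only [Pi.zero_apply]; positivity
        · refine (ae_restrict_iff' measurableSet_Ioc).2 (ae_of_all _ fun s hs => ?_)
          have : 0 < s := hs.1
          simp only [Pi.zero_apply]; positivity
    _ = _ := by
        rw [v1, v2, ← ENNReal.ofReal_add (by positivity) (by positivity), ← mul_div_assoc,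
          ← mul_div_assoc, w1, w2]
        congr 1
        ring

/-- Constant of the pointwise upper estimate for the integration operator. -/
def upperConst (n : ℕ) (p q α : ℝ) : ℝ :=
  4 * (1 / α + 1 / (n / p - α)) * ptConst n p ^ (1 - p / q)

lemma enorm_J_le {n : ℕ} (hn : 1 ≤ n) {p q α : ℝ} (hp : 0 < p) (hpq : p < q)
    (hα : α = (n : ℝ) * (1 / p - 1 / q)) (hα1 : α ≤ 1) {g f : En n → ℂ}
    (hg : DifferentiableOn ℂ g (Bn n)) (hL : lipNorm n α g ≠ ⊤) (hf : MemHp n p f)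
    {η : En n} (hη : ‖η‖ = 1) {r : ℝ} (hr : r ∈ Ioo (0 : ℝ) 1) {M : ℝ} (hM0 : 0 ≤ M)
    (hM : ∀ t ∈ Ioo (0 : ℝ) 1, ‖f (t • r • η)‖ ≤ M) :
    ‖J g f (r • η)‖ₑ ≤ ENNReal.ofReal (upperConst n p q α * (lipNorm n α g).toReal *
      ((hNorm n p f).toReal ^ (1 - p / q) * M ^ (p / q))) := by
  have hq : 0 < q := hp.trans hpq
  have hn0 : (0 : ℝ) < n := by exact_mod_cast hn
  have hα0 : 0 < α := by
    rw [hα]; exact mul_pos hn0 (sub_pos.2 (one_div_lt_one_div_of_lt hp hpq))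
  have hb : α < n / p := by
    have h1 : 0 < (n : ℝ) / q := by positivity
    have : α = n / p - n / q := by rw [hα]; ring
    linarith
  have hab : α / (n / p) = 1 - p / q := by
    rw [hα]; field_simp
  set L := (lipNorm n α g).toReal
  have hL0 : 0 ≤ L := ENNReal.toReal_nonneg
  set H := (hNorm n p f).toReal
  have hH0 : 0 ≤ H := ENNReal.toReal_nonneg
  have hP := ptConst_pos hn p
  have hN : ∀ t ∈ Ioo (0 : ℝ) 1,
      ‖f (t • r • η)‖ ≤ ptConst n p * H * (1 - t) ^ (-(n / p) : ℝ) := by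
    intro t ht
    have hnt : ‖t • r • η‖ ≤ t := by
      rw [norm_smul, norm_smul, hη, Real.norm_of_nonneg ht.1.le, Real.norm_of_nonneg hr.1.le]
      nlinarith [ht.1, hr.2]
    have ht1 : 0 < 1 - t := by linarith [ht.2]
    have h1 := hf.1.lineHol.enorm_le_hNorm hn hf.1.continuousOn.measurable_indicator_ball hp
      (hnt.trans_lt ht.2)
    have h2 : (1 - ‖t • r • η‖) ^ (-(n / p) : ℝ) ≤ (1 - t) ^ (-(n / p) : ℝ) :=
      Real.rpow_le_rpow_of_nonpos ht1 (by linarith) (neg_nonpos.2 (by positivity))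
    have h3 : ‖f (t • r • η)‖ₑ ≤
        ENNReal.ofReal (ptConst n p * (1 - t) ^ (-(n / p) : ℝ)) * hNorm n p f :=
      h1.trans (mul_le_mul_left (ENNReal.ofReal_le_ofReal (by gcongr)) _)
    rw [← ENNReal.ofReal_toReal hf.2.ne, ← ENNReal.ofReal_mul (by positivity),
      ← ofReal_norm] at h3
    refine ((ENNReal.ofReal_le_ofReal_iff (by positivity)).1 h3).trans_eq ?_
    ring
  have hmin := lintegral_rpow_le_of_le_min hα0 hb hM0 (mul_nonneg hP.le hH0)
    (fun t _ => norm_nonneg _) hM hN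
  calc ‖J g f (r • η)‖ₑ
      ≤ ∫⁻ t in Ioo (0 : ℝ) 1, ‖f (t • r • η) * radD g (t • r • η) / (t : ℂ)‖ₑ :=
        enorm_integral_le_lintegral_enorm _
    _ ≤ ∫⁻ t in Ioo (0 : ℝ) 1, ENNReal.ofReal (4 * L) *
          ENNReal.ofReal (‖f (t • r • η)‖ * (1 - t) ^ (α - 1)) := by
        refine setLIntegral_mono' measurableSet_Ioo fun t ht => ?_
        rw [← ofReal_norm, ← ENNReal.ofReal_mul (by positivity)]
        refine ENNReal.ofReal_le_ofReal
          ((norm_J_integrand_le hg hα0.le hα1 hL f hη hr ht).trans_eq ?_)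
        ring
    _ ≤ _ := by
        rw [lintegral_const_mul' _ _ ENNReal.ofReal_ne_top]
        refine (mul_le_mul_right hmin _).trans_eq ?_
        rw [← ENNReal.ofReal_mul (by positivity), hab, Real.mul_rpow hP.le hH0, sub_sub_cancel,
          upperConst]
        congr 1
        ring

lemma enorm_J_rpow_le {n : ℕ} (hn : 1 ≤ n) {p q α : ℝ} (hp : 0 < p) (hpq : p < q)
    (hα : α = (n : ℝ) * (1 / p - 1 / q)) (hα1 : α ≤ 1) {g f : En n → ℂ}
    (hg : DifferentiableOn ℂ g (Bn n)) (hL : lipNorm n α g ≠ ⊤) (hf : MemHp n p f)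
    {η : En n} (hη : ‖η‖ = 1) {r : ℝ} (hr : r ∈ Ioo (0 : ℝ) 1) :
    ‖J g f (r • η)‖ₑ ^ q ≤
      (ENNReal.ofReal (upperConst n p q α) * lipNorm n α g) ^ q * hNorm n p f ^ (q - p) *
        radialMax p f η := by
  have hq : 0 < q := hp.trans hpq
  obtain ⟨B, hB0, hB⟩ := exists_bound_closedBall hf.1.continuousOn hr.2
  set μ := min (radialMax p f η) (ENNReal.ofReal B ^ p) with hμ
  have hμt : μ ≠ ⊤ := ((min_le_right _ _).trans_lt
    (ENNReal.rpow_lt_top_of_nonneg hp.le ENNReal.ofReal_ne_top)).ne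
  have hM : ∀ t ∈ Ioo (0 : ℝ) 1, ‖f (t • r • η)‖ ≤ μ.toReal ^ (1 / p) := by
    intro t ht
    have htr : t * r ∈ Ioo (0 : ℝ) 1 :=
      ⟨mul_pos ht.1 hr.1, by nlinarith [ht.1, ht.2, hr.1, hr.2]⟩
    have h1 : ‖f (t • r • η)‖ₑ ^ p ≤ μ := by
      refine le_min ?_ (ENNReal.rpow_le_rpow ?_ hp.le)
      · rw [smul_smul]
        exact enorm_rpow_le_radialMax hf.1.continuousOn hη htr
      · rw [← ofReal_norm]
        refine ENNReal.ofReal_le_ofReal (hB _ ?_)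
        rw [smul_smul, norm_smul, hη, mul_one, Real.norm_of_nonneg htr.1.le]
        nlinarith [ht.2, hr.1]
    have h2 := ENNReal.toReal_mono hμt h1
    rw [← ENNReal.toReal_rpow, toReal_enorm] at h2
    calc ‖f (t • r • η)‖ = (‖f (t • r • η)‖ ^ p) ^ (1 / p) := by
          rw [← Real.rpow_mul (norm_nonneg _), mul_one_div_cancel hp.ne', Real.rpow_one]
      _ ≤ _ := Real.rpow_le_rpow (by positivity) h2 (by positivity)
  have hm0 : 0 ≤ μ.toReal := ENNReal.toReal_nonneg
  have h := enorm_J_le hn hp hpq hα hα1 hg hL hf hη hr (Real.rpow_nonneg hm0 _) hM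
  have hL0 : 0 ≤ (lipNorm n α g).toReal := ENNReal.toReal_nonneg
  have hH0 : 0 ≤ (hNorm n p f).toReal := ENNReal.toReal_nonneg
  have hpq1 : 0 ≤ 1 - p / q := by rw [sub_nonneg, div_le_one hq]; exact hpq.le
  rw [ENNReal.ofReal_mul' (by positivity), ENNReal.ofReal_mul' hL0, ENNReal.ofReal_toReal hL,
    ENNReal.ofReal_mul (by positivity), ← Real.rpow_mul hm0,
    ← ENNReal.ofReal_rpow_of_nonneg hH0 hpq1, ← ENNReal.ofReal_rpow_of_nonneg hm0 (by positivity),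
    ENNReal.ofReal_toReal hf.2.ne, ENNReal.ofReal_toReal hμt] at h
  refine (ENNReal.rpow_le_rpow h hq.le).trans ?_
  rw [ENNReal.mul_rpow_of_nonneg _ _ hq.le, ENNReal.mul_rpow_of_nonneg (_ ^ (1 - p / q)) _ hq.le,
    ← ENNReal.rpow_mul, ← ENNReal.rpow_mul, show (1 - p / q) * q = q - p by field_simp,
    show 1 / p * (p / q) * q = 1 by field_simp, ENNReal.rpow_one, mul_assoc]
  gcongr
  exact min_le_left _ _

theorem hNorm_J_le {n : ℕ} (hn : 1 ≤ n) {p q α : ℝ} (hp : 0 < p) (hpq : p < q)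
    (hα : α = (n : ℝ) * (1 / p - 1 / q)) (hα1 : α ≤ 1) {g f : En n → ℂ}
    (hg : DifferentiableOn ℂ g (Bn n)) (hL : lipNorm n α g ≠ ⊤) (hf : MemHp n p f) :
    hNorm n q (J g f) ≤
      256 ^ (1 / q) * ENNReal.ofReal (upperConst n p q α) * lipNorm n α g * hNorm n p f := by
  have hq : 0 < q := hp.trans hpq
  set S := ENNReal.ofReal (upperConst n p q α) * lipNorm n α g
  have hS : S ≠ ⊤ := ENNReal.mul_ne_top ENNReal.ofReal_ne_top hL
  have hA : S ^ q * hNorm n p f ^ (q - p) ≠ ⊤ := ENNReal.mul_ne_top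
    (ENNReal.rpow_lt_top_of_nonneg hq.le hS).ne
    (ENNReal.rpow_lt_top_of_nonneg (sub_nonneg.2 hpq.le) hf.2.ne).ne
  have h : hSup n q (J g f) ≤ 256 * (S * hNorm n p f) ^ q := by
    refine iSup₂_le fun r hr => ?_
    calc ∫⁻ ζ, ‖J g f (r • ζ)‖ₑ ^ q ∂(sigmaS n)
        ≤ ∫⁻ ζ, S ^ q * hNorm n p f ^ (q - p) * radialMax p f ζ ∂(sigmaS n) := by
          refine lintegral_mono_ae ?_
          filter_upwards [ae_norm_eq_one_sigmaS n] with ζ hζ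
          exact enorm_J_rpow_le hn hp hpq hα hα1 hg hL hf hζ hr
      _ ≤ S ^ q * hNorm n p f ^ (q - p) * (256 * hNorm n p f ^ p) := by
          rw [lintegral_const_mul' _ _ hA, hNorm_rpow hp]
          exact mul_le_mul_right (lintegral_radialMax_le hn hp hf.1) _
      _ = 256 * (S * hNorm n p f) ^ q := by
          rw [ENNReal.mul_rpow_of_nonneg S _ hq.le]
          have : hNorm n p f ^ q = hNorm n p f ^ (q - p) * hNorm n p f ^ p := by
            rw [← ENNReal.rpow_add_of_nonneg _ _ (sub_nonneg.2 hpq.le) hp.le, sub_add_cancel]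
          rw [this]
          ring
  rw [hNorm_eq n q]
  refine (ENNReal.rpow_le_rpow h (by positivity)).trans_eq ?_
  rw [ENNReal.mul_rpow_of_nonneg _ _ (by positivity), ← ENNReal.rpow_mul,
    mul_one_div_cancel hq.ne', ENNReal.rpow_one]
  ring

/-- For `0 < p < q < ∞` with `α = n(1/p - 1/q) ≤ 1` and `g` holomorphic on
`B_n`, the operator `J_g : H^p → H^q` is bounded iff `g ∈ Λ(α)`, and the least admissible
constant is comparable to `‖g‖_{Λ(α)}`, with comparison constants depending only on
`n`, `p`, `q`. -/
theorem stmt1 (n : ℕ) (hn : 1 ≤ n) (p q α : ℝ) (hp : 0 < p) (hpq : p < q)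
    (hα : α = (n : ℝ) * (1 / p - 1 / q)) (hα1 : α ≤ 1) :
    ∃ c₁ c₂ : ℝ≥0∞, 0 < c₁ ∧ c₁ < ⊤ ∧ 0 < c₂ ∧ c₂ < ⊤ ∧
      ∀ g : En n → ℂ, DifferentiableOn ℂ g (Bn n) →
        (((∃ C : ℝ≥0∞, 0 < C ∧ C < ⊤ ∧
              ∀ f, MemHp n p f → hNorm n q (J g f) ≤ C * hNorm n p f) ↔
            lipNorm n α g < ⊤) ∧
          (∀ C : ℝ≥0∞, (∀ f, MemHp n p f → hNorm n q (J g f) ≤ C * hNorm n p f) →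
            lipNorm n α g ≤ c₁ * C) ∧
          (lipNorm n α g < ⊤ →
            ∀ f, MemHp n p f → hNorm n q (J g f) ≤ c₂ * lipNorm n α g * hNorm n p f)) := by
  have hq : 0 < q := hp.trans hpq
  set c₁ := ENNReal.ofReal (lowerConst n p q α) * kernelConst n ^ (1 / p) + 1 with hc₁
  set c₂ := 256 ^ (1 / q) * ENNReal.ofReal (upperConst n p q α) + 1 with hc₂
  have hc₁t : c₁ < ⊤ := by
    refine ENNReal.add_lt_top.2 ⟨ENNReal.mul_lt_top ENNReal.ofReal_lt_top ?_, ENNReal.one_lt_top⟩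
    exact ENNReal.rpow_lt_top_of_nonneg (by positivity) (kernelConst_ne_top n)
  have hc₂t : c₂ < ⊤ := by
    refine ENNReal.add_lt_top.2 ⟨ENNReal.mul_lt_top ?_ ENNReal.ofReal_lt_top, ENNReal.one_lt_top⟩
    exact ENNReal.rpow_lt_top_of_nonneg (by positivity) (by norm_num)
  have hc₁0 : 0 < c₁ := zero_lt_one.trans_le le_add_self
  have hc₂0 : 0 < c₂ := zero_lt_one.trans_le le_add_self
  refine ⟨c₁, c₂, hc₁0, hc₁t, hc₂0, hc₂t, fun g hg => ?_⟩
  have lower : ∀ C : ℝ≥0∞, (∀ f, MemHp n p f → hNorm n q (J g f) ≤ C * hNorm n p f) →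
      lipNorm n α g ≤ c₁ * C := by
    intro C h
    by_cases hC : C = ⊤
    · rw [hC, ENNReal.mul_top hc₁0.ne']; exact le_top
    · refine (lipNorm_le_of_bounded hn hp hpq hα hα1 hg hC h).trans ?_
      rw [mul_left_comm, mul_comm]
      exact mul_le_mul_left le_self_add C
  have upper : lipNorm n α g < ⊤ →
      ∀ f, MemHp n p f → hNorm n q (J g f) ≤ c₂ * lipNorm n α g * hNorm n p f := by
    intro hL f hf
    refine (hNorm_J_le hn hp hpq hα hα1 hg hL.ne hf).trans ?_
    gcongr
    exact le_self_add
  refine ⟨⟨?_, fun hL => ?_⟩, lower, upper⟩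
  · rintro ⟨C, -, hC, h⟩
    exact (lower C h).trans_lt (ENNReal.mul_lt_top hc₁t hC)
  · refine ⟨c₂ * lipNorm n α g + 1, zero_lt_one.trans_le le_add_self,
      ENNReal.add_lt_top.2 ⟨ENNReal.mul_lt_top hc₂t hL, ENNReal.one_lt_top⟩, fun f hf => ?_⟩
    refine (upper hL f hf).trans ?_
    gcongr
    exact le_self_add

end
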